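/- arXiv:1811.05793 — 3 statements merged into one kernel-verified Lean document; each statement's English description precedes it below -/
import Mathlib

section
/- For every δ > 0 there exists c > 0 such that the following holds for all integers n ≥ 2 and s ≥ 1 and every real number K with 2 ≤ K ≤ c·s/(log n)^3: the number of sets J ⊆ [n] with |J| = s and |J+J| ≤ K·s is at most 2^{δs} · binom(⌈Ks/2⌉, s). -/
open Pointwise

/-- The elements `y` of `A` for which `x + y` lies outside `B`. -/
def missing (A B : Finset ℤ) (x : ℤ) : Finset ℤ := A.filter fun y => x + y ∉ B

/-- The elements of `A` that have at least `ε * #A` missing sums. -/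
noncomputable def heavy (ε : ℝ) (A B : Finset ℤ) : Finset ℤ :=
  A.filter fun x => ε * A.card ≤ ((missing A B x).card : ℝ)

lemma two_mul_card_le_card_image_union {A : Finset ℤ} (hA : A.Nonempty) :
    2 * A.card ≤ (A.image (A.min' hA + ·) ∪ A.image (A.max' hA + ·)).card + 1 := by
  have h := Finset.card_union_add_card_inter (A.image (A.min' hA + ·)) (A.image (A.max' hA + ·))
  rw [Finset.card_image_of_injective _ (add_right_injective _),
    Finset.card_image_of_injective _ (add_right_injective _)] at h
  have hi : (A.image (A.min' hA + ·) ∩ A.image (A.max' hA + ·)).card ≤ 1 := by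
    rw [Finset.card_le_one_iff_subset_singleton]
    refine ⟨A.min' hA + A.max' hA, fun z hz => ?_⟩
    simp only [Finset.mem_inter, Finset.mem_image] at hz
    obtain ⟨⟨x, hx, hxz⟩, y, hy, hyz⟩ := hz
    have h1 := A.le_max' x hx
    have h2 := A.min'_le y hy
    simp only [Finset.mem_singleton]
    linarith
  omega

lemma card_le_of_card_heavy_lt {ε : ℝ} {A B : Finset ℤ}
    (h : ((heavy ε A B).card : ℝ) < ε * A.card) :
    (2 - 4 * ε) * A.card ≤ B.card + 1 := by
  have hsub : heavy ε A B ⊆ A := Finset.filter_subset _ _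
  by_cases hne : (A \ heavy ε A B).Nonempty
  · have hlight : ∀ x ∈ A \ heavy ε A B, ((missing A B x).card : ℝ) ≤ ε * A.card := by
      intro x hx
      simp only [heavy, Finset.mem_sdiff, Finset.mem_filter, not_and, not_le] at hx
      exact (hx.2 hx.1).le
    set A' := A \ heavy ε A B with hA'
    have h1 := two_mul_card_le_card_image_union hne
    set a := A'.min' hne
    set M := A'.max' hne
    have hcov : A'.image (a + ·) ∪ A'.image (M + ·) ⊆
        B ∪ ((missing A B a).image (a + ·) ∪ (missing A B M).image (M + ·)) := by
      intro z hz
      simp only [Finset.mem_union, Finset.mem_image, missing, Finset.mem_filter] at hz ⊢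
      by_cases hzB : z ∈ B
      · exact Or.inl hzB
      · right
        rcases hz with ⟨y, hy, rfl⟩ | ⟨y, hy, rfl⟩
        · exact Or.inl ⟨y, ⟨(Finset.mem_sdiff.1 hy).1, hzB⟩, rfl⟩
        · exact Or.inr ⟨y, ⟨(Finset.mem_sdiff.1 hy).1, hzB⟩, rfl⟩
    have h2 := (Finset.card_le_card hcov).trans (Finset.card_union_le _ _)
    have h3 := Finset.card_union_le ((missing A B a).image (a + ·))
      ((missing A B M).image (M + ·))
    have h4 := Finset.card_image_le (s := missing A B a) (f := (a + ·))
    have h5 := Finset.card_image_le (s := missing A B M) (f := (M + ·))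
    have h6 : 2 * A'.card ≤ B.card + ((missing A B a).card + (missing A B M).card) + 1 := by
      omega
    have h6' : (2 : ℝ) * A'.card ≤
        B.card + ((missing A B a).card + (missing A B M).card) + 1 := by exact_mod_cast h6
    have h7 := hlight a (A'.min'_mem hne)
    have h8 := hlight M (A'.max'_mem hne)
    have h9 : (A'.card : ℝ) + (heavy ε A B).card = A.card := by
      exact_mod_cast Finset.card_sdiff_add_card_eq_card hsub
    linarith
  · rw [Finset.not_nonempty_iff_eq_empty, Finset.sdiff_eq_empty_iff_subset] at hne
    have h1 : (A.card : ℝ) ≤ (heavy ε A B).card := by exact_mod_cast Finset.card_le_card hne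
    have h2 : (0 : ℝ) ≤ A.card := by positivity
    have h3 : (0 : ℝ) ≤ B.card := by positivity
    nlinarith

/-- The elements `y` of `A` such that `y + T` has at most `θ` elements outside `B`. -/
noncomputable def almostInside (θ : ℝ) (A B T : Finset ℤ) : Finset ℤ :=
  A.filter fun y => ((missing T B y).card : ℝ) ≤ θ

lemma exists_subset_missing_le (J T B : Finset ℤ) (hT : T ⊆ J) {θ : ℝ} (hθ : 0 < θ) :
    ∃ U ⊆ J, U.card * θ ≤ (J + J).card ∧
      ∀ y ∈ J, ((missing T (B ∪ (T + U)) y).card : ℝ) ≤ θ := by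
  classical
  obtain ⟨U, hU, hmax⟩ := Finset.exists_max_image
    (J.powerset.filter fun U => U.card * θ ≤ (((T + U) \ B).card : ℝ)) Finset.card
    ⟨∅, by simp⟩
  simp only [Finset.mem_filter, Finset.mem_powerset] at hU hmax
  refine ⟨U, hU.1, hU.2.trans ?_, fun y hy => ?_⟩
  · exact_mod_cast Finset.card_le_card
      (Finset.sdiff_subset.trans (Finset.add_subset_add hT hU.1))
  by_contra! hlt
  have hyU : y ∉ U := by
    intro hyU
    have : missing T (B ∪ (T + U)) y = ∅ := by
      refine Finset.filter_eq_empty_iff.2 fun x hx => ?_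
      simp only [not_not]
      rw [add_comm y x]
      exact Finset.mem_union_right _ (Finset.add_mem_add hx hyU)
    rw [this] at hlt
    simp at hlt
    linarith
  have hins : ((insert y U).card : ℝ) * θ ≤ (((T + insert y U) \ B).card : ℝ) := by
    have hsub : ((T + U) \ B) ∪ (missing T (B ∪ (T + U)) y).image (y + ·) ⊆
        (T + insert y U) \ B := by
      intro z hz
      simp only [Finset.mem_union, Finset.mem_image, missing, Finset.mem_filter, not_or,
        Finset.mem_sdiff] at hz ⊢
      rcases hz with hz | ⟨x, ⟨hx, hxB, -⟩, rfl⟩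
      · exact ⟨Finset.add_subset_add_left (Finset.subset_insert _ _) hz.1, hz.2⟩
      · refine ⟨?_, hxB⟩
        rw [add_comm y x]
        exact Finset.add_mem_add hx (Finset.mem_insert_self _ _)
    have hdisj : Disjoint ((T + U) \ B) ((missing T (B ∪ (T + U)) y).image (y + ·)) := by
      rw [Finset.disjoint_left]
      intro z hz hz'
      simp only [Finset.mem_image, missing, Finset.mem_filter, Finset.mem_union, not_or] at hz'
      obtain ⟨x, ⟨-, -, hx⟩, rfl⟩ := hz'
      exact hx (Finset.mem_sdiff.1 hz).1
    have h1 := Finset.card_le_card hsub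
    rw [Finset.card_union_of_disjoint hdisj,
      Finset.card_image_of_injective _ (add_right_injective _)] at h1
    have h1' : (((T + U) \ B).card : ℝ) + (missing T (B ∪ (T + U)) y).card ≤
      ((T + insert y U) \ B).card := by exact_mod_cast h1
    rw [Finset.card_insert_of_notMem hyU]
    push_cast
    linarith [hU.2]
  have := hmax (insert y U) ⟨Finset.insert_subset hy hU.1, hins⟩
  rw [Finset.card_insert_of_notMem hyU] at this
  omega

lemma sum_card_missing_le {A B B' T : Finset ℤ} (hB : B ⊆ B') (θ : ℝ) :
    ((∑ x ∈ T, (missing A B x).card : ℕ) : ℝ) ≤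
      T.card * (A.card - (almostInside θ A B' T).card) + θ * (almostInside θ A B' T).card +
        T.card * (B'.card - B.card) := by
  have hx : ∀ x ∈ T, (missing A B x).card ≤
      (missing (A \ almostInside θ A B' T) B' x).card +
        (missing (almostInside θ A B' T) B' x).card + (B' \ B).card := by
    intro x _
    have hcov : (missing A B x).image (x + ·) ⊆
        ((missing (A \ almostInside θ A B' T) B' x) ∪
          (missing (almostInside θ A B' T) B' x)).image (x + ·) ∪ (B' \ B) := by
      intro z hz
      simp only [missing, Finset.mem_image, Finset.mem_filter, Finset.mem_union,
        Finset.mem_sdiff] at hz ⊢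
      obtain ⟨y, ⟨hy, hyB⟩, rfl⟩ := hz
      by_cases hz' : x + y ∈ B'
      · exact Or.inr ⟨hz', hyB⟩
      · refine Or.inl ⟨y, ?_, rfl⟩
        tauto
    have := Finset.card_le_card hcov
    rw [Finset.card_image_of_injective _ (add_right_injective _)] at this
    refine this.trans ((Finset.card_union_le _ _).trans ?_)
    rw [Finset.card_image_of_injective _ (add_right_injective _)]
    gcongr
    exact Finset.card_union_le _ _
  have h1 : ∑ x ∈ T, (missing (A \ almostInside θ A B' T) B' x).card ≤
      T.card * (A \ almostInside θ A B' T).card := by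
    rw [← smul_eq_mul]
    exact Finset.sum_le_card_nsmul _ _ _ fun x _ => Finset.card_filter_le _ _
  have h2 : ((∑ x ∈ T, (missing (almostInside θ A B' T) B' x).card : ℕ) : ℝ) ≤
      θ * (almostInside θ A B' T).card := by
    have : ∑ x ∈ T, (missing (almostInside θ A B' T) B' x).card =
        ∑ y ∈ almostInside θ A B' T, (missing T B' y).card := by
      have := Finset.sum_card_bipartiteAbove_eq_sum_card_bipartiteBelow
        (s := T) (t := almostInside θ A B' T) (fun x y => x + y ∉ B')
      simpa only [Finset.bipartiteAbove, Finset.bipartiteBelow, missing, add_comm] using this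
    rw [this, mul_comm, ← nsmul_eq_mul]
    push_cast
    exact Finset.sum_le_card_nsmul _ _ _ fun y hy => (Finset.mem_filter.1 hy).2
  have h3 := Finset.sum_le_sum hx
  rw [Finset.sum_add_distrib, Finset.sum_add_distrib, Finset.sum_const, smul_eq_mul] at h3
  have h4 : ((A \ almostInside θ A B' T).card : ℝ) + (almostInside θ A B' T).card = A.card := by
    exact_mod_cast Finset.card_sdiff_add_card_eq_card (Finset.filter_subset _ _)
  have h5 : ((B' \ B).card : ℝ) + B.card = B'.card := by
    exact_mod_cast Finset.card_sdiff_add_card_eq_card hB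
  rw [← h4, ← h5]
  have h3' := (Nat.cast_le (α := ℝ)).2 h3
  have h1' := (Nat.cast_le (α := ℝ)).2 h1
  push_cast at h3' h1' h2 ⊢
  linarith

lemma card_powerset_filter_card_le (X : Finset ℤ) (q : ℕ) :
    (X.powerset.filter fun T => T.card ≤ q).card ≤ (X.card + 1) ^ q := by
  classical
  induction q with
  | zero =>
    rw [pow_zero, Finset.card_le_one]
    intro a ha b hb
    simp_all
  | succ q ih =>
    have hcov : (X.powerset.filter fun T => T.card ≤ q + 1) ⊆
        ((X.powerset.filter fun T => T.card ≤ q) ×ˢ X.insertNone).image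
          fun p => p.2.elim p.1 fun a => insert a p.1 := by
      intro T hT
      simp only [Finset.mem_filter, Finset.mem_powerset] at hT
      simp only [Finset.mem_image, Finset.mem_product, Finset.mem_filter, Finset.mem_powerset,
        Prod.exists]
      rcases T.eq_empty_or_nonempty with rfl | ⟨a, ha⟩
      · exact ⟨∅, none, by simp⟩
      · refine ⟨T.erase a, some a, ⟨⟨(Finset.erase_subset _ _).trans hT.1, ?_⟩, ?_⟩, ?_⟩
        · rw [Finset.card_erase_of_mem ha]; omega
        · simpa using hT.1 ha
        · simpa using Finset.insert_erase ha
    refine (Finset.card_le_card hcov).trans (Finset.card_image_le.trans ?_)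
    rw [Finset.card_product, Finset.card_insertNone, pow_succ]
    gcongr

/-- The subsets of `X` with at most `q` elements. -/
def smallSubsets (X : Finset ℤ) (q : ℕ) : Finset (Finset ℤ) := X.powerset.filter fun T => T.card ≤ q

/-- The pair of sets replacing `(A, B)` for the fingerprint `(T, U)`. -/
noncomputable def refinePair (ε : ℝ) (b : ℕ) (A B T U : Finset ℤ) : Finset ℤ × Finset ℤ :=
  if T.card < b then (A \ heavy ε A B ∪ T, B)
  else (almostInside (ε / 2 * b) A (B ∪ (T + U)) T, B ∪ (T + U))

lemma exists_refinePair {X J A B : Finset ℤ} {ε m : ℝ} {b q : ℕ} (hε : 0 < ε) (hb : 0 < b)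
    (hbq : b ≤ q) (hq : m ≤ q * (ε / 2 * b)) (hbA : b ≤ ε / 2 * A.card)
    (hH : ε * A.card ≤ ((heavy ε A B).card : ℝ)) (hJX : J ⊆ X) (hJm : ((J + J).card : ℝ) ≤ m)
    (hJA : J ⊆ A) (hBJ : B ⊆ J + J) :
    ∃ T ∈ smallSubsets X q, ∃ U ∈ smallSubsets X q,
      J ⊆ (refinePair ε b A B T U).1 ∧ (refinePair ε b A B T U).2 ⊆ J + J ∧
      ((refinePair ε b A B T U).1.card : ℝ) - (refinePair ε b A B T U).2.card ≤
        A.card - B.card - ε / 2 * A.card := by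
  have hb' : (0 : ℝ) < b := by exact_mod_cast hb
  simp only [smallSubsets, Finset.mem_filter, Finset.mem_powerset]
  by_cases hT : (J ∩ heavy ε A B).card < b
  · refine ⟨J ∩ heavy ε A B, ⟨Finset.inter_subset_left.trans hJX, hT.le.trans hbq⟩, ∅,
      ⟨Finset.empty_subset _, by simp⟩, ?_⟩
    rw [refinePair, if_pos hT]
    refine ⟨fun x hx => ?_, hBJ, ?_⟩
    · have := hJA hx
      simp only [Finset.mem_union, Finset.mem_sdiff, Finset.mem_inter]
      tauto
    · have h1 : ((A \ heavy ε A B).card : ℝ) + (heavy ε A B).card = A.card := by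
        exact_mod_cast Finset.card_sdiff_add_card_eq_card (Finset.filter_subset _ _)
      have h2 : ((A \ heavy ε A B ∪ J ∩ heavy ε A B).card : ℝ) ≤ (A \ heavy ε A B).card + b := by
        exact_mod_cast (Finset.card_union_le _ _).trans (by omega)
      dsimp only
      linarith
  · obtain ⟨T, hTJ, hTb⟩ := Finset.exists_subset_card_eq (not_lt.1 hT)
    have hTJ' : T ⊆ J := hTJ.trans Finset.inter_subset_left
    obtain ⟨U, hUJ, hU, hUA⟩ := exists_subset_missing_le J T B hTJ' (θ := ε / 2 * b) (by positivity)
    refine ⟨T, ⟨hTJ'.trans hJX, hTb.le.trans hbq⟩, U, ⟨hUJ.trans hJX, ?_⟩, ?_⟩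
    · exact_mod_cast le_of_mul_le_mul_right ((hU.trans hJm).trans hq) (by positivity)
    rw [refinePair, if_neg hTb.not_lt]
    refine ⟨fun x hx => Finset.mem_filter.2 ⟨hJA hx, hUA x hx⟩,
      Finset.union_subset hBJ (Finset.add_subset_add hTJ' hUJ), ?_⟩
    have h1 := sum_card_missing_le (A := A) (T := T)
      (Finset.subset_union_left (s₁ := B) (s₂ := T + U)) (ε / 2 * b)
    have h2 : (b : ℝ) * (ε * A.card) ≤ ((∑ x ∈ T, (missing A B x).card : ℕ) : ℝ) := by
      rw [← hTb, ← nsmul_eq_mul]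
      push_cast
      exact Finset.card_nsmul_le_sum _ _ _ fun x hx =>
        (Finset.mem_filter.1 (Finset.mem_inter.1 (hTJ hx)).2).2
    dsimp only
    set A' := almostInside (ε / 2 * b) A (B ∪ (T + U)) T
    have h3 : (A'.card : ℝ) ≤ A.card := by exact_mod_cast Finset.card_filter_le _ _
    have h4 : ε / 2 * A'.card ≤ ε / 2 * A.card := by gcongr
    rw [hTb] at h1
    have h5 : (b : ℝ) * (ε * A.card) ≤ b * ((A.card - A'.card) + ε / 2 * A'.card +
        ((B ∪ (T + U)).card - B.card)) := by linarith
    have h6 := le_of_mul_le_mul_left h5 hb'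
    linarith

lemma exists_containers_of_pair {X : Finset ℤ} {ε m M : ℝ} {b q : ℕ} (hε : 0 < ε) (hb : 0 < b)
    (hbq : b ≤ q) (hq : m ≤ q * (ε / 2 * b)) (hbM : b ≤ ε / 2 * M)
    (hM : m + 1 ≤ (2 - 4 * ε) * M) (hε' : ε < 1 / 2) (k : ℕ) :
    ∀ A B : Finset ℤ, (A.card : ℝ) - B.card ≤ k * (ε / 2 * M) - m →
      ∃ C : Finset (Finset ℤ), C.card ≤ ((smallSubsets X q).card ^ 2) ^ k ∧
        (∀ D ∈ C, (D.card : ℝ) ≤ M) ∧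
        ∀ J ⊆ X, ((J + J).card : ℝ) ≤ m → J ⊆ A → B ⊆ J + J → ∃ D ∈ C, J ⊆ D := by
  classical
  have hS : 0 < (smallSubsets X q).card :=
    Finset.card_pos.2 ⟨∅, by simp [smallSubsets]⟩
  have hM0 : 0 < M := by
    have : (0 : ℝ) < b := by exact_mod_cast hb
    by_contra! h
    nlinarith
  have hsmall : ∀ k : ℕ, ∀ A B : Finset ℤ, (A.card : ℝ) ≤ M →
      ∃ C : Finset (Finset ℤ), C.card ≤ ((smallSubsets X q).card ^ 2) ^ k ∧
        (∀ D ∈ C, (D.card : ℝ) ≤ M) ∧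
        ∀ J ⊆ X, ((J + J).card : ℝ) ≤ m → J ⊆ A → B ⊆ J + J → ∃ D ∈ C, J ⊆ D := by
    intro k A B hA
    refine ⟨{A}, ?_, by simpa using hA, fun J _ _ hJA _ => ⟨A, by simp, hJA⟩⟩
    rw [Finset.card_singleton]
    exact Nat.one_le_iff_ne_zero.2 (by positivity)
  induction k with
  | zero =>
    intro A B hAB
    by_cases hA : (A.card : ℝ) ≤ M
    · exact hsmall 0 A B hA
    refine ⟨∅, by simp, by simp, fun J _ hJm _ hBJ => absurd ?_ hA⟩
    have : (B.card : ℝ) ≤ (J + J).card := by exact_mod_cast Finset.card_le_card hBJ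
    push_cast at hAB
    linarith
  | succ k ih =>
    intro A B hAB
    by_cases hA : (A.card : ℝ) ≤ M
    · exact hsmall _ A B hA
    push Not at hA
    by_cases hB : (B.card : ℝ) ≤ m
    swap
    · refine ⟨∅, by simp, by simp, fun J _ hJm _ hBJ => absurd ?_ hB⟩
      have : (B.card : ℝ) ≤ (J + J).card := by exact_mod_cast Finset.card_le_card hBJ
      linarith
    have hH : ε * A.card ≤ ((heavy ε A B).card : ℝ) := by
      by_contra! h
      have h1 := card_le_of_card_heavy_lt h
      nlinarith
    have hεA : ε / 2 * M ≤ ε / 2 * A.card := by gcongr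
    have hC : ∀ p : Finset ℤ × Finset ℤ, ∃ C : Finset (Finset ℤ),
        C.card ≤ ((smallSubsets X q).card ^ 2) ^ k ∧ (∀ D ∈ C, (D.card : ℝ) ≤ M) ∧
        ∀ J ⊆ X, ((J + J).card : ℝ) ≤ m → J ⊆ (refinePair ε b A B p.1 p.2).1 →
          (refinePair ε b A B p.1 p.2).2 ⊆ J + J →
          ((refinePair ε b A B p.1 p.2).1.card : ℝ) - (refinePair ε b A B p.1 p.2).2.card ≤
            A.card - B.card - ε / 2 * A.card → ∃ D ∈ C, J ⊆ D := by
      intro p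
      by_cases hp : ((refinePair ε b A B p.1 p.2).1.card : ℝ) -
          (refinePair ε b A B p.1 p.2).2.card ≤ A.card - B.card - ε / 2 * A.card
      · obtain ⟨C, h1, h2, h3⟩ := ih _ _ (hp.trans (by push_cast at hAB; linarith))
        exact ⟨C, h1, h2, fun J h4 h5 h6 h7 _ => h3 J h4 h5 h6 h7⟩
      · exact ⟨∅, by simp, by simp, fun J _ _ _ _ h => absurd h hp⟩
    choose C hC1 hC2 hC3 using hC
    refine ⟨(smallSubsets X q ×ˢ smallSubsets X q).biUnion C, ?_, ?_, ?_⟩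
    · refine (Finset.card_biUnion_le_card_mul _ _ _ fun p _ => hC1 p).trans ?_
      rw [Finset.card_product, pow_succ' (_ ^ 2), sq]
    · simp only [Finset.mem_biUnion]
      rintro D ⟨p, -, hD⟩
      exact hC2 p D hD
    · intro J hJX hJm hJA hBJ
      obtain ⟨T, hT, U, hU, h1, h2, h3⟩ :=
        exists_refinePair hε hb hbq hq (hbM.trans hεA) hH hJX hJm hJA hBJ
      obtain ⟨D, hD, hJD⟩ := hC3 (T, U) J hJX hJm h1 h2 h3
      exact ⟨D, Finset.mem_biUnion.2 ⟨(T, U), Finset.mk_mem_product hT hU, hD⟩, hJD⟩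

lemma exists_containers {X : Finset ℤ} {ε m M : ℝ} {b q k : ℕ} (hε : 0 < ε) (hb : 0 < b)
    (hbq : b ≤ q) (hq : m ≤ q * (ε / 2 * b)) (hbM : b ≤ ε / 2 * M)
    (hM : m + 1 ≤ (2 - 4 * ε) * M) (hε' : ε < 1 / 2) (hk : 2 * m ≤ k * (ε / 2 * M)) :
    ∃ C : Finset (Finset ℤ), C.card ≤ ((smallSubsets X q).card ^ 2) ^ (k + 1) ∧
      (∀ D ∈ C, (D.card : ℝ) ≤ M) ∧
      ∀ J ⊆ X, ((J + J).card : ℝ) ≤ m → b ≤ J.card → ∃ D ∈ C, J ⊆ D := by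
  classical
  have hb' : (0 : ℝ) < b := by exact_mod_cast hb
  have hC : ∀ p : Finset ℤ × Finset ℤ, ∃ C : Finset (Finset ℤ),
      C.card ≤ ((smallSubsets X q).card ^ 2) ^ k ∧ (∀ D ∈ C, (D.card : ℝ) ≤ M) ∧
      ∀ J ⊆ X, ((J + J).card : ℝ) ≤ m → J ⊆ almostInside (ε / 2 * b) X (p.1 + p.2) p.1 →
        p.1 + p.2 ⊆ J + J → p.1.card = b → ∃ D ∈ C, J ⊆ D := by
    rintro ⟨T, U⟩
    dsimp only
    by_cases hp : T.card = b ∧ ((T + U).card : ℝ) ≤ m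
    · obtain ⟨hTb, hTU⟩ := hp
      have h1 := sum_card_missing_le (A := X) (T := T) (Finset.empty_subset (T + U)) (ε / 2 * b)
      have h2 : ∀ x, missing X ∅ x = X := fun x => by simp [missing]
      simp only [h2, Finset.sum_const, smul_eq_mul, hTb, Finset.card_empty] at h1
      set A := almostInside (ε / 2 * b) X (T + U) T with hA
      have h3 : (b : ℝ) * (A.card - ε / 2 * A.card) ≤ b * (T + U).card := by
        push_cast at h1
        linarith
      have h4 := le_of_mul_le_mul_left h3 hb'
      have h5 : ε / 2 * A.card ≤ 1 / 2 * A.card := by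
        gcongr; linarith
      obtain ⟨C, h6, h7, h8⟩ := exists_containers_of_pair (X := X) hε hb hbq hq hbM hM hε' k
        A (T + U) (by linarith)
      exact ⟨C, h6, h7, fun J h9 h10 h11 h12 _ => h8 J h9 h10 h11 h12⟩
    · refine ⟨∅, by simp, by simp, fun J _ hJm _ hTU hTb => absurd ⟨hTb, ?_⟩ hp⟩
      refine le_trans ?_ hJm
      exact_mod_cast Finset.card_le_card hTU
  choose C hC1 hC2 hC3 using hC
  refine ⟨(smallSubsets X q ×ˢ smallSubsets X q).biUnion C, ?_, ?_, ?_⟩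
  · refine (Finset.card_biUnion_le_card_mul _ _ _ fun p _ => hC1 p).trans ?_
    rw [Finset.card_product, pow_succ' (_ ^ 2), sq]
  · simp only [Finset.mem_biUnion]
    rintro D ⟨p, -, hD⟩
    exact hC2 p D hD
  · intro J hJX hJm hJb
    obtain ⟨T, hTJ, hTb⟩ := Finset.exists_subset_card_eq hJb
    obtain ⟨U, hUJ, hU, hUA⟩ := exists_subset_missing_le J T ∅ hTJ (θ := ε / 2 * b) (by positivity)
    rw [Finset.empty_union] at hUA
    obtain ⟨D, hD, hJD⟩ := hC3 (T, U) J hJX hJm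
      (fun x hx => Finset.mem_filter.2 ⟨hJX hx, hUA x hx⟩) (Finset.add_subset_add hTJ hUJ) hTb
    refine ⟨D, Finset.mem_biUnion.2 ⟨(T, U), Finset.mk_mem_product ?_ ?_, hD⟩, hJD⟩
    · simp only [smallSubsets, Finset.mem_filter, Finset.mem_powerset]
      exact ⟨hTJ.trans hJX, hTb.le.trans hbq⟩
    · simp only [smallSubsets, Finset.mem_filter, Finset.mem_powerset]
      refine ⟨hUJ.trans hJX, ?_⟩
      exact_mod_cast le_of_mul_le_mul_right ((hU.trans hJm).trans hq) (by positivity)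

lemma card_le_card_containers_mul_choose {C : Finset (Finset ℤ)} {N s : ℕ}
    (hC : ∀ D ∈ C, D.card ≤ N) {F : Set (Finset ℤ)} (hF : ∀ J ∈ F, J.card = s ∧ ∃ D ∈ C, J ⊆ D) :
    Nat.card F ≤ C.card * N.choose s := by
  classical
  have hsub : F ⊆ (C.biUnion fun D => D.powersetCard s : Finset (Finset ℤ)) := by
    intro J hJ
    obtain ⟨hJs, D, hD, hJD⟩ := hF J hJ
    simp only [Finset.coe_biUnion, Set.mem_iUnion, Finset.mem_coe, Finset.mem_powersetCard]
    exact ⟨D, hD, hJD, hJs⟩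
  rw [Nat.card_coe_set_eq]
  refine (Set.ncard_le_ncard hsub (Finset.finite_toSet _)).trans ?_
  rw [Set.ncard_coe_finset]
  refine Finset.card_biUnion_le_card_mul _ _ _ fun D hD => ?_
  rw [Finset.card_powersetCard]
  exact Nat.choose_le_choose s (hC D hD)

lemma choose_add_le_choose_mul_choose {N s : ℕ} (hs : s ≤ N) (k : ℕ) :
    (N + k).choose s ≤ (s + k).choose s * N.choose s := by
  obtain ⟨d, rfl⟩ := Nat.exists_eq_add_of_le hs
  induction k with
  | zero => simp
  | succ k ih =>
    have h1 := Nat.choose_mul_succ_eq (s + d + k) s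
    have h2 := Nat.choose_mul_succ_eq (s + k) s
    rw [show s + d + k + 1 - s = d + k + 1 by omega] at h1
    rw [show s + k + 1 - s = k + 1 by omega] at h2
    have hpos : 0 < (d + k + 1) * (k + 1) := by positivity
    refine Nat.le_of_mul_le_mul_right ?_ hpos
    calc (s + d + (k + 1)).choose s * ((d + k + 1) * (k + 1))
        = (s + d + k).choose s * (s + d + k + 1) * (k + 1) := by rw [h1]; ring_nf
      _ ≤ (s + k).choose s * (s + d).choose s * ((s + d + k + 1) * (k + 1)) := by
          rw [mul_assoc]; gcongr
      _ ≤ (s + k).choose s * (s + d).choose s * ((s + k + 1) * (d + k + 1)) := by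
          refine Nat.mul_le_mul_left _ ?_
          nlinarith [Nat.zero_le (s * d)]
      _ = (s + k).choose s * (s + k + 1) * ((s + d).choose s * (d + k + 1)) := by ring
      _ = _ := by rw [h2]; ring_nf

lemma descFactorial_add_le {N k : ℕ} {t : ℝ} (ht : 0 ≤ t) (s : ℕ) (h : (k : ℝ) ≤ t * (N - s))
    (hs : s ≤ N) :
    ((N + k).descFactorial s : ℝ) ≤ (1 + t) ^ s * N.descFactorial s := by
  induction s with
  | zero => simp
  | succ s ih =>
    push_cast at h
    have hk : (k : ℝ) ≤ t * (N - s) := by nlinarith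
    rw [Nat.descFactorial_succ, Nat.descFactorial_succ, pow_succ]
    push_cast [Nat.cast_sub (show s ≤ N + k by omega), Nat.cast_sub (show s ≤ N by omega)]
    have h1 : (N : ℝ) + k - s ≤ (1 + t) * (N - s) := by linarith
    have h2 : (0 : ℝ) ≤ N + k - s := by
      have : (s : ℝ) ≤ N := by exact_mod_cast (by omega : s ≤ N)
      have : (0 : ℝ) ≤ k := by positivity
      linarith
    calc ((N : ℝ) + k - s) * (N + k).descFactorial s
        ≤ ((1 + t) * (N - s)) * ((1 + t) ^ s * N.descFactorial s) :=
          mul_le_mul h1 (ih hk (by omega)) (by positivity) (h2.trans h1)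
      _ = _ := by ring

lemma choose_add_le_exp_mul_choose {η : ℝ} (hη : 0 < η) :
    ∃ γ : ℝ, 0 < γ ∧ ∀ N k s : ℕ, s ≤ N → (k : ℝ) ≤ γ * N →
      ((N + k).choose s : ℝ) ≤ Real.exp (η * s) * N.choose s := by
  have hlog : 0 < Real.log (1 + 2 / η) := Real.log_pos (by simp [hη])
  refine ⟨min (η / 2) (η / 4 / Real.log (1 + 2 / η)), by positivity, fun N k s hs hk => ?_⟩
  have hN : (0 : ℝ) ≤ N := by positivity
  have hs0 : (0 : ℝ) ≤ s := by positivity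
  rcases le_or_gt (2 * s) N with h | h
  · have h' : 2 * (s : ℝ) ≤ N := by exact_mod_cast h
    have h1 : (k : ℝ) ≤ η / 2 * N := hk.trans (by gcongr; exact min_le_left _ _)
    have h2 := descFactorial_add_le (N := N) (k := k) hη.le s (by nlinarith) hs
    rw [Nat.descFactorial_eq_factorial_mul_choose, Nat.descFactorial_eq_factorial_mul_choose] at h2
    push_cast at h2
    have h3 : (1 + η) ^ s ≤ Real.exp (η * s) := by
      rw [mul_comm, Real.exp_nat_mul]
      gcongr
      linarith [Real.add_one_le_exp η]
    have hf : (0 : ℝ) < s.factorial := by exact_mod_cast s.factorial_pos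
    have h4 : (s.factorial : ℝ) * (N + k).choose s ≤
        s.factorial * ((1 + η) ^ s * N.choose s) := by linarith
    refine (le_of_mul_le_mul_left h4 hf).trans ?_
    gcongr
  · have h' : (N : ℝ) ≤ 2 * s := by exact_mod_cast h.le
    have h1 : (k : ℝ) ≤ η / 4 / Real.log (1 + 2 / η) * (2 * s) :=
      hk.trans (mul_le_mul (min_le_right _ _) h' hN (by positivity))
    have h2 : k * Real.log (1 + 2 / η) ≤ η / 2 * s := by
      calc k * Real.log (1 + 2 / η)
          ≤ η / 4 / Real.log (1 + 2 / η) * (2 * s) * Real.log (1 + 2 / η) := by gcongr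
        _ = η / 2 * s := by
          generalize Real.log (1 + 2 / η) = l at hlog
          field_simp
          ring
    have h3 : ((s + k).choose s : ℝ) ≤ Real.exp (η * s) := by
      have h4 : (η / 2) ^ k * ((s + k).choose s : ℝ) ≤ (1 + η / 2) ^ (s + k) := by
        rw [add_pow]
        have := Finset.single_le_sum
          (f := fun i => (1 : ℝ) ^ i * (η / 2) ^ (s + k - i) * ((s + k).choose i : ℝ))
          (s := Finset.range (s + k + 1)) (fun i _ => by positivity)
          (Finset.mem_range.2 (by omega : s < s + k + 1))
        simpa using this
      have h5 : (1 + η / 2) ^ (s + k) = (η / 2) ^ k * ((1 + η / 2) ^ s * (1 + 2 / η) ^ k) := by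
        rw [pow_add, mul_left_comm, ← mul_pow]
        congr 2
        field_simp
        ring
      rw [h5] at h4
      refine (le_of_mul_le_mul_left h4 (by positivity)).trans ?_
      calc (1 + η / 2) ^ s * (1 + 2 / η) ^ k
          ≤ Real.exp (η / 2) ^ s * Real.exp (Real.log (1 + 2 / η)) ^ k := by
            rw [Real.exp_log (by positivity)]
            gcongr
            linarith [Real.add_one_le_exp (η / 2)]
        _ = Real.exp (s * (η / 2) + k * Real.log (1 + 2 / η)) := by
            rw [Real.exp_add, Real.exp_nat_mul, Real.exp_nat_mul]
        _ ≤ Real.exp (η * s) := by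
            gcongr
            linarith
    calc ((N + k).choose s : ℝ) ≤ (s + k).choose s * N.choose s := by
          exact_mod_cast choose_add_le_choose_mul_choose hs k
      _ ≤ _ := by gcongr

lemma exists_containers_interval {n k : ℕ} (hn : 2 ≤ n) {ε r : ℝ} (hε0 : 0 < ε)
    (hε1 : ε ≤ 1 / 8) (hr0 : 0 < r) (hεr : 8 ≤ ε * r) (hkε : 8 ≤ k * ε) :
    ∃ C : Finset (Finset ℤ), (C.card : ℝ) ≤ Real.exp (16 / ε * (k + 1) * (r * Real.log n)) ∧
      (∀ D ∈ C, (D.card : ℝ) ≤ (r ^ 2 + 1) / (2 - 4 * ε)) ∧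
      ∀ J ⊆ Finset.Icc 1 (n : ℤ), ((J + J).card : ℝ) ≤ r ^ 2 → 2 * r ≤ J.card →
        ∃ D ∈ C, J ⊆ D := by
  have hr1 : 1 ≤ r := by nlinarith
  obtain ⟨b, hb⟩ : ∃ b, b = ⌈r⌉₊ := ⟨_, rfl⟩
  have hbr : r ≤ b := by rw [hb]; exact Nat.le_ceil _
  have hbr2 : b ≤ 2 * r := by
    rw [hb]
    linarith [Nat.ceil_lt_add_one hr0.le]
  obtain ⟨q, hq⟩ : ∃ q, q = ⌈2 / ε * r⌉₊ := ⟨_, rfl⟩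
  have hqr : 2 / ε * r ≤ q := by rw [hq]; exact Nat.le_ceil _
  have h2ε : 16 ≤ 2 / ε := by
    rw [le_div_iff₀ hε0]
    linarith
  have h2r : 2 * r ≤ 2 / ε * r := by
    gcongr
    linarith
  have hqr2 : q ≤ 4 / ε * r := by
    rw [hq]
    have h1 := Nat.ceil_lt_add_one (show 0 ≤ 2 / ε * r by positivity)
    have h3 : 4 / ε * r = 2 / ε * r + 2 / ε * r := by ring
    linarith
  have hbq : b ≤ q := by
    have : (b : ℝ) ≤ q := hbr2.trans (h2r.trans hqr)
    exact_mod_cast this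
  have hmq : r ^ 2 ≤ q * (ε / 2 * b) := by
    calc r ^ 2 = 2 / ε * r * (ε / 2 * r) := by field_simp
      _ ≤ q * (ε / 2 * b) := by gcongr
  obtain ⟨M, hM⟩ : ∃ M, M = (r ^ 2 + 1) / (2 - 4 * ε) := ⟨_, rfl⟩
  have hden : 0 < 2 - 4 * ε := by linarith
  have hMr : r ^ 2 / 2 ≤ M := by
    rw [hM, le_div_iff₀ hden]
    nlinarith [sq_nonneg r]
  have hM' : r ^ 2 + 1 = (2 - 4 * ε) * M := by
    rw [hM]
    field_simp
  have hεM : ε * r * r / 4 ≤ ε / 2 * M := by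
    calc ε * r * r / 4 = ε / 2 * (r ^ 2 / 2) := by ring
      _ ≤ ε / 2 * M := by gcongr
  have hεrr : 8 * r ≤ ε * r * r := by gcongr
  have hkM : 2 * r ^ 2 ≤ k * (ε / 2 * M) := by
    calc 2 * r ^ 2 = 8 * (r ^ 2 / 4) := by ring
      _ ≤ k * ε * (r ^ 2 / 4) := by gcongr
      _ = k * (ε * r * r / 4) := by ring
      _ ≤ _ := by gcongr
  obtain ⟨C, hCcard, hCM, hC⟩ := exists_containers (X := Finset.Icc 1 (n : ℤ)) (ε := ε)
    (m := r ^ 2) (M := M) (b := b) (q := q) (k := k) hε0 (by exact_mod_cast hr0.trans_le hbr)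
    hbq hmq (by linarith) hM'.le (by linarith) hkM
  refine ⟨C, ?_, hM ▸ hCM, fun J hJ hJr hrJ => hC J hJ hJr (by exact_mod_cast hbr2.trans hrJ)⟩
  have h1 : C.card ≤ (((n + 1) ^ q) ^ 2) ^ (k + 1) := by
    refine hCcard.trans ?_
    gcongr
    simpa [smallSubsets] using card_powerset_filter_card_le (Finset.Icc 1 (n : ℤ)) q
  have h3 : (2 : ℝ) ≤ n := by exact_mod_cast hn
  have hL : 0 ≤ Real.log n := Real.log_nonneg (by linarith)
  have h2 : ((n : ℝ) + 1) ≤ Real.exp (2 * Real.log n) := by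
    rw [two_mul, Real.exp_add, Real.exp_log (by linarith)]
    nlinarith
  calc (C.card : ℝ) ≤ ((((n : ℝ) + 1) ^ q) ^ 2) ^ (k + 1) := by exact_mod_cast h1
    _ ≤ (((Real.exp (2 * Real.log n)) ^ q) ^ 2) ^ (k + 1) := by gcongr
    _ = Real.exp (4 * (k + 1) * Real.log n * q) := by
        rw [← pow_mul, ← pow_mul, ← Real.exp_nat_mul]
        push_cast
        ring_nf
    _ ≤ Real.exp (4 * (k + 1) * Real.log n * (4 / ε * r)) := by gcongr
    _ = _ := by ring_nf

lemma sqrt_bounds {K L c s ε θ : ℝ} (hK : 2 ≤ K) (hs : 0 < s) (hL : 1 / 2 ≤ L) (hε0 : 0 < ε)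
    (hε1 : ε ≤ 1 / 8) (hθ : 0 < θ) (hc0 : 0 < c) (hc1 : c ≤ ε ^ 2 / 128) (hc2 : 2 * c ≤ θ ^ 2)
    (h : K * L ^ 3 ≤ c * s) :
    32 ≤ ε ^ 2 * s ∧ 8 ≤ ε * √(K * s) ∧ 2 * √(K * s) ≤ s ∧ √(K * s) * L ≤ θ * s := by
  have hKL : K * L ^ 2 ≤ 2 * c * s := by
    have h1 : K * L ^ 2 * (1 / 2) ≤ K * L ^ 2 * L := by gcongr
    linarith
  have hL2 : 1 / 4 ≤ L ^ 2 := by nlinarith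
  have hK4 : K * (1 / 4) ≤ 2 * c * s := le_trans (by gcongr) hKL
  have hcs : c * s ≤ ε ^ 2 / 128 * s := by gcongr
  have hs_large : 32 ≤ ε ^ 2 * s := by linarith
  have hKs : 0 ≤ K * s := by positivity
  refine ⟨hs_large, ?_, ?_, ?_⟩
  · refine le_of_sq_le_sq ?_ (by positivity)
    rw [mul_pow, Real.sq_sqrt hKs]
    have : 2 * (ε ^ 2 * s) ≤ K * (ε ^ 2 * s) := by gcongr
    linarith
  · refine le_of_sq_le_sq ?_ hs.le
    rw [mul_pow, Real.sq_sqrt hKs]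
    have h1 : ε ^ 2 ≤ 1 := by nlinarith
    have h2 : c ≤ 1 / 128 := by linarith
    have h3 : K ≤ 1 / 4 * s := by nlinarith
    calc 2 ^ 2 * (K * s) ≤ 2 ^ 2 * (1 / 4 * s * s) := by gcongr
      _ = s ^ 2 := by ring
  · refine le_of_sq_le_sq ?_ (by positivity)
    calc (√(K * s) * L) ^ 2 = K * L ^ 2 * s := by rw [mul_pow, Real.sq_sqrt hKs]; ring
      _ ≤ 2 * c * s * s := by gcongr
      _ ≤ θ ^ 2 * s * s := by gcongr
      _ = (θ * s) ^ 2 := by ring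

/-- For every `δ > 0` there exists `c > 0` such that for all integers
`n ≥ 2`, `s ≥ 1` and every real `K` with `2 ≤ K ≤ c·s/(log n)^3`, the number of sets
`J ⊆ [n]` with `|J| = s` and `|J+J| ≤ K·s` is at most `2^(δs) · binom(⌈Ks/2⌉, s)`. -/
theorem number_of_sets_with_small_doubling_int :
    ∀ δ : ℝ, 0 < δ → ∃ c : ℝ, 0 < c ∧
      ∀ n s : ℕ, 2 ≤ n → 1 ≤ s →
      ∀ K : ℝ, 2 ≤ K → K ≤ c * s / (Real.log n) ^ 3 →
      (Nat.card {J : Finset ℤ | J ⊆ Finset.Icc 1 (n : ℤ) ∧ J.card = s ∧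
          ((J + J).card : ℝ) ≤ K * s} : ℝ) ≤
        (2 : ℝ) ^ (δ * s) * (Nat.choose ⌈K * s / 2⌉₊ s : ℝ) := by
  intro δ hδ
  have hlog2 : 0 < Real.log 2 := Real.log_pos (by norm_num)
  obtain ⟨η, hη⟩ : ∃ η, η = δ * Real.log 2 / 2 := ⟨_, rfl⟩
  have hη0 : 0 < η := by rw [hη]; positivity
  obtain ⟨γ, hγ, hchoose⟩ := choose_add_le_exp_mul_choose hη0
  obtain ⟨ε, hε⟩ : ∃ ε, ε = min (1 / 8) (γ / 5) := ⟨_, rfl⟩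
  have hε0 : 0 < ε := by rw [hε]; positivity
  have hε1 : ε ≤ 1 / 8 := hε ▸ min_le_left _ _
  have hεγ : 5 * ε ≤ γ := by
    have : ε ≤ γ / 5 := hε ▸ min_le_right _ _
    linarith
  obtain ⟨k, hk⟩ := exists_nat_ge (8 / ε)
  have hkε : 8 ≤ k * ε := by rwa [div_le_iff₀ hε0] at hk
  obtain ⟨D, hD⟩ : ∃ D, D = 16 / ε * (k + 1) := ⟨_, rfl⟩
  have hD0 : 0 < D := by rw [hD]; positivity
  have hηD : 0 < η / D := by positivity
  refine ⟨min (ε ^ 2 / 128) ((η / D) ^ 2 / 2), by positivity, fun n s hn hs K hK hKc => ?_⟩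
  have hs0 : (0 : ℝ) < s := by exact_mod_cast hs
  have hL1 : 1 / 2 ≤ Real.log n := by
    have h1 : Real.log 2 ≤ Real.log n :=
      Real.log_le_log (by norm_num) (by exact_mod_cast hn)
    linarith [Real.log_two_gt_d9]
  rw [le_div_iff₀ (by positivity)] at hKc
  obtain ⟨hs_large, hεr, hrs, hrL⟩ := sqrt_bounds hK hs0 hL1 hε0 hε1 hηD (by positivity)
    (min_le_left _ _) (by linarith [min_le_right (ε ^ 2 / 128) ((η / D) ^ 2 / 2)]) hKc
  have hKs : 0 < K * s := by positivity
  obtain ⟨C, hCcard, hCM, hC⟩ := exists_containers_interval hn hε0 hε1 (Real.sqrt_pos.2 hKs)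
    hεr hkε
  rw [Real.sq_sqrt hKs.le] at hCM hC
  have hCexp : (C.card : ℝ) ≤ Real.exp (η * s) := by
    refine hCcard.trans (Real.exp_le_exp.2 ?_)
    rw [← hD]
    calc D * (√(K * s) * Real.log n) ≤ D * (η / D * s) := by gcongr
      _ = η * s := by field_simp
  obtain ⟨M, hM⟩ : ∃ M, M = (K * s + 1) / (2 - 4 * ε) := ⟨_, rfl⟩
  rw [← hM] at hCM
  have hden : 0 < 2 - 4 * ε := by linarith
  have hM0 : 0 ≤ M := by rw [hM]; positivity
  obtain ⟨N, hN⟩ : ∃ N, N = ⌈K * s / 2⌉₊ := ⟨_, rfl⟩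
  have hNm : K * s / 2 ≤ N := by rw [hN]; exact Nat.le_ceil _
  have hsN' : (s : ℝ) ≤ N := by
    have : 2 * (s : ℝ) ≤ K * s := by gcongr
    linarith
  have hsN : s ≤ N := by exact_mod_cast hsN'
  have hεN : 1 ≤ ε * N := by
    have h1 : ε * s ≤ ε * N := by gcongr
    have h2 : ε * (ε * s) ≤ 1 * (ε * s) := by gcongr; linarith
    linarith
  have hMN : M ≤ N + 5 * ε * N := by
    rw [hM, div_le_iff₀ hden]
    have h1 : ε * (ε * N) ≤ 1 / 8 * (ε * N) := by gcongr
    linarith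
  have hfloor : ((⌊M⌋₊ - N : ℕ) : ℝ) ≤ γ * N := by
    rcases le_total ⌊M⌋₊ N with h | h
    · rw [Nat.sub_eq_zero_of_le h, Nat.cast_zero]
      positivity
    · rw [Nat.cast_sub h]
      have h1 := Nat.floor_le hM0
      have h2 : 5 * ε * N ≤ γ * N := by gcongr
      linarith
  have hcount := card_le_card_containers_mul_choose (N := N + (⌊M⌋₊ - N)) (s := s) (C := C)
    (fun D hD => (Nat.le_floor (hCM D hD)).trans (by omega))
    (F := {J : Finset ℤ | J ⊆ Finset.Icc 1 (n : ℤ) ∧ J.card = s ∧ ((J + J).card : ℝ) ≤ K * s})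
    (fun J hJ => ⟨hJ.2.1, hC J hJ.1 hJ.2.2 (by rw [hJ.2.1]; exact hrs)⟩)
  have hpow : (2 : ℝ) ^ (δ * s) = Real.exp (η * s) * Real.exp (η * s) := by
    rw [Real.rpow_def_of_pos (by norm_num), ← Real.exp_add, hη]
    ring_nf
  rw [hpow, ← hN, mul_assoc]
  calc (Nat.card {J : Finset ℤ | J ⊆ Finset.Icc 1 (n : ℤ) ∧ J.card = s ∧
          ((J + J).card : ℝ) ≤ K * s} : ℝ)
      ≤ C.card * (N + (⌊M⌋₊ - N)).choose s := by exact_mod_cast hcount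
    _ ≤ _ := mul_le_mul hCexp (hchoose _ _ _ hsN hfloor) (by positivity) (by positivity)
end

section
/- For every δ > 0 there exists c > 0 such that the following holds for all integers n ≥ 2 and s ≥ 1, every real number K with 2 ≤ K ≤ c·s/(log n)^3, and every subset Y ⊆ G with |Y| = n: the number of sets J ⊆ Y with |J| = s and |J+J| ≤ K·s is at most 2^{δs} · binom(⌈(Ks+β)/2⌉, s), where β := β((1+δ)Ks). -/
open Pointwise

/-- `betaSubgroup G t` is the maximum of `|H|` over all finite subgroups `H ≤ G` with
`|H| ≤ t` (the trivial subgroup guarantees this is at least `1` whenever `t ≥ 1`). -/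
noncomputable def betaSubgroup (G : Type*) [AddCommGroup G] (t : ℝ) : ℕ :=
  sSup {k : ℕ | ∃ H : AddSubgroup G, Nat.card H = k ∧ 0 < k ∧ (k : ℝ) ≤ t}

section Pollard

variable {G : Type*} [AddCommGroup G] [DecidableEq G]

/-- The truncated representation count `∑ₓ min t r(x)`, where `r(x)` is the number of ways to write
`x` as a sum of an element of `U` and an element of `V`. -/
def truncatedSum (t : ℕ) (U V : Finset G) : ℕ :=
  ∑ x ∈ U + V, min t (U.addConvolution V x)

theorem truncatedSum_eq_sum {t : ℕ} {U V X : Finset G} (h : U + V ⊆ X) :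
    truncatedSum t U V = ∑ x ∈ X, min t (U.addConvolution V x) := by
  refine Finset.sum_subset h fun x _ hx => ?_
  rw [Finset.addConvolution_eq_zero.2 hx, Nat.min_zero]

theorem addConvolution_comm (U V : Finset G) (x : G) :
    U.addConvolution V x = V.addConvolution U x := by
  refine Finset.card_nbij' Prod.swap Prod.swap ?_ ?_ ?_ ?_ <;>
    simp +contextual [Set.MapsTo, Set.LeftInvOn, add_comm]

theorem addConvolution_union_left {U V : Finset G} (h : Disjoint U V) (W : Finset G) (x : G) :
    (U ∪ V).addConvolution W x = U.addConvolution W x + V.addConvolution W x := by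
  unfold Finset.addConvolution
  rw [Finset.union_product, Finset.filter_union, Finset.card_union_of_disjoint]
  refine Finset.disjoint_filter_filter (Finset.disjoint_left.2 fun p hp hq => ?_)
  exact Finset.disjoint_left.1 h (Finset.mem_product.1 hp).1 (Finset.mem_product.1 hq).1

theorem addConvolution_union_right {U V : Finset G} (h : Disjoint U V) (W : Finset G) (x : G) :
    W.addConvolution (U ∪ V) x = W.addConvolution U x + W.addConvolution V x := by
  simp only [addConvolution_comm W, addConvolution_union_left h]

theorem addConvolution_eq_union_inter_add_sdiff (U V : Finset G) (x : G) :
    U.addConvolution V x =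
      (U ∪ V).addConvolution (U ∩ V) x + (U \ V).addConvolution (V \ U) x := by
  have h1 : U.addConvolution V x
      = U.addConvolution (U ∩ V) x + U.addConvolution (V \ U) x := by
    rw [← addConvolution_union_right, Finset.inter_comm, Finset.union_comm,
      Finset.sdiff_union_inter]
    rw [Finset.inter_comm]; exact (Finset.disjoint_sdiff_inter V U).symm
  have h2 : U.addConvolution (V \ U) x
      = (U ∩ V).addConvolution (V \ U) x + (U \ V).addConvolution (V \ U) x := by
    rw [← addConvolution_union_left, Finset.union_comm, Finset.sdiff_union_inter]
    exact (Finset.disjoint_sdiff_inter U V).symm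
  have h3 : (U ∪ V).addConvolution (U ∩ V) x
      = U.addConvolution (U ∩ V) x + (V \ U).addConvolution (U ∩ V) x := by
    rw [← addConvolution_union_left Finset.disjoint_sdiff, Finset.union_sdiff_self_eq_union]
  rw [h1, h2, h3, addConvolution_comm (V \ U)]
  ring

theorem sum_addConvolution {U V X : Finset G} (h : U + V ⊆ X) :
    ∑ x ∈ X, U.addConvolution V x = U.card * V.card := by
  rw [← Finset.card_product]
  refine (Finset.card_eq_sum_card_fiberwise fun p hp => h ?_).symm
  have := Finset.mem_product.1 hp
  exact Finset.add_mem_add this.1 this.2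

theorem truncatedSum_card_right (U V : Finset G) :
    truncatedSum V.card U V = U.card * V.card := by
  rw [← sum_addConvolution subset_rfl]
  exact Finset.sum_congr rfl fun x _ => min_eq_right Finset.addConvolution_le_card_right

theorem truncatedSum_vadd (t : ℕ) (U V : Finset G) (e : G) :
    truncatedSum t U (e +ᵥ V) = truncatedSum t U V := by
  have h : U + (e +ᵥ V) = e +ᵥ (U + V) := by
    rw [add_vadd_comm]
  unfold truncatedSum
  rw [h, ← Finset.image_vadd, Finset.sum_image fun x _ y _ h => vadd_left_cancel e h]
  refine Finset.sum_congr rfl fun x _ => ?_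
  rw [addConvolution_comm, addConvolution_comm U V]
  simp

theorem truncatedSum_union_inter_le (t : ℕ) (U V : Finset G) :
    truncatedSum t (U ∪ V) (U ∩ V) ≤ truncatedSum t U V := by
  rw [truncatedSum_eq_sum (X := ((U ∪ V) + (U ∩ V)) ∪ (U + V)) Finset.subset_union_left,
    truncatedSum_eq_sum (X := ((U ∪ V) + (U ∩ V)) ∪ (U + V)) Finset.subset_union_right]
  refine Finset.sum_le_sum fun x _ => ?_
  rw [addConvolution_eq_union_inter_add_sdiff U V]
  omega

theorem truncatedSum_union_inter_add_sdiff_le (i t : ℕ) (U V : Finset G) :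
    truncatedSum i (U ∪ V) (U ∩ V) + truncatedSum t (U \ V) (V \ U) ≤
      truncatedSum (i + t) U V := by
  set X := ((U ∪ V) + (U ∩ V)) ∪ ((U + V) ∪ ((U \ V) + (V \ U))) with hX
  rw [truncatedSum_eq_sum (X := X) (by rw [hX]; exact Finset.subset_union_left),
    truncatedSum_eq_sum (X := X) (t := t)
      (by rw [hX]; exact Finset.subset_union_right.trans Finset.subset_union_right),
    truncatedSum_eq_sum (X := X) (t := i + t)
      (by rw [hX]; exact Finset.subset_union_left.trans Finset.subset_union_right),
    ← Finset.sum_add_distrib]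
  refine Finset.sum_le_sum fun x _ => ?_
  rw [addConvolution_eq_union_inter_add_sdiff U V]
  omega

/-- If all translates of `V` that meet `U` lie in `U`, then `U` is a union of cosets of a finite
subgroup, one coset of which contains `V`. -/
theorem exists_subgroup_of_translates_subset {U V : Finset G} (hU : U.Nonempty) (hV : V.Nonempty)
    (h : ∀ u ∈ U, ∀ v ∈ V, (u - v) +ᵥ V ⊆ U) :
    ∃ H : AddSubgroup G, Finite H ∧ Nat.card H ≤ U.card ∧ V.card ≤ Nat.card H := by
  obtain ⟨u₀, hu₀⟩ := hU
  obtain ⟨v₀, hv₀⟩ := hV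
  let H := AddAction.stabilizer G U
  have hHU : ∀ g : H, (g : G) + u₀ ∈ U := fun g => by
    have := AddAction.mem_stabilizer_iff.1 g.2
    rw [← this]
    exact Finset.vadd_mem_vadd_finset hu₀
  let f : H → U := fun g => ⟨g + u₀, hHU g⟩
  have hf : Function.Injective f := fun a b hab => by
    have := congrArg Subtype.val hab
    exact Subtype.ext (add_right_cancel this)
  have hfin : Finite H := Finite.of_injective f hf
  have hVH : ∀ v ∈ V, v - v₀ ∈ H := fun v hv => by
    refine AddAction.mem_stabilizer_iff.2 ?_
    refine Finset.eq_of_subset_of_card_le (fun x hx => ?_) (by simp)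
    obtain ⟨u, hu, rfl⟩ := Finset.mem_vadd_finset.1 hx
    refine h u hu v₀ hv₀ (Finset.mem_vadd_finset.2 ⟨v, hv, ?_⟩)
    simp only [vadd_eq_add]; abel
  let g : V → H := fun v => ⟨v - v₀, hVH v v.2⟩
  have hg : Function.Injective g := fun a b hab => by
    have := congrArg Subtype.val hab
    exact Subtype.ext (sub_left_injective this)
  refine ⟨H, hfin, ?_, ?_⟩
  · simpa using Nat.card_le_card_of_injective f hf
  · simpa using Nat.card_le_card_of_injective g hg

theorem le_truncatedSum_of_translates_subset {t : ℕ} {U V : Finset G} (hV : V.Nonempty)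
    (ht : t ≤ V.card) (h : ∀ u ∈ U, ∀ v ∈ V, (u - v) +ᵥ V ⊆ U) :
    t * U.card ≤ truncatedSum t U V := by
  obtain ⟨v₀, hv₀⟩ := hV
  have hsub : v₀ +ᵥ U ⊆ U + V := fun x hx => by
    obtain ⟨u, hu, rfl⟩ := Finset.mem_vadd_finset.1 hx
    rw [vadd_eq_add, add_comm v₀ u]
    exact Finset.add_mem_add hu hv₀
  refine le_trans ?_ (Finset.sum_le_sum_of_subset hsub)
  rw [← Finset.card_vadd_finset v₀ U, mul_comm, ← smul_eq_mul]
  refine Finset.card_nsmul_le_sum _ _ _ fun x hx => le_min le_rfl (ht.trans ?_)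
  obtain ⟨u, hu, rfl⟩ := Finset.mem_vadd_finset.1 hx
  refine Finset.card_le_card_of_injOn (fun v => (u + v₀ - v, v)) (fun v hv => ?_)
    fun a _ b _ hab => congrArg Prod.snd hab
  simp only [Finset.coe_filter, Finset.mem_product, Set.mem_ofPred_eq, vadd_eq_add]
  refine ⟨⟨h u hu v hv (Finset.mem_vadd_finset.2 ⟨v₀, hv₀, ?_⟩), hv⟩, by abel⟩
  simp only [vadd_eq_add]; abel

/-- A version of Pollard's theorem in arbitrary abelian groups: the only obstruction comes from
finite subgroups. -/
theorem pollard_of_subgroup_bound {L β : ℝ} (hβ : 0 ≤ β)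
    (hsub : ∀ H : AddSubgroup G, Finite H → (Nat.card H : ℝ) ≤ L → (Nat.card H : ℝ) ≤ β)
    {t : ℕ} {U V : Finset G} (htU : t ≤ U.card) (htV : t ≤ V.card) :
    (t : ℝ) * min L (U.card + V.card - t - β) ≤ truncatedSum t U V := by
  induction hn : V.card using Nat.strong_induction_on generalizing t U V with
  | _ n ih =>
  subst hn
  rcases Nat.eq_zero_or_pos t with rfl | ht
  · simp
  have hU : U.Nonempty := Finset.card_pos.1 (ht.trans_le htU)
  have hV : V.Nonempty := Finset.card_pos.1 (ht.trans_le htV)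
  by_cases hstuck : ∀ u ∈ U, ∀ v ∈ V, (u - v) +ᵥ V ⊆ U
  · obtain ⟨H, hfin, hHU, hVH⟩ := exists_subgroup_of_translates_subset hU hV hstuck
    have h1 := le_truncatedSum_of_translates_subset hV htV hstuck
    have h1' : (t : ℝ) * U.card ≤ truncatedSum t U V := by exact_mod_cast h1
    refine le_trans (mul_le_mul_of_nonneg_left ?_ t.cast_nonneg) h1'
    have hHU' : (Nat.card H : ℝ) ≤ U.card := by exact_mod_cast hHU
    have hVH' : (V.card : ℝ) ≤ Nat.card H := by exact_mod_cast hVH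
    rcases le_total (Nat.card H : ℝ) L with hL | hL
    · have := hsub H hfin hL
      have ht0 : (0 : ℝ) ≤ t := t.cast_nonneg
      exact (min_le_right _ _).trans (by linarith)
    · exact (min_le_left _ _).trans (hL.trans hHU')
  push Not at hstuck
  obtain ⟨u, hu, v, hv, hnot⟩ := hstuck
  rw [← truncatedSum_vadd t U V (u - v)]
  have hcard : ((u - v) +ᵥ V).card = V.card := Finset.card_vadd_finset _ _
  rw [← hcard] at ih htV ⊢
  set W := (u - v) +ᵥ V with hW
  have huW : u ∈ W := Finset.mem_vadd_finset.2 ⟨v, hv, by simp⟩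
  have hI : 0 < (U ∩ W).card := Finset.card_pos.2 ⟨u, Finset.mem_inter.2 ⟨hu, huW⟩⟩
  have hIW : (U ∩ W).card < W.card := by
    refine Finset.card_lt_card ⟨Finset.inter_subset_right, fun hc => hnot fun x hx => ?_⟩
    exact (Finset.mem_inter.1 (hc hx)).1
  have hUI := Finset.card_union_add_card_inter U W
  have hUI' : ((U ∪ W).card : ℝ) + (U ∩ W).card = U.card + W.card := by exact_mod_cast hUI
  rcases le_total t (U ∩ W).card with hti | hti
  · have := ih _ hIW (U := U ∪ W) (V := U ∩ W) (t := t)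
      (htU.trans (Finset.card_le_card Finset.subset_union_left)) hti rfl
    rw [hUI'] at this
    refine this.trans ?_
    exact_mod_cast truncatedSum_union_inter_le t U W
  · obtain ⟨j, rfl⟩ := Nat.exists_eq_add_of_le hti
    have hU' := Finset.card_sdiff_add_card_inter U W
    have hW' := Finset.card_sdiff_add_card_inter W U
    rw [Finset.inter_comm] at hW'
    have := ih (W \ U).card (by omega) (U := U \ W) (V := W \ U) (t := j)
      (by omega) (by omega) rfl
    have key := truncatedSum_union_inter_add_sdiff_le (U ∩ W).card j U W
    rw [truncatedSum_card_right] at key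
    have key' : ((U ∪ W).card : ℝ) * (U ∩ W).card + truncatedSum j (U \ W) (W \ U) ≤
      truncatedSum ((U ∩ W).card + j) U W := by exact_mod_cast key
    refine le_trans ?_ key'
    have e1 : ((U \ W).card : ℝ) + (U ∩ W).card = U.card := by exact_mod_cast hU'
    have e2 : ((W \ U).card : ℝ) + (U ∩ W).card = W.card := by exact_mod_cast hW'
    refine le_trans ?_ (add_le_add_right this _)
    have e3 : ((U ∪ W).card : ℝ) = (U \ W).card + (W \ U).card + (U ∩ W).card := by linarith
    rw [e3, ← e1, ← e2]
    push_cast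
    set i : ℝ := ((U ∩ W).card : ℝ)
    set a : ℝ := ((U \ W).card : ℝ)
    set b : ℝ := ((W \ U).card : ℝ)
    have hj : (0 : ℝ) ≤ j := j.cast_nonneg
    have hi : (0 : ℝ) ≤ i := Nat.cast_nonneg _
    rcases le_total L (a + b - j - β) with hc | hc
    · rw [min_eq_left hc]
      have := mul_le_mul_of_nonneg_left (min_le_left L (a + i + (b + i) - (i + j) - β)) hj
      have := mul_le_mul_of_nonneg_left (min_le_right L (a + i + (b + i) - (i + j) - β)) hi
      nlinarith
    · rw [min_eq_right hc]
      have := mul_le_mul_of_nonneg_left (min_le_right L (a + i + (b + i) - (i + j) - β))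
        (add_nonneg hi hj)
      nlinarith

end Pollard

section Supersaturation

variable {G : Type*} [AddCommGroup G] [DecidableEq G]

theorem truncatedSum_le_add_card (t : ℕ) (A B : Finset G) :
    truncatedSum t B B ≤ t * A.card + ((B ×ˢ B).filter fun p => p.1 + p.2 ∉ A).card := by
  have h1 : ((B ×ˢ B).filter fun p => p.1 + p.2 ∉ A).card =
      ∑ x ∈ (B + B) \ A, B.addConvolution B x := by
    rw [Finset.card_eq_sum_card_fiberwise (f := fun p : G × G => p.1 + p.2) (t := (B + B) \ A)]
    · refine Finset.sum_congr rfl fun x hx => ?_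
      unfold Finset.addConvolution
      rw [Finset.filter_filter]
      congr 1
      refine Finset.filter_congr fun p _ => ⟨fun h => h.2, fun h => ⟨?_, h⟩⟩
      rw [h]
      exact (Finset.mem_sdiff.1 hx).2
    · intro p hp
      simp only [Finset.coe_filter, Finset.mem_product, Set.mem_ofPred_eq] at hp
      exact Finset.mem_coe.2 (Finset.mem_sdiff.2 ⟨Finset.add_mem_add hp.1.1 hp.1.2, hp.2⟩)
  rw [h1, truncatedSum, ← Finset.sum_inter_add_sum_sdiff (B + B) A]
  refine add_le_add ?_ (Finset.sum_le_sum fun x _ => min_le_right _ _)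
  calc ∑ x ∈ (B + B) ∩ A, min t (B.addConvolution B x)
      ≤ ((B + B) ∩ A).card • t := Finset.sum_le_card_nsmul _ _ _ fun x _ => min_le_left _ _
    _ ≤ t * A.card := by
      rw [smul_eq_mul, mul_comm]
      exact Nat.mul_le_mul_left _ (Finset.card_le_card Finset.inter_subset_right)

theorem supersaturation {m ε δ β θ : ℝ} (hβ : 0 ≤ β) (hε : 0 < ε) (hε1 : ε ≤ 1)
    (hsub : ∀ H : AddSubgroup G, Finite H → (Nat.card H : ℝ) ≤ (1 + δ) * m →
      (Nat.card H : ℝ) ≤ β)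
    (hδ : 0 < δ) {A B : Finset G} (hA : (A.card : ℝ) ≤ m)
    (hB : (1 + ε) * ((m + β) / 2) ≤ B.card) (hlarge : 2 ≤ ε * B.card)
    (hθ₀ : θ ≤ 1 / 2) (hθ₁ : θ ≤ ε / 4 * (δ / 2)) (hθ₂ : θ ≤ ε / 4 * (ε / 2)) :
    θ * (B.card : ℝ) ^ 2 ≤ ((B ×ˢ B).filter fun p => p.1 + p.2 ∉ A).card := by
  have hmain : ∀ t : ℕ, (truncatedSum t B B : ℝ) ≤
      t * A.card + ((B ×ˢ B).filter fun p => p.1 + p.2 ∉ A).card := fun t => by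
    exact_mod_cast truncatedSum_le_add_card t A B
  set P : ℝ := (((B ×ˢ B).filter fun p => p.1 + p.2 ∉ A).card : ℝ)
  have hb : (0 : ℝ) ≤ B.card := Nat.cast_nonneg _
  rcases le_total (2 * m) B.card with hbig | hsmall
  · have h := hmain B.card
    rw [truncatedSum_card_right] at h
    push_cast at h
    set b : ℝ := (B.card : ℝ)
    have h1 : b * A.card ≤ b * (b / 2) := mul_le_mul_of_nonneg_left (by linarith) hb
    have h2 : θ * b ^ 2 ≤ 1 / 2 * b ^ 2 := mul_le_mul_of_nonneg_right hθ₀ (sq_nonneg _)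
    nlinarith
  · set t : ℕ := ⌊ε * B.card / 2⌋₊ with ht
    have ht1 : (t : ℝ) ≤ ε * B.card / 2 := Nat.floor_le (by positivity)
    have ht2 : ε * B.card / 4 ≤ t := by
      have h1 : ε * B.card / 2 < t + 1 := Nat.lt_floor_add_one _
      have h2 : (1 : ℝ) ≤ t := by
        exact_mod_cast Nat.le_floor (by push_cast; linarith : ((1 : ℕ) : ℝ) ≤ ε * B.card / 2)
      linarith
    have htB : t ≤ B.card := by
      have : (t : ℝ) ≤ B.card := by nlinarith
      exact_mod_cast this
    have hp := pollard_of_subgroup_bound hβ hsub htB htB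
    have h := hp.trans (hmain t)
    set b : ℝ := (B.card : ℝ)
    have ht0 : (0 : ℝ) ≤ t := t.cast_nonneg
    have hA' : (t : ℝ) * A.card ≤ t * m := mul_le_mul_of_nonneg_left hA ht0
    have hmin : m + min (δ / 2) (ε / 2) * b ≤ min ((1 + δ) * m) (b + b - t - β) := by
      refine le_min ?_ ?_
      · have := mul_le_mul_of_nonneg_right (min_le_left (δ / 2) (ε / 2)) hb
        nlinarith
      · have := mul_le_mul_of_nonneg_right (min_le_right (δ / 2) (ε / 2)) hb
        nlinarith
    have h3 := mul_le_mul_of_nonneg_left hmin ht0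
    have h4 : ε * b / 4 * (min (δ / 2) (ε / 2) * b) ≤ t * (min (δ / 2) (ε / 2) * b) := by
      refine mul_le_mul_of_nonneg_right ht2 (mul_nonneg ?_ hb)
      exact le_min (by positivity) (by positivity)
    have hθ : θ ≤ ε / 4 * min (δ / 2) (ε / 2) := by
      rcases min_choice (δ / 2) (ε / 2) with h | h <;> rw [h] <;> assumption
    have h5 := mul_le_mul_of_nonneg_right hθ (sq_nonneg b)
    nlinarith

end Supersaturation

section Step

variable {G : Type*} [AddCommGroup G] [DecidableEq G]

/-- The elements `v` of `B` for which at least `η |B|` of the sums `a + v`, `a ∈ B`, lie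
outside `A`. -/
noncomputable def highDegree (η : ℝ) (A B : Finset G) : Finset G :=
  B.filter fun v => η * B.card ≤ (B.filter fun a => a + v ∉ A).card

/-- The elements `v` of `B` for which fewer than `κ` of the sums `v + t`, `t ∈ T`, lie
outside `A`. -/
noncomputable def lowDegree (κ : ℝ) (T A B : Finset G) : Finset G :=
  B.filter fun v => ((T.filter fun t => v + t ∉ A).card : ℝ) < κ

theorem card_sdiff_highDegree_le {η : ℝ} {A B : Finset G}
    (h : 2 * η * (B.card : ℝ) ^ 2 ≤ ((B ×ˢ B).filter fun p => p.1 + p.2 ∉ A).card) :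
    ((B \ highDegree η A B).card : ℝ) ≤ (1 - η) * B.card := by
  have hsub : highDegree η A B ⊆ B := Finset.filter_subset _ _
  have hcard : ((B \ highDegree η A B).card : ℝ) + (highDegree η A B).card = B.card := by
    exact_mod_cast Finset.card_sdiff_add_card_eq_card hsub
  have hsum : (((B ×ˢ B).filter fun p => p.1 + p.2 ∉ A).card : ℝ) =
      ∑ v ∈ B, ((B.filter fun a => a + v ∉ A).card : ℝ) := by
    simp only [Finset.card_filter]
    push_cast
    rw [Finset.sum_product_right]
  rw [← Finset.sum_sdiff hsub] at hsum
  have h1 : ∑ v ∈ B \ highDegree η A B, ((B.filter fun a => a + v ∉ A).card : ℝ) ≤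
      (B \ highDegree η A B).card • (η * B.card) := by
    refine Finset.sum_le_card_nsmul _ _ _ fun v hv => ?_
    rw [Finset.mem_sdiff, highDegree, Finset.mem_filter] at hv
    by_contra hc
    exact hv.2 ⟨hv.1, (not_le.1 hc).le⟩
  have h2 : ∑ v ∈ highDegree η A B, ((B.filter fun a => a + v ∉ A).card : ℝ) ≤
      (highDegree η A B).card • (B.card : ℝ) :=
    Finset.sum_le_card_nsmul _ _ _ fun v _ => by
      exact_mod_cast Finset.card_le_card (Finset.filter_subset _ _)
  rw [nsmul_eq_mul] at h1 h2
  set b : ℝ := (B.card : ℝ)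
  set x : ℝ := ((B \ highDegree η A B).card : ℝ)
  set y : ℝ := ((highDegree η A B).card : ℝ)
  have hx : 0 ≤ x := Nat.cast_nonneg _
  have hy : 0 ≤ y := Nat.cast_nonneg _
  have hb : 0 ≤ b := Nat.cast_nonneg _
  rcases hb.eq_or_lt with hb0 | hb0
  · rw [← hb0]; linarith
  rcases lt_or_ge η 0 with hη | hη
  · nlinarith
  have h3 : 2 * η * b ^ 2 ≤ η * b ^ 2 + y * b := by nlinarith [mul_nonneg hη hb]
  have h4 : η * b ≤ y := by
    refine le_of_mul_le_mul_right ?_ hb0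
    nlinarith
  linarith

theorem card_lowDegree_le {η : ℝ} {A B T F : Finset G} (hη : 0 ≤ η) (hT : T ⊆ highDegree η A B)
    (hT0 : T.Nonempty) (hTF : (T.card : ℝ) * F.card ≤ η * B.card / 2) :
    ((lowDegree (η / 4 * T.card) T (A ∪ (T + F)) B).card : ℝ) ≤ (1 - η / 4) * B.card := by
  set A' := A ∪ (T + F) with hA'
  set low := lowDegree (η / 4 * T.card) T A' B with hlow
  have hsub : low ⊆ B := Finset.filter_subset _ _
  have hcard : ((B \ low).card : ℝ) + low.card = B.card := by
    exact_mod_cast Finset.card_sdiff_add_card_eq_card hsub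
  have hlower : T.card • (η * B.card / 2) ≤
      ∑ t ∈ T, ((B.filter fun v => v + t ∉ A').card : ℝ) := by
    refine Finset.card_nsmul_le_sum _ _ _ fun t ht => ?_
    have h1 : η * B.card ≤ (B.filter fun v => v + t ∉ A).card :=
      (Finset.mem_filter.1 (hT ht)).2
    have h2 : (B.filter fun v => v + t ∉ A) ⊆
        (B.filter fun v => v + t ∉ A') ∪ (B.filter fun v => v + t ∈ T + F) := fun v hv => by
      simp only [Finset.mem_union, Finset.mem_filter, hA'] at hv ⊢
      tauto
    have h3 : (B.filter fun v => v + t ∈ T + F).card ≤ T.card * F.card := by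
      refine le_trans (Finset.card_le_card_of_injOn (fun v => v + t) (fun v hv => ?_)
        fun a _ b _ hab => add_right_cancel hab) (Finset.card_add_le (s := T) (t := F))
      exact (Finset.mem_filter.1 hv).2
    have h4 := (Finset.card_le_card h2).trans (Finset.card_union_le _ _)
    have h4' : ((B.filter fun v => v + t ∉ A).card : ℝ) ≤
        (B.filter fun v => v + t ∉ A').card + (B.filter fun v => v + t ∈ T + F).card := by
      exact_mod_cast h4
    have h3' : ((B.filter fun v => v + t ∈ T + F).card : ℝ) ≤ T.card * F.card := by
      exact_mod_cast h3
    linarith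
  have hswap : ∑ t ∈ T, ((B.filter fun v => v + t ∉ A').card : ℝ) =
      ∑ v ∈ B, ((T.filter fun t => v + t ∉ A').card : ℝ) := by
    simp only [Finset.card_filter]
    push_cast
    exact Finset.sum_comm
  rw [hswap, ← Finset.sum_sdiff hsub] at hlower
  have h1 : ∑ v ∈ B \ low, ((T.filter fun t => v + t ∉ A').card : ℝ) ≤
      (B \ low).card • (T.card : ℝ) :=
    Finset.sum_le_card_nsmul _ _ _ fun v _ => by
      exact_mod_cast Finset.card_le_card (Finset.filter_subset _ _)
  have h2 : ∑ v ∈ low, ((T.filter fun t => v + t ∉ A').card : ℝ) ≤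
      low.card • (η / 4 * T.card) :=
    Finset.sum_le_card_nsmul _ _ _ fun v hv => (Finset.mem_filter.1 hv).2.le
  rw [nsmul_eq_mul] at h1 h2 hlower
  have hq : (0 : ℝ) < T.card := by exact_mod_cast Finset.card_pos.2 hT0
  have hx : (0 : ℝ) ≤ (B \ low).card := Nat.cast_nonneg _
  have h3 : η * B.card / 2 ≤ (B \ low).card + η / 4 * low.card := by
    refine le_of_mul_le_mul_left ?_ hq
    linarith
  nlinarith

theorem exists_growth_or_low_degree {κ : ℝ} (A T J : Finset G) (f : ℕ) :
    ∃ F ⊆ J, F.card ≤ f ∧ ((A.card : ℝ) + f * κ ≤ (A ∪ (T + F)).card ∨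
      ∀ v ∈ J, ((T.filter fun t => v + t ∉ A ∪ (T + F)).card : ℝ) < κ) := by
  induction f with
  | zero => exact ⟨∅, by simp⟩
  | succ f ih =>
    obtain ⟨F, hFJ, hFf, hgrow | hlow⟩ := ih
    · by_cases hc : ∀ v ∈ J, ((T.filter fun t => v + t ∉ A ∪ (T + F)).card : ℝ) < κ
      · exact ⟨F, hFJ, by omega, Or.inr hc⟩
      push Not at hc
      obtain ⟨v, hv, hκ⟩ := hc
      refine ⟨insert v F, Finset.insert_subset hv hFJ,
        (Finset.card_insert_le _ _).trans (by omega), Or.inl ?_⟩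
      have hdisj : Disjoint (A ∪ (T + F))
          ((T.filter fun t => v + t ∉ A ∪ (T + F)).image fun t => v + t) := by
        rw [Finset.disjoint_right]
        intro x hx
        obtain ⟨t, ht, rfl⟩ := Finset.mem_image.1 hx
        exact (Finset.mem_filter.1 ht).2
      have hsub : (A ∪ (T + F)) ∪ ((T.filter fun t => v + t ∉ A ∪ (T + F)).image fun t => v + t) ⊆
          A ∪ (T + insert v F) := by
        refine Finset.union_subset (Finset.union_subset_union subset_rfl
          (Finset.add_subset_add_left (Finset.subset_insert _ _))) fun x hx => ?_
        obtain ⟨t, ht, rfl⟩ := Finset.mem_image.1 hx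
        rw [add_comm v t]
        exact Finset.mem_union_right _
          (Finset.add_mem_add (Finset.mem_filter.1 ht).1 (Finset.mem_insert_self _ _))
      have hcard := Finset.card_le_card hsub
      rw [Finset.card_union_of_disjoint hdisj,
        Finset.card_image_of_injective _ (add_right_injective v)] at hcard
      have hcard' : ((A ∪ (T + F)).card : ℝ) + (T.filter fun t => v + t ∉ A ∪ (T + F)).card ≤
        (A ∪ (T + insert v F)).card := by exact_mod_cast hcard
      push_cast
      linarith
    · exact ⟨F, hFJ, by omega, Or.inr hlow⟩

end Step

section Containers

theorem card_filter_powerset_card_le {α : Type*} [DecidableEq α] (Y : Finset α) (q : ℕ) :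
    (Y.powerset.filter fun T => T.card ≤ q).card ≤ (Y.card + 1) ^ q := by
  have h : (Y.powerset.filter fun T => T.card ≤ q) ⊆
      (Finset.range (q + 1)).biUnion fun i => Y.powersetCard i := fun T hT => by
    rw [Finset.mem_filter, Finset.mem_powerset] at hT
    exact Finset.mem_biUnion.2 ⟨T.card, Finset.mem_range.2 (by omega),
      Finset.mem_powersetCard.2 ⟨hT.1, rfl⟩⟩
  refine (Finset.card_le_card h).trans (Finset.card_biUnion_le.trans ?_)
  rw [add_pow]
  refine Finset.sum_le_sum fun i hi => ?_
  rw [Finset.card_powersetCard, one_pow, mul_one]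
  refine (Nat.choose_le_pow _ _).trans (Nat.le_mul_of_pos_right _ (Nat.choose_pos ?_))
  exact Nat.lt_succ_iff.1 (Finset.mem_range.1 hi)

variable {G : Type*} [AddCommGroup G] [DecidableEq G]

/-- There is a family of at most `X` finite sets, each of size at most `M`, such that for every
`J ⊆ Y` with `|J + J| ≤ m` and `A ⊆ J + J`, some member of the family contains `J ∩ B`. -/
def HasContainers (Y : Finset G) (m : ℝ) (A B : Finset G) (X : ℕ) (M : ℝ) : Prop :=
  ∃ 𝒞 : Finset (Finset G), 𝒞.card ≤ X ∧ (∀ C ∈ 𝒞, (C.card : ℝ) ≤ M) ∧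
    ∀ J ⊆ Y, ((J + J).card : ℝ) ≤ m → A ⊆ J + J → ∃ C ∈ 𝒞, J ∩ B ⊆ C

theorem hasContainers_of_lt_card {Y A B : Finset G} {m : ℝ} {X : ℕ} {M : ℝ}
    (h : m < A.card) : HasContainers Y m A B X M := by
  refine ⟨∅, by simp, by simp, fun J _ hJm hAJ => ?_⟩
  have : (A.card : ℝ) ≤ (J + J).card := by exact_mod_cast Finset.card_le_card hAJ
  linarith

theorem hasContainers_of_card_le {Y A B : Finset G} {m : ℝ} {X : ℕ} {M : ℝ}
    (hX : 1 ≤ X) (h : (B.card : ℝ) ≤ M) : HasContainers Y m A B X M :=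
  ⟨{B}, by simpa using hX, by simpa using h,
    fun J _ _ _ => ⟨B, Finset.mem_singleton_self _, Finset.inter_subset_right⟩⟩

theorem hasContainers_step {Y A B : Finset G} {m η M : ℝ} {q X : ℕ} (hη : 0 ≤ η) (hq : 1 ≤ q)
    (hqB : (q : ℝ) ^ 2 ≤ η * B.card / 2)
    (hbad : 2 * η * (B.card : ℝ) ^ 2 ≤ ((B ×ˢ B).filter fun p => p.1 + p.2 ∉ A).card)
    (hA : ∀ A' : Finset G, (A.card : ℝ) + η / 4 * (q : ℝ) ^ 2 ≤ A'.card →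
      HasContainers Y m A' B X M)
    (hB : ∀ B' : Finset G, (B'.card : ℝ) ≤ (1 - η / 4) * B.card → HasContainers Y m A B' X M) :
    HasContainers Y m A B (3 * ((Y.card + 1) ^ q) ^ 2 * X) (M + q) := by
  classical
  set 𝒯 := Y.powerset.filter fun T => T.card ≤ q with h𝒯
  set N := (Y.card + 1) ^ q with hN
  have h𝒯N : 𝒯.card ≤ N := card_filter_powerset_card_le Y q
  have hN1 : 1 ≤ N := Nat.one_le_pow _ _ (Nat.succ_pos _)
  have hmem : ∀ J ⊆ Y, ∀ T ⊆ J, T.card ≤ q → T ∈ 𝒯 := fun J hJ T hT hc =>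
    Finset.mem_filter.2 ⟨Finset.mem_powerset.2 (hT.trans hJ), hc⟩
  obtain ⟨𝒞₁, hcard₁, hsize₁, hcov₁⟩ := hB (B \ highDegree η A B) (by
    have := card_sdiff_highDegree_le hbad
    have h0 : (0 : ℝ) ≤ η * B.card := mul_nonneg hη (Nat.cast_nonneg _)
    linarith)
  have hA' : ∀ p : Finset G × Finset G, ∃ 𝒞 : Finset (Finset G), 𝒞.card ≤ X ∧
      (∀ C ∈ 𝒞, (C.card : ℝ) ≤ M) ∧
      ((A.card : ℝ) + η / 4 * (q : ℝ) ^ 2 ≤ (A ∪ (p.1 + p.2)).card →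
        ∀ J ⊆ Y, ((J + J).card : ℝ) ≤ m → A ∪ (p.1 + p.2) ⊆ J + J → ∃ C ∈ 𝒞, J ∩ B ⊆ C) := by
    intro p
    by_cases h : (A.card : ℝ) + η / 4 * (q : ℝ) ^ 2 ≤ (A ∪ (p.1 + p.2)).card
    · obtain ⟨𝒞, h1, h2, h3⟩ := hA _ h
      exact ⟨𝒞, h1, h2, fun _ => h3⟩
    · exact ⟨∅, by simp, by simp, fun h' => absurd h' h⟩
  choose 𝒞₂ hcard₂ hsize₂ hcov₂ using hA'
  have hB' : ∀ p : Finset G × Finset G, ∃ 𝒞 : Finset (Finset G), 𝒞.card ≤ X ∧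
      (∀ C ∈ 𝒞, (C.card : ℝ) ≤ M) ∧
      (((lowDegree (η / 4 * q) p.1 (A ∪ (p.1 + p.2)) B).card : ℝ) ≤ (1 - η / 4) * B.card →
        ∀ J ⊆ Y, ((J + J).card : ℝ) ≤ m → A ⊆ J + J →
          ∃ C ∈ 𝒞, J ∩ lowDegree (η / 4 * q) p.1 (A ∪ (p.1 + p.2)) B ⊆ C) := by
    intro p
    by_cases h : ((lowDegree (η / 4 * q) p.1 (A ∪ (p.1 + p.2)) B).card : ℝ) ≤
        (1 - η / 4) * B.card
    · obtain ⟨𝒞, h1, h2, h3⟩ := hB _ h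
      exact ⟨𝒞, h1, h2, fun _ => h3⟩
    · exact ⟨∅, by simp, by simp, fun h' => absurd h' h⟩
  choose 𝒞₃ hcard₃ hsize₃ hcov₃ using hB'
  refine ⟨(𝒯.biUnion fun T => 𝒞₁.image fun C => C ∪ T) ∪
    ((𝒯 ×ˢ 𝒯).biUnion 𝒞₂ ∪ (𝒯 ×ˢ 𝒯).biUnion 𝒞₃), ?_, ?_, ?_⟩
  · have h1 : (𝒯.biUnion fun T => 𝒞₁.image fun C => C ∪ T).card ≤ N * X :=
      (Finset.card_biUnion_le_card_mul _ _ X fun T _ => Finset.card_image_le.trans hcard₁).trans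
        (Nat.mul_le_mul_right _ h𝒯N)
    have hNN : (𝒯 ×ˢ 𝒯).card ≤ N ^ 2 := by
      rw [Finset.card_product, sq]
      exact Nat.mul_le_mul h𝒯N h𝒯N
    have h2 : ((𝒯 ×ˢ 𝒯).biUnion 𝒞₂).card ≤ N ^ 2 * X :=
      (Finset.card_biUnion_le_card_mul _ _ X fun p _ => hcard₂ p).trans
        (Nat.mul_le_mul_right _ hNN)
    have h3 : ((𝒯 ×ˢ 𝒯).biUnion 𝒞₃).card ≤ N ^ 2 * X :=
      (Finset.card_biUnion_le_card_mul _ _ X fun p _ => hcard₃ p).trans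
        (Nat.mul_le_mul_right _ hNN)
    have h4 : N * X ≤ N ^ 2 * X := Nat.mul_le_mul_right _ (Nat.le_self_pow two_ne_zero N)
    have h5 := Finset.card_union_le (𝒯.biUnion fun T => 𝒞₁.image fun C => C ∪ T)
      ((𝒯 ×ˢ 𝒯).biUnion 𝒞₂ ∪ (𝒯 ×ˢ 𝒯).biUnion 𝒞₃)
    have h6 := Finset.card_union_le ((𝒯 ×ˢ 𝒯).biUnion 𝒞₂) ((𝒯 ×ˢ 𝒯).biUnion 𝒞₃)
    rw [mul_assoc]
    omega
  · have hq0 : (0 : ℝ) ≤ q := q.cast_nonneg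
    intro C hC
    rw [Finset.mem_union, Finset.mem_union, Finset.mem_biUnion, Finset.mem_biUnion,
      Finset.mem_biUnion] at hC
    obtain ⟨T, hT, hC⟩ | ⟨p, -, hC⟩ | ⟨p, -, hC⟩ := hC
    · obtain ⟨C, hC₁, rfl⟩ := Finset.mem_image.1 hC
      have h1 : ((C ∪ T).card : ℝ) ≤ C.card + T.card := by exact_mod_cast Finset.card_union_le _ _
      have h2 : (T.card : ℝ) ≤ q := by exact_mod_cast (Finset.mem_filter.1 hT).2
      linarith [hsize₁ C hC₁]
    · linarith [hsize₂ p C hC]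
    · linarith [hsize₃ p C hC]
  · intro J hJ hJm hAJ
    rcases le_total (J ∩ highDegree η A B).card q with hle | hge
    · obtain ⟨C, hC, hsub⟩ := hcov₁ J hJ hJm hAJ
      refine ⟨C ∪ (J ∩ highDegree η A B), Finset.mem_union_left _ (Finset.mem_biUnion.2
        ⟨_, hmem J hJ _ Finset.inter_subset_left hle, Finset.mem_image_of_mem _ hC⟩),
        fun v hv => ?_⟩
      rw [Finset.mem_inter] at hv
      by_cases hhigh : v ∈ highDegree η A B
      · exact Finset.mem_union_right _ (Finset.mem_inter.2 ⟨hv.1, hhigh⟩)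
      · exact Finset.mem_union_left _
          (hsub (Finset.mem_inter.2 ⟨hv.1, Finset.mem_sdiff.2 ⟨hv.2, hhigh⟩⟩))
    obtain ⟨T, hT, hTq⟩ := Finset.exists_subset_card_eq hge
    have hTJ : T ⊆ J := hT.trans Finset.inter_subset_left
    obtain ⟨F, hFJ, hFq, hF⟩ := exists_growth_or_low_degree (κ := η / 4 * q) A T J q
    have hpair : (T, F) ∈ 𝒯 ×ˢ 𝒯 :=
      Finset.mem_product.2 ⟨hmem J hJ T hTJ hTq.le, hmem J hJ F hFJ hFq⟩
    rcases hF with hgrow | hlow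
    · obtain ⟨C, hC, hsub⟩ := hcov₂ (T, F) (by simp only; linarith) J hJ hJm
        (Finset.union_subset hAJ (Finset.add_subset_add hTJ hFJ))
      exact ⟨C, Finset.mem_union_right _ (Finset.mem_union_left _
        (Finset.mem_biUnion.2 ⟨_, hpair, hC⟩)), hsub⟩
    · have hsmall : ((lowDegree (η / 4 * q) T (A ∪ (T + F)) B).card : ℝ) ≤
          (1 - η / 4) * B.card := by
        rw [← hTq]
        refine card_lowDegree_le hη (hT.trans Finset.inter_subset_right)
          (Finset.card_pos.1 (by omega)) (le_trans ?_ hqB)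
        rw [hTq, sq]
        exact mul_le_mul_of_nonneg_left (by exact_mod_cast hFq) q.cast_nonneg
      obtain ⟨C, hC, hsub⟩ := hcov₃ (T, F) hsmall J hJ hJm hAJ
      refine ⟨C, Finset.mem_union_right _ (Finset.mem_union_right _
        (Finset.mem_biUnion.2 ⟨_, hpair, hC⟩)), fun v hv => hsub ?_⟩
      rw [Finset.mem_inter] at hv
      exact Finset.mem_inter.2 ⟨hv.1, Finset.mem_filter.2 ⟨hv.2, hlow v hv.1⟩⟩

theorem hasContainers_of_supersaturation {Y : Finset G} {m η M : ℝ} {q : ℕ} (hη : 0 ≤ η)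
    (hq : 1 ≤ q) (hM : 1 ≤ M) (hqM : (q : ℝ) ^ 2 ≤ η * M / 2)
    (hsat : ∀ A B : Finset G, (A.card : ℝ) ≤ m → M < B.card →
      2 * η * (B.card : ℝ) ^ 2 ≤ ((B ×ˢ B).filter fun p => p.1 + p.2 ∉ A).card)
    (r : ℕ) : ∀ i j : ℕ, i + j = r → ∀ A B : Finset G, m < A.card + i * (η / 4 * (q : ℝ) ^ 2) →
      (B.card : ℝ) ≤ Real.exp (η / 4 * j) →
      HasContainers Y m A B ((3 * ((Y.card + 1) ^ q) ^ 2) ^ r) (M + r * q) := by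
  induction r with
  | zero =>
    intro i j hij A B hA _
    obtain rfl : i = 0 := by omega
    exact hasContainers_of_lt_card (by simpa using hA)
  | succ r ih =>
    intro i j hij A B hA hB
    rcases lt_or_ge m (A.card : ℝ) with hAm | hAm
    · exact hasContainers_of_lt_card hAm
    rcases le_or_gt (B.card : ℝ) M with hBM | hBM
    · refine hasContainers_of_card_le (Nat.one_le_pow _ _ (by positivity)) (hBM.trans ?_)
      have : (0 : ℝ) ≤ (r + 1 : ℕ) * q := by positivity
      linarith
    obtain ⟨i, rfl⟩ : ∃ k, i = k + 1 := Nat.exists_eq_succ_of_ne_zero fun h => by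
      rw [h] at hA; simp only [Nat.cast_zero, zero_mul, add_zero] at hA; linarith
    obtain ⟨j, rfl⟩ : ∃ k, j = k + 1 := Nat.exists_eq_succ_of_ne_zero fun h => by
      rw [h] at hB; simp only [Nat.cast_zero, mul_zero, Real.exp_zero] at hB; linarith
    have hstep := hasContainers_step (Y := Y) (m := m) (M := M + r * q)
      (X := (3 * ((Y.card + 1) ^ q) ^ 2) ^ r) hη hq
      (hqM.trans (by have := mul_le_mul_of_nonneg_left hBM.le hη; linarith))
      (hsat A B hAm hBM)
      (fun A' hA' => ih i (j + 1) (by omega) A' B (by push_cast at hA; linarith) hB)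
      (fun B' hB' => ih (i + 1) j (by omega) A B' hA (by
        have h1 : 1 - η / 4 ≤ Real.exp (-(η / 4)) := by
          have := Real.add_one_le_exp (-(η / 4)); linarith
        calc (B'.card : ℝ) ≤ (1 - η / 4) * B.card := hB'
          _ ≤ Real.exp (-(η / 4)) * Real.exp (η / 4 * (j + 1 : ℕ)) :=
            mul_le_mul h1 hB (Nat.cast_nonneg _) (Real.exp_pos _).le
          _ = Real.exp (η / 4 * j) := by
            rw [← Real.exp_add]; congr 1; push_cast; ring))
    have e1 : 3 * ((Y.card + 1) ^ q) ^ 2 * (3 * ((Y.card + 1) ^ q) ^ 2) ^ r =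
      (3 * ((Y.card + 1) ^ q) ^ 2) ^ (r + 1) := (pow_succ' _ _).symm
    have e2 : M + r * q + q = M + (r + 1 : ℕ) * q := by push_cast; ring
    rwa [e1, e2] at hstep

/-- The number of sets that have containers is at most the number of containers times the number
of subsets of a container. -/
theorem card_le_of_hasContainers {Y : Finset G} {m M : ℝ} {X : ℕ}
    (h : HasContainers Y m ∅ Y X M) (s : ℕ) :
    Nat.card {J : Finset G | J ⊆ Y ∧ J.card = s ∧ ((J + J).card : ℝ) ≤ m} ≤
      X * Nat.choose ⌊M⌋₊ s := by
  classical
  obtain ⟨𝒞, hcard, hsize, hcov⟩ := h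
  have hsub : {J : Finset G | J ⊆ Y ∧ J.card = s ∧ ((J + J).card : ℝ) ≤ m} ⊆
      (𝒞.biUnion fun C => C.powersetCard s : Finset (Finset G)) := by
    rintro J ⟨hJ, hs, hm⟩
    obtain ⟨C, hC, hJC⟩ := hcov J hJ hm (Finset.empty_subset _)
    rw [Finset.inter_eq_left.2 hJ] at hJC
    exact Finset.mem_coe.2 (Finset.mem_biUnion.2 ⟨C, hC, Finset.mem_powersetCard.2 ⟨hJC, hs⟩⟩)
  rw [Nat.card_coe_set_eq]
  refine (Set.ncard_le_ncard hsub (Finset.finite_toSet _)).trans ?_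
  rw [Set.ncard_coe_finset]
  refine (Finset.card_biUnion_le_card_mul _ _ (Nat.choose ⌊M⌋₊ s) fun C hC => ?_).trans
    (Nat.mul_le_mul_right _ hcard)
  rw [Finset.card_powersetCard]
  exact Nat.choose_le_choose _ (Nat.le_floor (hsize C hC))

end Containers

section Binomial

theorem sum_range_inv_sqrt_le (s : ℕ) : ∑ i ∈ Finset.range s, 1 / √((i : ℝ) + 1) ≤ 2 * √s := by
  induction s with
  | zero => simp
  | succ s ih =>
    rw [Finset.sum_range_succ]
    push_cast
    have hs : (0 : ℝ) ≤ s := s.cast_nonneg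
    have h1 : 0 < √((s : ℝ) + 1) := Real.sqrt_pos.2 (by positivity)
    have h2 := Real.sq_sqrt hs
    have h3 := Real.sq_sqrt (show (0 : ℝ) ≤ s + 1 by positivity)
    have h4 : 1 / √((s : ℝ) + 1) ≤ 2 * √(s + 1) - 2 * √s := by
      rw [div_le_iff₀ h1]
      nlinarith [sq_nonneg (√((s : ℝ) + 1) - √s)]
    linarith

theorem one_add_le_exp_sqrt {u : ℝ} (hu : 0 ≤ u) : 1 + u ≤ Real.exp √u := by
  have h := Real.sum_le_exp_of_nonneg (Real.sqrt_nonneg u) 4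
  simp only [Finset.sum_range_succ, Finset.sum_range_zero, Nat.factorial] at h
  have h0 := Real.sqrt_nonneg u
  have h1 := Real.sq_sqrt hu
  norm_num at h
  nlinarith [mul_nonneg h0 (sq_nonneg (√u - 3 / 2))]

/-- Increasing the upper index of a binomial coefficient by a small proportion costs at most a
small exponential factor in the lower index. -/
theorem choose_add_le_exp_mul_choose_s1 {N k s : ℕ} {a : ℝ} (ha : 0 ≤ a) (hs : s ≤ N)
    (hk : (k : ℝ) ≤ a * N) :
    (Nat.choose (N + k) s : ℝ) ≤ Real.exp (2 * √a * s) * Nat.choose N s := by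
  have hprod : ∀ n : ℕ, s ≤ n →
      ((s.factorial : ℝ) * n.choose s) = ∏ i ∈ Finset.range s, ((n : ℝ) - i) := fun n hn => by
    have h := Nat.descFactorial_eq_factorial_mul_choose n s
    rw [Nat.descFactorial_eq_prod_range] at h
    rw [← Nat.cast_mul, ← h]
    push_cast
    refine Finset.prod_congr rfl fun i hi => ?_
    exact Nat.cast_sub ((Finset.mem_range.1 hi).le.trans hn)
  have hfac : (0 : ℝ) < s.factorial := by exact_mod_cast s.factorial_pos
  refine le_of_mul_le_mul_left ?_ hfac
  rw [mul_left_comm, hprod _ hs, hprod _ (hs.trans (Nat.le_add_right _ _))]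
  have hterm : ∀ i ∈ Finset.range s, (((N + k : ℕ) : ℝ) - i) ≤
      Real.exp (√a * √s * (1 / √((s : ℝ) - i))) * ((N : ℝ) - i) := by
    intro i hi
    have his : (i : ℝ) + 1 ≤ s := by exact_mod_cast Finset.mem_range.1 hi
    have hsN : (s : ℝ) ≤ N := by exact_mod_cast hs
    have hi0 : (0 : ℝ) ≤ i := i.cast_nonneg
    have hpos : (0 : ℝ) < s - i := by linarith
    have hexp : √a * √s * (1 / √((s : ℝ) - i)) = √(a * s / (s - i)) := by
      rw [Real.sqrt_div (by positivity), Real.sqrt_mul ha, mul_one_div]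
    rw [hexp]
    have h1 := one_add_le_exp_sqrt (u := a * s / (s - i)) (by positivity)
    refine le_trans ?_ (mul_le_mul_of_nonneg_right h1 (by linarith))
    have h2 : a * N ≤ a * s / (s - i) * (N - i) := by
      rw [div_mul_eq_mul_div, le_div_iff₀ hpos, mul_assoc, mul_assoc]
      exact mul_le_mul_of_nonneg_left (by nlinarith) ha
    push_cast
    linarith
  have hnonneg : ∀ i ∈ Finset.range s, (0 : ℝ) ≤ ((N + k : ℕ) : ℝ) - i := fun i hi => by
    have : i ≤ N + k := by have := Finset.mem_range.1 hi; omega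
    exact sub_nonneg.2 (by exact_mod_cast this)
  refine (Finset.prod_le_prod hnonneg hterm).trans ?_
  rw [Finset.prod_mul_distrib, ← Real.exp_sum, ← Finset.mul_sum]
  refine mul_le_mul_of_nonneg_right (Real.exp_le_exp.2 ?_) (Finset.prod_nonneg fun i hi => ?_)
  · have hreflect : ∑ i ∈ Finset.range s, 1 / √((s : ℝ) - i) =
        ∑ i ∈ Finset.range s, 1 / √((i : ℝ) + 1) := by
      rw [← Finset.sum_range_reflect]
      refine Finset.sum_congr rfl fun i hi => ?_
      have hi' := Finset.mem_range.1 hi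
      have : ((s - 1 - i : ℕ) : ℝ) = s - 1 - i := by
        rw [Nat.sub_sub, Nat.cast_sub (by omega)]; push_cast; ring
      rw [this]
      congr 2
      ring
    rw [hreflect]
    have h1 := mul_le_mul_of_nonneg_left (sum_range_inv_sqrt_le s)
      (mul_nonneg (Real.sqrt_nonneg a) (Real.sqrt_nonneg (s : ℝ)))
    have h2 := Real.mul_self_sqrt (s.cast_nonneg : (0 : ℝ) ≤ s)
    calc _ ≤ _ := h1
      _ = 2 * √a * (√s * √s) := by ring
      _ = _ := by rw [h2]
  · have : i ≤ N := (Finset.mem_range.1 hi).le.trans hs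
    exact sub_nonneg.2 (by exact_mod_cast this)

end Binomial

section BetaSubgroup

variable {G : Type*} [AddCommGroup G]

theorem card_le_betaSubgroup {t : ℝ} (H : AddSubgroup G) [Finite H] (hH : (Nat.card H : ℝ) ≤ t) :
    Nat.card H ≤ betaSubgroup G t := by
  refine le_csSup ⟨⌊t⌋₊, ?_⟩ ⟨H, rfl, Nat.card_pos, hH⟩
  rintro k ⟨_, -, -, hk⟩
  exact Nat.le_floor hk

end BetaSubgroup

section Counting

variable {G : Type*} [AddCommGroup G] [DecidableEq G]

/-- The counting bound with explicit parameters: `q` is the size of the fingerprints and `i + j`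
the number of rounds of the container algorithm. -/
theorem card_le_of_parameters {δ ε η m : ℝ} {s q i j : ℕ} {Y : Finset G} (hδ : 0 < δ)
    (hε : 0 < ε) (hε1 : ε ≤ 1) (hη : 0 ≤ η) (hη₀ : 2 * η ≤ 1 / 2)
    (hη₁ : 2 * η ≤ ε / 4 * (δ / 2)) (hη₂ : 2 * η ≤ ε / 4 * (ε / 2))
    (hs : 2 * (s : ℝ) ≤ m) (hm : 4 ≤ ε * m) (hq : 1 ≤ q) (hqm : (q : ℝ) ^ 2 ≤ η * m / 4)
    (hi : m < i * (η / 4 * (q : ℝ) ^ 2)) (hj : (Y.card : ℝ) ≤ Real.exp (η / 4 * j))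
    (hij : ((i + j : ℕ) : ℝ) * q ≤ ε * m / 2) :
    (Nat.card {J : Finset G | J ⊆ Y ∧ J.card = s ∧ ((J + J).card : ℝ) ≤ m} : ℝ) ≤
      (3 * (((Y.card : ℝ) + 1) ^ q) ^ 2) ^ (i + j) * (Real.exp (2 * √(2 * ε) * s) *
        Nat.choose ⌈(m + betaSubgroup G ((1 + δ) * m)) / 2⌉₊ s) := by
  set β : ℝ := (betaSubgroup G ((1 + δ) * m) : ℝ) with hβdef
  have hβ : 0 ≤ β := Nat.cast_nonneg _
  have hm4 : 4 ≤ m := by nlinarith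
  set M := (1 + ε) * ((m + β) / 2) with hM
  have hmM : m / 2 ≤ M := by rw [hM]; nlinarith
  have hcont := hasContainers_of_supersaturation (Y := Y) (m := m) (M := M) hη hq (by linarith)
    (hqm.trans (by nlinarith))
    (fun A B hA hB => supersaturation hβ hε hε1
      (fun H _ hH => Nat.cast_le.2 (card_le_betaSubgroup H hH))
      hδ hA hB.le (by nlinarith) hη₀ hη₁ hη₂)
    (i + j) i j rfl ∅ Y (by simpa using hi) hj
  have hcount := card_le_of_hasContainers hcont s
  set N := ⌈(m + β) / 2⌉₊ with hN
  have hNle : (m + β) / 2 ≤ N := Nat.le_ceil _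
  have hfloor : ⌊M + ((i + j : ℕ) : ℝ) * q⌋₊ ≤ N + ⌊2 * ε * N⌋₊ := by
    have h1 : M + ((i + j : ℕ) : ℝ) * q ≤ 2 * ε * N + N := by rw [hM]; nlinarith
    calc _ ≤ ⌊2 * ε * N + (N : ℝ)⌋₊ := Nat.floor_le_floor h1
      _ = _ := by rw [Nat.floor_add_natCast (by positivity), add_comm]
  have hsN : s ≤ N := by
    have : (s : ℝ) ≤ N := by linarith
    exact_mod_cast this
  have hbin := choose_add_le_exp_mul_choose_s1 (k := ⌊2 * ε * N⌋₊) (a := 2 * ε) (by positivity) hsN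
    (Nat.floor_le (by positivity))
  have hchoose : (Nat.choose ⌊M + ((i + j : ℕ) : ℝ) * q⌋₊ s : ℝ) ≤
      Nat.choose (N + ⌊2 * ε * N⌋₊) s := by
    exact_mod_cast Nat.choose_le_choose s hfloor
  have hcount' : (Nat.card {J : Finset G | J ⊆ Y ∧ J.card = s ∧ ((J + J).card : ℝ) ≤ m} : ℝ) ≤
      (3 * (((Y.card : ℝ) + 1) ^ q) ^ 2) ^ (i + j) *
        Nat.choose ⌊M + ((i + j : ℕ) : ℝ) * q⌋₊ s := by exact_mod_cast hcount
  exact hcount'.trans (mul_le_mul_of_nonneg_left (hchoose.trans hbin) (by positivity))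

end Counting

/-- The existence of fingerprint sizes and round numbers for `card_le_of_parameters`. -/
theorem exists_parameters {η γ m ℓ s : ℝ} (hη : 0 < η) (hη₁ : η ≤ 1 / 4) (hℓ : 1 / 2 ≤ ℓ)
    (hγ : 0 ≤ γ) (hs : 0 ≤ s) (hm : ℓ ≤ η / 8 * m) (hmγ : m * ℓ ^ 3 ≤ (γ * s) ^ 2) :
    ∃ q i j : ℕ, 1 ≤ q ∧ (q : ℝ) ^ 2 ≤ η * m / 4 ∧ m < i * (η / 4 * (q : ℝ) ^ 2) ∧
      ℓ ≤ η / 4 * j ∧ ((i + j : ℕ) : ℝ) * q * ℓ ≤ 140 / η ^ 2 * (γ * s) := by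
  have hℓ0 : 0 < ℓ := by linarith
  have hm0 : 0 < m := by nlinarith
  set x : ℝ := √(η / 8 * m / ℓ) with hx
  have hxsq : x ^ 2 = η / 8 * m / ℓ := Real.sq_sqrt (by positivity)
  have hx1 : 1 ≤ x := Real.one_le_sqrt.2 ((one_le_div hℓ0).2 hm)
  have hqx : (⌊x⌋₊ : ℝ) ≤ x := Nat.floor_le (by linarith)
  have hq1 : 1 ≤ ⌊x⌋₊ := Nat.le_floor (by simpa using hx1)
  have hq1' : (1 : ℝ) ≤ ⌊x⌋₊ := by exact_mod_cast hq1
  have hxq : x / 2 ≤ ⌊x⌋₊ := by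
    have := Nat.lt_floor_add_one x
    linarith
  generalize ⌊x⌋₊ = q at *
  have hq0 : (0 : ℝ) < q := by linarith
  have hup : (q : ℝ) ^ 2 * ℓ ≤ η / 8 * m := by
    have h1 : (q : ℝ) ^ 2 ≤ x ^ 2 := pow_le_pow_left₀ hq0.le hqx 2
    rw [hxsq, le_div_iff₀ hℓ0] at h1
    exact h1
  have hlo : η / 32 * m ≤ (q : ℝ) ^ 2 * ℓ := by
    have h1 : (x / 2) ^ 2 ≤ (q : ℝ) ^ 2 := pow_le_pow_left₀ (by linarith) hxq 2
    have h2 : x ^ 2 * ℓ = η / 8 * m := by rw [hxsq]; field_simp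
    nlinarith
  refine ⟨q, ⌊128 * ℓ / η ^ 2⌋₊ + 1, ⌈4 * ℓ / η⌉₊, hq1, ?_, ?_, ?_, ?_⟩
  · nlinarith [sq_nonneg (q : ℝ)]
  · have h1 : 128 * ℓ / η ^ 2 < (⌊128 * ℓ / η ^ 2⌋₊ + 1 : ℕ) := by
      push_cast
      exact Nat.lt_floor_add_one _
    have h2 : 128 * ℓ / η ^ 2 * (η / 4 * (q : ℝ) ^ 2) = 32 / η * ((q : ℝ) ^ 2 * ℓ) := by
      field_simp; ring
    have h3 : m = 32 / η * (η / 32 * m) := by field_simp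
    calc m = 32 / η * (η / 32 * m) := h3
      _ ≤ 32 / η * ((q : ℝ) ^ 2 * ℓ) := mul_le_mul_of_nonneg_left hlo (by positivity)
      _ = 128 * ℓ / η ^ 2 * (η / 4 * (q : ℝ) ^ 2) := h2.symm
      _ < _ := mul_lt_mul_of_pos_right h1 (by positivity)
  · have h1 := mul_le_mul_of_nonneg_left (Nat.le_ceil (4 * ℓ / η)) (show 0 ≤ η / 4 by positivity)
    have h2 : η / 4 * (4 * ℓ / η) = ℓ := by field_simp
    linarith
  · have hr : ((⌊128 * ℓ / η ^ 2⌋₊ + 1 + ⌈4 * ℓ / η⌉₊ : ℕ) : ℝ) ≤ 140 / η ^ 2 * ℓ := by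
      push_cast
      have h1 : (⌊128 * ℓ / η ^ 2⌋₊ : ℝ) ≤ 128 * ℓ / η ^ 2 := Nat.floor_le (by positivity)
      have h2 : (⌈4 * ℓ / η⌉₊ : ℝ) < 4 * ℓ / η + 1 := Nat.ceil_lt_add_one (by positivity)
      have h3 : 4 * ℓ / η + 2 ≤ 12 * ℓ / η ^ 2 := by
        rw [le_div_iff₀ (by positivity), add_mul, div_mul_eq_mul_div, sq, ← mul_assoc,
          mul_div_cancel_right₀ _ hη.ne']
        nlinarith
      have h4 : 140 / η ^ 2 * ℓ = 128 * ℓ / η ^ 2 + 12 * ℓ / η ^ 2 := by ring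
      linarith
    have hqℓ : q * ℓ ^ 2 ≤ γ * s := by
      refine le_of_sq_le_sq ?_ (by positivity)
      have h1 : (q * ℓ ^ 2 : ℝ) ^ 2 = (q : ℝ) ^ 2 * ℓ * ℓ ^ 3 := by ring
      rw [h1]
      refine le_trans ?_ hmγ
      refine mul_le_mul_of_nonneg_right (hup.trans ?_) (by positivity)
      nlinarith
    calc _ ≤ 140 / η ^ 2 * ℓ * q * ℓ := by gcongr
      _ = 140 / η ^ 2 * (q * ℓ ^ 2) := by ring
      _ ≤ _ := mul_le_mul_of_nonneg_left hqℓ (by positivity)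

/-- The choice of constants in terms of `δ` and `D`. -/
theorem exists_constants {δ D : ℝ} (hδ : 0 < δ) (hD : 0 < D) :
    ∃ ε η γ : ℝ, 0 < ε ∧ ε ≤ 1 ∧ ε ≤ D ^ 2 / 8 ∧ 0 < η ∧ η ≤ 1 / 4 ∧
      η ≤ ε / 4 * (δ / 2) / 2 ∧ η ≤ ε / 4 * (ε / 2) / 2 ∧ 0 < γ ∧ γ ≤ 1 ∧ γ ≤ η / 8 ∧
      γ ≤ ε / 8 ∧ γ ≤ ε * η ^ 2 / 280 ∧ γ ≤ D * η ^ 2 / 840 := by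
  obtain ⟨ε, hε, hε'⟩ := exists_between (show 0 < min 1 (D ^ 2 / 8) by positivity)
  rw [lt_min_iff] at hε'
  obtain ⟨η, hη, hη'⟩ := exists_between
    (show 0 < min (1 / 4) (min (ε / 4 * (δ / 2) / 2) (ε / 4 * (ε / 2) / 2)) by positivity)
  rw [lt_min_iff, lt_min_iff] at hη'
  obtain ⟨γ, hγ, hγ'⟩ := exists_between (show 0 < min 1 (min (η / 8) (min (ε / 8)
    (min (ε * η ^ 2 / 280) (D * η ^ 2 / 840)))) by positivity)
  rw [lt_min_iff, lt_min_iff, lt_min_iff, lt_min_iff] at hγ'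
  exact ⟨ε, η, γ, hε, hε'.1.le, hε'.2.le, hη, hη'.1.le, hη'.2.1.le, hη'.2.2.le, hγ, hγ'.1.le,
    hγ'.2.1.le, hγ'.2.2.1.le, hγ'.2.2.2.1.le, hγ'.2.2.2.2.le⟩

theorem three_mul_succ_pow_le {n : ℕ} (hn : 2 ≤ n) {q : ℕ} (hq : 1 ≤ q) (r : ℕ) :
    (3 * (((n : ℝ) + 1) ^ q) ^ 2) ^ r ≤ Real.exp (6 * ((r : ℝ) * q * Real.log n)) := by
  have hn' : (2 : ℝ) ≤ n := by exact_mod_cast hn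
  have h3 : (3 : ℝ) ≤ (n : ℝ) ^ 2 := by nlinarith
  have hstep : 3 * (((n : ℝ) + 1) ^ q) ^ 2 ≤ (n : ℝ) ^ (6 * q) := by
    calc 3 * (((n : ℝ) + 1) ^ q) ^ 2 ≤ (n : ℝ) ^ (2 * q) * (((n : ℝ) ^ 2) ^ q) ^ 2 := by
          gcongr
          · exact h3.trans (pow_le_pow_right₀ (by linarith) (by omega))
          · nlinarith
      _ = (n : ℝ) ^ (6 * q) := by rw [← pow_mul, ← pow_mul, ← pow_add]; congr 1; ring
  have hexp : (n : ℝ) ^ (6 * q * r) = Real.exp (6 * ((r : ℝ) * q * Real.log n)) := by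
    rw [← Real.exp_log (show (0 : ℝ) < (n : ℝ) ^ (6 * q * r) by positivity), Real.log_pow]
    congr 1
    push_cast
    ring
  calc _ ≤ ((n : ℝ) ^ (6 * q)) ^ r := pow_le_pow_left₀ (by positivity) hstep _
    _ = _ := by rw [← pow_mul, hexp]

/-- For every `δ > 0` there exists `c > 0` such that for all integers
`n ≥ 2`, `s ≥ 1`, every real `K` with `2 ≤ K ≤ c·s/(log n)^3`, and every `Y ⊆ G` with
`|Y| = n`, the number of sets `J ⊆ Y` with `|J| = s` and `|J+J| ≤ K·s` is at most
`2^(δs) · binom(⌈(Ks+β)/2⌉, s)` where `β = β((1+δ)Ks)`. -/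
theorem number_of_sets_with_small_doubling_group {G : Type*} [AddCommGroup G] [DecidableEq G] :
    ∀ δ : ℝ, 0 < δ → ∃ c : ℝ, 0 < c ∧
      ∀ n s : ℕ, 2 ≤ n → 1 ≤ s →
      ∀ K : ℝ, 2 ≤ K → K ≤ c * s / (Real.log n) ^ 3 →
      ∀ Y : Finset G, Y.card = n →
      (Nat.card {J : Finset G | J ⊆ Y ∧ J.card = s ∧ ((J + J).card : ℝ) ≤ K * s} : ℝ) ≤
        (2 : ℝ) ^ (δ * s) *
          (Nat.choose ⌈(K * s + (betaSubgroup G ((1 + δ) * K * s) : ℝ)) / 2⌉₊ s : ℝ) := by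
  intro δ hδ
  have hlog2 : 1 / 2 < Real.log 2 := by linarith [Real.log_two_gt_d9]
  obtain ⟨D, hD⟩ : ∃ D, D = δ * Real.log 2 / 2 := ⟨_, rfl⟩
  have hD0 : 0 < D := by rw [hD]; positivity
  obtain ⟨ε, η, γ, hε0, hε1, hεD, hη0, hη₀, hη₁, hη₂, hγ0, hγ₁, hγ₂, hγ₃, hγ₄, hγ₅⟩ :=
    exists_constants hδ hD0
  refine ⟨γ ^ 2, by positivity, fun n s hn hs K hK hKc Y hY => ?_⟩
  obtain ⟨ℓ, hℓ⟩ : ∃ ℓ, ℓ = Real.log n := ⟨_, rfl⟩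
  have hn' : (2 : ℝ) ≤ n := by exact_mod_cast hn
  have hℓ2 : 1 / 2 ≤ ℓ := by
    rw [hℓ]
    exact hlog2.le.trans (Real.log_le_log two_pos hn')
  have hℓ0 : 0 < ℓ := by linarith
  rw [← hℓ, le_div_iff₀ (by positivity)] at hKc
  have hs1 : (1 : ℝ) ≤ s := by exact_mod_cast hs
  have hs0 : (0 : ℝ) < s := by linarith
  obtain ⟨m, hm⟩ : ∃ m, m = K * s := ⟨_, rfl⟩
  have hsm : 2 * (s : ℝ) ≤ m := by rw [hm]; exact mul_le_mul_of_nonneg_right hK hs0.le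
  have hmγ : m * ℓ ^ 3 ≤ (γ * s) ^ 2 := by
    calc m * ℓ ^ 3 = K * ℓ ^ 3 * s := by rw [hm]; ring
      _ ≤ γ ^ 2 * s * s := mul_le_mul_of_nonneg_right hKc hs0.le
      _ = _ := by ring
  have hγs : 2 * ℓ ^ 3 ≤ γ ^ 2 * s :=
    (mul_le_mul_of_nonneg_right hK (by positivity)).trans hKc
  have hℓγ : ℓ ≤ γ * m := by
    have h1 : ℓ * (1 / 4) ≤ ℓ ^ 3 := by
      have := mul_le_mul_of_nonneg_left (pow_le_pow_left₀ one_half_pos.le hℓ2 2) hℓ0.le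
      linarith only [this, show ℓ * ℓ ^ 2 = ℓ ^ 3 by ring]
    have h2 : γ ^ 2 * s ≤ γ * s :=
      mul_le_mul_of_nonneg_right (pow_le_of_le_one hγ0.le hγ₁ two_ne_zero) hs0.le
    have h3 : γ * (2 * s) ≤ γ * m := mul_le_mul_of_nonneg_left hsm hγ0.le
    linarith only [h1, h2, h3, hγs]
  have hγε : 4 ≤ ε * m := by
    have h1 : 8 * γ * m ≤ ε * m := by
      refine mul_le_mul_of_nonneg_right (by linarith) (by linarith)
    linarith
  obtain ⟨q, i, j, hq, hqm, hi, hj, hij⟩ := exists_parameters hη0 hη₀ hℓ2 hγ0.le hs0.le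
    (hℓγ.trans (mul_le_mul_of_nonneg_right hγ₂ (by linarith))) hmγ
  have hnexp : (n : ℝ) = Real.exp ℓ := by rw [hℓ, Real.exp_log (by linarith)]
  have hrε : ((i + j : ℕ) : ℝ) * q ≤ ε * m / 2 := by
    have h1 : ((i + j : ℕ) : ℝ) * q * (1 / 2) ≤ 140 / η ^ 2 * (γ * s) :=
      (mul_le_mul_of_nonneg_left hℓ2 (by positivity)).trans hij
    have h2 : 140 / η ^ 2 * (γ * s) ≤ 140 / η ^ 2 * (ε * η ^ 2 / 280 * s) := by gcongr
    have h3 : 140 / η ^ 2 * (ε * η ^ 2 / 280 * s) = ε * s / 2 := by field_simp; ring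
    have h4 : ε * (2 * s) ≤ ε * m := mul_le_mul_of_nonneg_left hsm hε0.le
    linarith
  have hrD : 6 * (((i + j : ℕ) : ℝ) * q * ℓ) ≤ D * s := by
    have h2 : 140 / η ^ 2 * (γ * s) ≤ 140 / η ^ 2 * (D * η ^ 2 / 840 * s) := by gcongr
    have h3 : 140 / η ^ 2 * (D * η ^ 2 / 840 * s) = D * s / 6 := by field_simp; ring
    linarith
  have hcount := card_le_of_parameters (Y := Y) hδ hε0 hε1 hη0.le (by linarith) (by linarith)
    (by linarith) hsm hγε hq hqm hi
    (by rw [hY, hnexp]; exact Real.exp_le_exp.2 hj) hrε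
  rw [hY, hm, ← mul_assoc (1 + δ)] at hcount
  refine hcount.trans ?_
  rw [← mul_assoc]
  refine mul_le_mul_of_nonneg_right ?_ (Nat.cast_nonneg _)
  have hX : (3 * (((n : ℝ) + 1) ^ q) ^ 2) ^ (i + j) ≤ Real.exp (D * s) := by
    refine (three_mul_succ_pow_le hn hq (i + j)).trans (Real.exp_le_exp.2 ?_)
    rwa [← hℓ]
  have hsqrt : 2 * √(2 * ε) ≤ D := by
    have h1 : √(2 * ε) ≤ D / 2 := Real.sqrt_le_iff.2 ⟨by positivity, by
      linarith only [hεD, show (D / 2) ^ 2 = D ^ 2 / 4 by ring]⟩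
    linarith only [h1]
  calc _ ≤ Real.exp (D * s) * Real.exp (D * s) := by
        refine mul_le_mul hX (Real.exp_le_exp.2 ?_) (Real.exp_pos _).le (Real.exp_pos _).le
        exact mul_le_mul_of_nonneg_right hsqrt hs0.le
    _ = (2 : ℝ) ^ (δ * s) := by
        rw [← Real.exp_add, Real.rpow_def_of_pos two_pos, hD]
        congr 1
        ring
end

section
/- For every δ > 0 there exists c > 0 such that the following holds for all integers n ≥ 2 and s ≥ 1 and every real number K with 2 ≤ K ≤ c·s/(log n)^3. Let N be the number of sets J ⊆ [n] with |J| = s and |J+J| ≤ K·s, and let N' be the number of such sets J for which there exists T ⊆ J with |T| ≤ δ·s such that J∖T is contained in an arithmetic progression of size at most (1+δ)·Ks/2. Then N − N' ≤ δ·N; that is, for all but at most a δ-fraction of the sets J ⊆ [n] with |J| = s and |J+J| ≤ K|J|, there is a set T ⊆ J with |T| ≤ δs such that J∖T is contained in an arithmetic progression of size at most (1+δ)Ks/2. -/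
open Pointwise

/-- If almost all sums of elements of `X` lie in a set `A` barely larger than `X`, then `X - X` is
a subgroup, of size about `#A`. -/
theorem exists_addSubgroup_eq_sub {G : Type*} [AddCommGroup G] [DecidableEq G]
    (X A : Finset G) (e f : ℕ) (hX : ∀ x ∈ X, (X.filter fun y => x + y ∉ A).card ≤ e)
    (hA : A.card ≤ X.card + f) (hlarge : 6 * e + 3 * f < X.card) :
    ∃ H : AddSubgroup G, (H : Set G) = ((X - X : Finset G) : Set G) ∧
      (X - X).card * (X.card - 2 * e) ≤ A.card ^ 2 := by
  classical
  have hX0 : X.Nonempty := Finset.card_pos.mp (by omega)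
  obtain ⟨x₀, hx₀⟩ := hX0
  -- differences of elements of `X` are popular differences of `A`
  have popular : ∀ d ∈ X - X, X.card ≤ (A.filter fun p => p + d ∈ A).card + 2 * e := by
    intro d hd
    obtain ⟨x, hx, y, hy, rfl⟩ := Finset.mem_sub.mp hd
    have h1 : X ⊆ ((X.filter fun z => x + z ∉ A) ∪ (X.filter fun z => y + z ∉ A)) ∪
        (X.filter fun z => x + z ∈ A ∧ y + z ∈ A) := by
      intro z hz
      simp only [Finset.mem_union, Finset.mem_filter]
      tauto
    have h2 := (Finset.card_le_card h1).trans (Finset.card_union_le _ _)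
    have h3 := Finset.card_union_le (X.filter fun z => x + z ∉ A) (X.filter fun z => y + z ∉ A)
    have h4 : (X.filter fun z => x + z ∈ A ∧ y + z ∈ A).card ≤
        (A.filter fun p => p + (x - y) ∈ A).card := by
      apply Finset.card_le_card_of_injOn (fun z => y + z)
      · intro z hz
        simp only [Finset.coe_filter, Set.mem_ofPred_eq] at hz ⊢
        refine ⟨hz.2.2, ?_⟩
        rw [show y + z + (x - y) = x + z by abel]
        exact hz.2.1
      · intro z _ z' _ h
        exact add_left_cancel h
    have := hX x hx
    have := hX y hy
    omega
  -- few elements of `A` are outside the translate `x₀ + X`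
  have outside : (A.filter fun p => p - x₀ ∉ X).card ≤ e + f := by
    have h1 : (X.filter fun y => x₀ + y ∈ A).card ≤ (A.filter fun p => p - x₀ ∈ X).card := by
      apply Finset.card_le_card_of_injOn (fun z => x₀ + z)
      · intro z hz
        simp only [Finset.coe_filter, Set.mem_ofPred_eq] at hz ⊢
        exact ⟨hz.2, by simpa using hz.1⟩
      · intro z _ z' _ h
        exact add_left_cancel h
    have h2 := Finset.card_filter_add_card_filter_not (s := X) (fun y => x₀ + y ∈ A)
    have h3 := Finset.card_filter_add_card_filter_not (s := A) (fun p => p - x₀ ∈ X)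
    have := hX x₀ hx₀
    omega
  have closed : ∀ d₁ ∈ X - X, ∀ d₂ ∈ X - X, d₁ + d₂ ∈ X - X := by
    intro d₁ h₁ d₂ h₂
    by_contra hcon
    have h1 : (A.filter fun p => p + d₁ ∈ A).card = (A.filter fun q => q - d₁ ∈ A).card := by
      apply Finset.card_bij (fun p _ => p + d₁)
      · intro p hp
        simp only [Finset.mem_filter] at hp ⊢
        simpa using hp.symm
      · intro p _ p' _ h
        exact add_right_cancel h
      · intro q hq
        simp only [Finset.mem_filter] at hq
        exact ⟨q - d₁, by simpa using hq.symm, by simp⟩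
    have h2 := Finset.card_union_add_card_inter (A.filter fun q => q - d₁ ∈ A)
      (A.filter fun p => p + d₂ ∈ A)
    have h3 : ((A.filter fun q => q - d₁ ∈ A) ∪ (A.filter fun p => p + d₂ ∈ A)).card ≤ A.card :=
      Finset.card_le_card (Finset.union_subset (Finset.filter_subset _ _)
        (Finset.filter_subset _ _))
    have h4 : ((A.filter fun q => q - d₁ ∈ A) ∩ (A.filter fun p => p + d₂ ∈ A)) ⊆
        ((A.filter fun p => p - x₀ ∉ X).image fun p => p + d₁) ∪
        ((A.filter fun p => p - x₀ ∉ X).image fun p => p - d₂) := by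
      intro q hq
      simp only [Finset.mem_inter, Finset.mem_filter] at hq
      obtain ⟨⟨_, hq1⟩, _, hq2⟩ := hq
      by_contra hno
      apply hcon
      simp only [Finset.mem_union, Finset.mem_image, Finset.mem_filter, not_or, not_exists] at hno
      have e1 : q - d₁ - x₀ ∈ X := by
        by_contra h
        exact hno.1 (q - d₁) ⟨⟨hq1, h⟩, by simp⟩
      have e2 : q + d₂ - x₀ ∈ X := by
        by_contra h
        exact hno.2 (q + d₂) ⟨⟨hq2, h⟩, by simp⟩
      have := Finset.sub_mem_sub e2 e1
      rwa [show q + d₂ - x₀ - (q - d₁ - x₀) = d₁ + d₂ by abel] at this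
    have h5 := (Finset.card_le_card h4).trans (Finset.card_union_le _ _)
    have h6 := Finset.card_image_le (s := A.filter fun p => p - x₀ ∉ X) (f := fun p => p + d₁)
    have h7 := Finset.card_image_le (s := A.filter fun p => p - x₀ ∉ X) (f := fun p => p - d₂)
    have := popular d₁ h₁
    have := popular d₂ h₂
    omega
  refine ⟨{ carrier := ((X - X : Finset G) : Set G)
            add_mem' := ?_
            zero_mem' := ?_
            neg_mem' := ?_ }, rfl, ?_⟩
  · intro a b ha hb
    exact closed a ha b hb
  · have := Finset.sub_mem_sub hx₀ hx₀
    simpa using this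
  · intro a ha
    obtain ⟨x, hx, y, hy, rfl⟩ := Finset.mem_sub.mp (Finset.mem_coe.mp ha)
    rw [neg_sub]
    exact Finset.mem_coe.mpr (Finset.sub_mem_sub hy hx)
  · have h1 : ∀ d ∈ X - X, X.card - 2 * e ≤
        ((A ×ˢ A).filter fun x => x.2 - x.1 = d).card := by
      intro d hd
      have h2 : (A.filter fun p => p + d ∈ A).card ≤
          ((A ×ˢ A).filter fun x => x.2 - x.1 = d).card := by
        apply Finset.card_le_card_of_injOn (fun p => (p, p + d))
        · intro p hp
          simp only [Finset.coe_filter, Set.mem_ofPred_eq, Finset.mem_product] at hp ⊢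
          exact ⟨hp, by simp⟩
        · intro p _ p' _ h
          exact (Prod.ext_iff.mp h).1
      have := popular d hd
      omega
    calc (X - X).card * (X.card - 2 * e) = ∑ d ∈ X - X, (X.card - 2 * e) := by simp
      _ ≤ ∑ d ∈ X - X, ((A ×ˢ A).filter fun x => x.2 - x.1 = d).card := Finset.sum_le_sum h1
      _ ≤ (A ×ˢ A).card := by
        rw [← Finset.card_biUnion]
        · apply Finset.card_le_card
          intro x hx
          simp only [Finset.mem_biUnion, Finset.mem_filter] at hx
          exact hx.choose_spec.2.1
        · intro d _ d' _ hne
          apply Finset.disjoint_filter.mpr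
          rintro x _ rfl h
          exact hne h
      _ = A.card ^ 2 := by rw [Finset.card_product, sq]

/-- If a finite set of integers has a large image in a subgroup of `ZMod m`, where `m` is its
diameter, then it is contained in a short arithmetic progression. -/
theorem subset_progression_of_mod_mem_addSubgroup (B : Finset ℤ) (a : ℤ) (m : ℕ) (hm : 0 < m)
    (hB : ∀ v ∈ B, a ≤ v ∧ v ≤ a + m) (H : AddSubgroup (ZMod m)) (D : Finset (ZMod m))
    (hD : (H : Set (ZMod m)) = D) (hBH : ∀ v ∈ B, ((v - a : ℤ) : ZMod m) ∈ H) :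
    ∃ d : ℤ, d ≠ 0 ∧ B ⊆ (Finset.range (D.card + 1)).image (fun i : ℕ => a + (i : ℤ) * d) := by
  have hcyc := Int.subgroup_cyclic (H.comap (Int.castAddHom (ZMod m)))
  obtain ⟨g, hg⟩ := hcyc
  have hmem : ∀ x : ℤ, (x : ZMod m) ∈ H ↔ g ∣ x := by
    intro x
    have : x ∈ H.comap (Int.castAddHom (ZMod m)) ↔ g ∣ x := by
      rw [hg, AddSubgroup.mem_closure_singleton]
      constructor
      · rintro ⟨z, rfl⟩
        exact ⟨z, by simp [mul_comm]⟩
      · rintro ⟨z, rfl⟩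
        exact ⟨z, by simp [mul_comm]⟩
    simpa using this
  have hgm : g ∣ (m : ℤ) := by
    rw [← hmem]
    simp
  have hg0 : g ≠ 0 := by
    rintro rfl
    simp at hgm
    omega
  have hd0 : 0 < |g| := abs_pos.mpr hg0
  obtain ⟨r, hr⟩ := (abs_dvd g (m : ℤ)).mpr hgm
  have hr0 : 0 < r := by
    have : 0 < |g| * r := by rw [← hr]; exact_mod_cast hm
    exact (pos_iff_pos_of_mul_pos this).mp hd0
  lift r to ℕ using hr0.le
  have hrD : r ≤ D.card := by
    have : (Finset.range r).card ≤ D.card := by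
      apply Finset.card_le_card_of_injOn (fun i : ℕ => (((i : ℤ) * |g| : ℤ) : ZMod m))
      · intro i _
        rw [← hD]
        exact (hmem _).mpr (Dvd.dvd.mul_left (by simp) _)
      · intro i hi j hj hij
        simp only [Finset.coe_range, Set.mem_Iio] at hi hj
        have h1 := (ZMod.intCast_eq_intCast_iff_dvd_sub _ _ _).mp hij
        rw [hr, ← sub_mul, mul_comm (|g|)] at h1
        have h2 := Int.dvd_of_mul_dvd_mul_right hd0.ne' h1
        have h3 : (j : ℤ) - i = 0 := by
          apply Int.eq_zero_of_abs_lt_dvd h2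
          rw [abs_lt]
          omega
        omega
    simpa using this
  refine ⟨|g|, hd0.ne', ?_⟩
  intro v hv
  obtain ⟨i, hi⟩ := (abs_dvd g _).mpr ((hmem _).mp (hBH v hv))
  have hb := hB v hv
  have hi0 : 0 ≤ i := by
    by_contra h
    push Not at h
    nlinarith
  have hir : i ≤ r := by
    by_contra h
    push Not at h
    nlinarith
  lift i to ℕ using hi0
  rw [Finset.mem_image]
  refine ⟨i, ?_, ?_⟩
  · rw [Finset.mem_range]
    omega
  · linarith [mul_comm (|g|) (i : ℤ)]

/-- A set of integers `B` most of whose sums lie in `A` satisfies `#A ≥ (2 - o(1)) #B`, and if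
`#A ≤ (2 + o(1)) #B` then `B` is contained in an arithmetic progression of about its size. -/
theorem subset_progression_of_forall_few_missing_sums (B A : Finset ℤ) (e : ℕ)
    (hdeg : ∀ v ∈ B, (B.filter fun u => v + u ∉ A).card ≤ e) (hB : 50 * (e + 1) ≤ B.card) :
    2 * B.card ≤ A.card + 2 * e + 1 ∧
    (A.card ≤ 2 * B.card + 3 * e → ∃ a d : ℤ, d ≠ 0 ∧ ∃ L : ℕ, L ≤ B.card + 21 * (e + 1) ∧
      B ⊆ (Finset.range L).image (fun i : ℕ => a + (i : ℤ) * d)) := by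
  have hne : B.Nonempty := Finset.card_pos.mp (by omega)
  set a := B.min' hne with ha
  set b := B.max' hne with hb
  have haB : a ∈ B := Finset.min'_mem _ _
  have hbB : b ∈ B := Finset.max'_mem _ _
  have hle : ∀ v ∈ B, a ≤ v ∧ v ≤ b := fun v hv => ⟨Finset.min'_le _ _ hv, Finset.le_max' _ _ hv⟩
  have hab : a < b := by
    apply Finset.min'_lt_max'_of_card
    omega
  have hU : ∀ v ∈ B, B.card ≤ (B.filter fun u => v + u ∈ A).card + e := by
    intro v hv
    have := hdeg v hv
    have := Finset.card_filter_add_card_filter_not (s := B) (fun u => v + u ∈ A)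
    omega
  constructor
  · have h1 : ((B.filter fun u => a + u ∈ A).image fun u => a + u) ∪
        ((B.filter fun u => b + u ∈ A).image fun u => b + u) ⊆ A := by
      intro x hx
      simp only [Finset.mem_union, Finset.mem_image, Finset.mem_filter] at hx
      rcases hx with ⟨u, hu, rfl⟩ | ⟨u, hu, rfl⟩
      · exact hu.2
      · exact hu.2
    have h2 : ((B.filter fun u => a + u ∈ A).image fun u => a + u) ∩
        ((B.filter fun u => b + u ∈ A).image fun u => b + u) ⊆ {a + b} := by
      intro x hx
      simp only [Finset.mem_inter, Finset.mem_image, Finset.mem_filter] at hx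
      obtain ⟨⟨u, hu, rfl⟩, w, hw, hwu⟩ := hx
      have := hle u hu.1
      have := hle w hw.1
      rw [Finset.mem_singleton]
      omega
    have h3 := Finset.card_union_add_card_inter ((B.filter fun u => a + u ∈ A).image fun u => a + u)
      ((B.filter fun u => b + u ∈ A).image fun u => b + u)
    rw [Finset.card_image_of_injective _ (add_right_injective a),
      Finset.card_image_of_injective _ (add_right_injective b)] at h3
    have h4 := Finset.card_le_card h1
    have h5 := Finset.card_le_card h2
    rw [Finset.card_singleton] at h5
    have := hU a haB
    have := hU b hbB
    omega
  · intro hA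
    obtain ⟨m, hm⟩ : ∃ m : ℕ, (m : ℤ) = b - a := ⟨(b - a).toNat, by omega⟩
    have hm0 : 0 < m := by omega
    have : NeZero m := ⟨hm0.ne'⟩
    let φ : ℤ → ZMod m := fun x => (x : ZMod m)
    have hφab : φ a = φ b := by
      apply (ZMod.intCast_eq_intCast_iff_dvd_sub _ _ _).mpr
      rw [hm]
    have hX : B.card ≤ (B.image φ).card + 1 := by
      have h1 : (B.erase b).card ≤ (B.image φ).card := by
        apply Finset.card_le_card_of_injOn φ
        · intro x hx
          exact Finset.mem_coe.mpr (Finset.mem_image_of_mem _ (Finset.mem_of_mem_erase hx))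
        · intro x hx y hy hxy
          have h2 := (ZMod.intCast_eq_intCast_iff_dvd_sub _ _ _).mp hxy
          have hx := Finset.mem_erase.mp (Finset.mem_coe.mp hx)
          have hy := Finset.mem_erase.mp (Finset.mem_coe.mp hy)
          have := hle x hx.2
          have := hle y hy.2
          have h3 : y - x = 0 := by
            apply Int.eq_zero_of_abs_lt_dvd h2
            rw [abs_lt]
            omega
          omega
      rw [Finset.card_erase_of_mem hbB] at h1
      omega
    have hA' : (A.image φ).card ≤ B.card + 5 * e + 1 := by
      set U := (B.filter fun u => a + u ∈ A ∧ b + u ∈ A).erase a with hUdef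
      have hUmem : ∀ u ∈ U, u ≠ a ∧ u ∈ B ∧ a + u ∈ A ∧ b + u ∈ A := by
        intro u hu
        simpa [hUdef] using hu
      have hUcard : B.card ≤ U.card + 2 * e + 1 := by
        have h1 : B ⊆ (B.filter fun u => a + u ∉ A) ∪ (B.filter fun u => b + u ∉ A) ∪
            (B.filter fun u => a + u ∈ A ∧ b + u ∈ A) := by
          intro u hu
          simp only [Finset.mem_union, Finset.mem_filter]
          tauto
        have h2 := (Finset.card_le_card h1).trans (Finset.card_union_le _ _)
        have h3 := Finset.card_union_le (B.filter fun u => a + u ∉ A) (B.filter fun u => b + u ∉ A)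
        have h4 := Finset.pred_card_le_card_erase
          (s := B.filter fun u => a + u ∈ A ∧ b + u ∈ A) (a := a)
        rw [← hUdef] at h4
        have := hdeg a haB
        have := hdeg b hbB
        omega
      have h1 : A.image φ ⊆ (A \ U.image fun u => b + u).image φ := by
        intro x hx
        obtain ⟨y, hy, rfl⟩ := Finset.mem_image.mp hx
        by_cases hyU : y ∈ U.image fun u => b + u
        · obtain ⟨u, hu, rfl⟩ := Finset.mem_image.mp hyU
          obtain ⟨hua, huB, hu1, hu2⟩ := hUmem u hu
          refine Finset.mem_image.mpr ⟨a + u, ?_, ?_⟩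
          · refine Finset.mem_sdiff.mpr ⟨hu1, ?_⟩
            intro h
            obtain ⟨w, hw, hwu⟩ := Finset.mem_image.mp h
            obtain ⟨hwa, hwB, -, -⟩ := hUmem w hw
            have := hle w hwB
            have := hle u huB
            omega
          · simp only [φ, Int.cast_add] at hφab ⊢
            rw [hφab]
        · exact Finset.mem_image_of_mem _ (Finset.mem_sdiff.mpr ⟨hy, hyU⟩)
      have h2 := (Finset.card_le_card h1).trans Finset.card_image_le
      have h3 : (U.image fun u => b + u) ⊆ A := by
        intro x hx
        obtain ⟨u, hu, rfl⟩ := Finset.mem_image.mp hx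
        exact (hUmem u hu).2.2.2
      rw [Finset.card_sdiff_of_subset h3,
        Finset.card_image_of_injective _ (add_right_injective b)] at h2
      have h4 := Finset.card_le_card h3
      rw [Finset.card_image_of_injective _ (add_right_injective b)] at h4
      omega
    obtain ⟨H, hH, hcard⟩ := exists_addSubgroup_eq_sub (B.image φ) (A.image φ) e (5 * e + 2) (by
        intro x hx
        obtain ⟨v, hv, rfl⟩ := Finset.mem_image.mp hx
        refine le_trans ?_ (hdeg v hv)
        have : ((B.image φ).filter fun y => φ v + y ∉ A.image φ) ⊆
            (B.filter fun u => v + u ∉ A).image φ := by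
          intro y hy
          obtain ⟨hy1, hy2⟩ := Finset.mem_filter.mp hy
          obtain ⟨u, hu, rfl⟩ := Finset.mem_image.mp hy1
          refine Finset.mem_image_of_mem _ (Finset.mem_filter.mpr ⟨hu, ?_⟩)
          intro h
          apply hy2
          refine Finset.mem_image.mpr ⟨v + u, h, ?_⟩
          simp [φ]
        exact (Finset.card_le_card this).trans Finset.card_image_le) (by omega) (by omega)
    obtain ⟨d, hd, hsub⟩ := subset_progression_of_mod_mem_addSubgroup B a m hm0 (by
        intro v hv
        have := hle v hv
        omega) H (B.image φ - B.image φ) hH (by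
        intro v hv
        rw [← SetLike.mem_coe, hH, Finset.mem_coe, Int.cast_sub]
        exact Finset.sub_mem_sub (Finset.mem_image_of_mem _ hv) (Finset.mem_image_of_mem _ haB))
    refine ⟨a, d, hd, _, ?_, hsub⟩
    set h := (B.image φ - B.image φ).card
    have h1 : h * (B.card - (2 * e + 1)) ≤ (B.card + 5 * e + 1) ^ 2 := by
      refine le_trans ?_ (hcard.trans (Nat.pow_le_pow_left hA' 2))
      exact Nat.mul_le_mul_left _ (by omega)
    obtain ⟨k, hk⟩ : ∃ k, B.card = k + (2 * e + 1) := ⟨B.card - (2 * e + 1), by omega⟩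
    rw [hk] at h1 hB ⊢
    rw [Nat.add_sub_cancel] at h1
    by_contra hcon
    push Not at hcon
    nlinarith

/-- Version of `subset_progression_of_forall_few_missing_sums` where only the total number of
missing sums is controlled; a few elements of `B` may then fall outside the progression. -/
theorem mostly_subset_progression_of_few_missing_sums (B A : Finset ℤ) (e : ℕ)
    (hbad : ((B ×ˢ B).filter fun p => p.1 + p.2 ∉ A).card ≤ e ^ 2)
    (hB : 100 * (e + 1) ≤ B.card) :
    2 * B.card ≤ A.card + 4 * e + 1 ∧
    (A.card ≤ 2 * B.card + e → ∃ a d : ℤ, d ≠ 0 ∧ ∃ L : ℕ, L ≤ B.card + 21 * (e + 1) ∧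
      (B \ (Finset.range L).image (fun i : ℕ => a + (i : ℤ) * d)).card ≤ e) := by
  set B' := B.filter fun v => (B.filter fun u => v + u ∉ A).card ≤ e with hB'
  have hsub : B' ⊆ B := Finset.filter_subset _ _
  have hrem : (B \ B').card ≤ e := by
    have h1 : (B \ B').card * (e + 1) ≤ e ^ 2 := by
      calc (B \ B').card * (e + 1) = ∑ v ∈ B \ B', (e + 1) := by simp
        _ ≤ ∑ v ∈ B \ B', (B.filter fun u => v + u ∉ A).card := by
          apply Finset.sum_le_sum
          intro v hv
          simp only [hB', Finset.mem_sdiff, Finset.mem_filter, not_and, not_le] at hv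
          exact hv.2 hv.1
        _ ≤ ∑ v ∈ B, (B.filter fun u => v + u ∉ A).card :=
          Finset.sum_le_sum_of_subset Finset.sdiff_subset
        _ = ((B ×ˢ B).filter fun p => p.1 + p.2 ∉ A).card := by
          simp only [Finset.card_filter, Finset.sum_product]
        _ ≤ e ^ 2 := hbad
    by_contra hcon
    push Not at hcon
    nlinarith
  have hcard := Finset.card_sdiff_add_card_eq_card hsub
  obtain ⟨h1, h2⟩ := subset_progression_of_forall_few_missing_sums B' A e (by
    intro v hv
    refine le_trans (Finset.card_le_card ?_) (Finset.mem_filter.mp hv).2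
    exact Finset.filter_subset_filter _ hsub) (by omega)
  refine ⟨by omega, fun hA => ?_⟩
  obtain ⟨a, d, hd, L, hL, hBL⟩ := h2 (by omega)
  refine ⟨a, d, hd, L, by omega, ?_⟩
  exact (Finset.card_le_card (Finset.sdiff_subset_sdiff le_rfl hBL)).trans hrem

section Containers

variable {G : Type*} [AddCommGroup G] [DecidableEq G]

/-- There are few pairs `(S', B')`, each with `#B' ≤ β` or with all but few pairs of elements of
`B'` summing to an element of `S' + S'`, such that every `J` between `S` and `B` with
`#(J + J) ≤ m` lies between the two components of one of them. -/
def HasSumsetContainers (m β E t : ℕ) (S B : Finset G) : Prop :=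
  ∃ F : Finset (Finset G × Finset G), F.card ≤ (B.card + 1) ^ t ∧
    (∀ p ∈ F, (p.1 + p.1).card ≤ m ∧ (p.2.card ≤ β ∨
      E * ((p.2 ×ˢ p.2).filter fun x => x.1 + x.2 ∉ p.1 + p.1).card ≤ 2 * p.2.card ^ 2)) ∧
    ∀ J, S ⊆ J → J ⊆ B → (J + J).card ≤ m → ∃ p ∈ F, p.1 ⊆ J ∧ J ⊆ p.2

theorem HasSumsetContainers.mono {m β E t t' : ℕ} {S B : Finset G} (ht : t ≤ t')
    (h : HasSumsetContainers m β E t S B) : HasSumsetContainers m β E t' S B := by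
  obtain ⟨F, h1, h2, h3⟩ := h
  exact ⟨F, h1.trans (Nat.pow_le_pow_right (by omega) ht), h2, h3⟩

theorem HasSumsetContainers.of_lt_card {m β E t : ℕ} {S B : Finset G} (h : m < (S + S).card) :
    HasSumsetContainers m β E t S B := by
  refine ⟨∅, by simp, by simp, ?_⟩
  intro J hSJ _ hJ
  have := Finset.card_le_card (Finset.add_subset_add hSJ hSJ)
  omega

theorem HasSumsetContainers.of_terminal {m β E t : ℕ} {S B : Finset G} (h : (S + S).card ≤ m)
    (hB : B.card ≤ β ∨
      E * ((B ×ˢ B).filter fun x => x.1 + x.2 ∉ S + S).card ≤ 2 * B.card ^ 2) :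
    HasSumsetContainers m β E t S B := by
  refine ⟨{(S, B)}, ?_, ?_, ?_⟩
  · rw [Finset.card_singleton]
    exact Nat.one_le_pow _ _ (by omega)
  · intro p hp
    rw [Finset.mem_singleton] at hp
    subst hp
    exact ⟨h, hB⟩
  · intro J h1 h2 _
    exact ⟨(S, B), by simp, h1, h2⟩

theorem HasSumsetContainers.of_query {m β E t : ℕ} {S B : Finset G} {v : G} (hv : v ∈ B)
    (hno : HasSumsetContainers m β E (t + 1) S (B.erase v))
    (hyes : HasSumsetContainers m β E t (insert v S) B) :
    HasSumsetContainers m β E (t + 1) S B := by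
  classical
  obtain ⟨F, h1, h2, h3⟩ := hno
  obtain ⟨F', h1', h2', h3'⟩ := hyes
  refine ⟨F ∪ F', ?_, ?_, ?_⟩
  · have hb := Finset.card_erase_add_one hv
    rw [hb] at h1
    calc (F ∪ F').card ≤ F.card + F'.card := Finset.card_union_le _ _
      _ ≤ B.card ^ (t + 1) + (B.card + 1) ^ t := add_le_add h1 h1'
      _ ≤ (B.card + 1) ^ t * B.card + (B.card + 1) ^ t := by
        rw [pow_succ]
        gcongr
        omega
      _ = (B.card + 1) ^ (t + 1) := by ring
  · intro p hp
    rcases Finset.mem_union.mp hp with hp | hp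
    · exact h2 p hp
    · exact h2' p hp
  · intro J hSJ hJB hJ
    by_cases hvJ : v ∈ J
    · obtain ⟨p, hp, hp'⟩ := h3' J (Finset.insert_subset hvJ hSJ) hJB hJ
      exact ⟨p, Finset.mem_union_right _ hp, hp'⟩
    · obtain ⟨p, hp, hp'⟩ := h3 J hSJ (Finset.subset_erase.mpr ⟨hJB, hvJ⟩) hJ
      exact ⟨p, Finset.mem_union_left _ hp, hp'⟩

theorem card_add_insert_ge (S : Finset G) (u : G) :
    (S + S).card + (S.filter fun s => u + s ∉ S + S).card ≤
      (insert u S + insert u S).card := by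
  have h1 : ((S.filter fun s => u + s ∉ S + S).image fun s => u + s).card =
      (S.filter fun s => u + s ∉ S + S).card :=
    Finset.card_image_of_injective _ (add_right_injective u)
  rw [← h1, ← Finset.card_union_of_disjoint]
  · apply Finset.card_le_card
    apply Finset.union_subset
    · exact Finset.add_subset_add (Finset.subset_insert _ _) (Finset.subset_insert _ _)
    · intro x hx
      obtain ⟨s, hs, rfl⟩ := Finset.mem_image.mp hx
      exact Finset.add_mem_add (Finset.mem_insert_self _ _)
        (Finset.mem_insert_of_mem (Finset.mem_filter.mp hs).1)
  · rw [Finset.disjoint_left]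
    intro x hx hx'
    obtain ⟨s, hs, rfl⟩ := Finset.mem_image.mp hx'
    exact (Finset.mem_filter.mp hs).2 hx

theorem sum_card_filter_add_swap (S B A : Finset G) :
    ∑ v ∈ S, (B.filter fun u => v + u ∉ A).card = ∑ u ∈ B, (S.filter fun s => u + s ∉ A).card := by
  simp only [Finset.card_filter]
  rw [Finset.sum_comm]
  simp only [add_comm]

theorem card_growth_of_many_heavy {E D g : ℕ} (hE : 1 ≤ E) (hD : 1 ≤ D) {S₀ B₀ S B V : Finset G}
    (hBB : B ⊆ B₀) (hVS : V ⊆ S) (hV : V.card = 2 * E * D)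
    (hdeg : ∀ v ∈ V, B₀.card ≤ E * (B₀.filter fun u => v + u ∉ S₀ + S₀).card)
    (hshrink : 4 * E * B₀.card < 4 * E * B.card + B₀.card) (hg : 4 * E * g ≤ B.card)
    (hlow : ∀ u ∈ B, (S.filter fun s => u + s ∉ S + S).card ≤ D) (hSS : S₀ ⊆ S) :
    (S₀ + S₀).card + g ≤ (S + S).card := by
  by_contra hcon
  push Not at hcon
  have hSS2 := Finset.add_subset_add hSS hSS
  set W := (S + S) \ (S₀ + S₀) with hW
  have hWc : W.card + (S₀ + S₀).card = (S + S).card := Finset.card_sdiff_add_card_eq_card hSS2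
  have h1 : ∀ v ∈ V, (B₀.filter fun u => v + u ∉ S₀ + S₀).card ≤
      (B₀ \ B).card + (B.filter fun u => v + u ∉ S + S).card + W.card := by
    intro v _
    have hsub : (B₀.filter fun u => v + u ∉ S₀ + S₀) ⊆
        ((B₀ \ B) ∪ (B.filter fun u => v + u ∉ S + S)) ∪ (B.filter fun u => v + u ∈ W) := by
      intro u hu
      simp only [Finset.mem_union, Finset.mem_filter, hW, Finset.mem_sdiff] at hu ⊢
      tauto
    have h2 : (B.filter fun u => v + u ∈ W).card ≤ W.card := by
      apply Finset.card_le_card_of_injOn (fun u => v + u)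
      · intro u hu
        exact (Finset.mem_filter.mp (Finset.mem_coe.mp hu)).2
      · intro u _ u' _ h
        exact add_left_cancel h
    have h3 := (Finset.card_le_card hsub).trans (Finset.card_union_le _ _)
    have h4 := Finset.card_union_le (B₀ \ B) (B.filter fun u => v + u ∉ S + S)
    omega
  have h2 : ∑ v ∈ V, (B.filter fun u => v + u ∉ S + S).card ≤ B.card * D := by
    calc ∑ v ∈ V, (B.filter fun u => v + u ∉ S + S).card
        ≤ ∑ v ∈ S, (B.filter fun u => v + u ∉ S + S).card := Finset.sum_le_sum_of_subset hVS
      _ = ∑ u ∈ B, (S.filter fun s => u + s ∉ S + S).card := sum_card_filter_add_swap _ _ _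
      _ ≤ ∑ u ∈ B, D := Finset.sum_le_sum hlow
      _ = B.card * D := by simp
  have h3 : V.card * B₀.card ≤
      E * (V.card * (B₀ \ B).card + B.card * D + V.card * W.card) := by
    calc V.card * B₀.card = ∑ v ∈ V, B₀.card := by simp
      _ ≤ ∑ v ∈ V, E * (B₀.filter fun u => v + u ∉ S₀ + S₀).card := Finset.sum_le_sum hdeg
      _ ≤ ∑ v ∈ V, E * ((B₀ \ B).card + (B.filter fun u => v + u ∉ S + S).card + W.card) :=
        Finset.sum_le_sum fun v hv => Nat.mul_le_mul_left _ (h1 v hv)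
      _ = E * (V.card * (B₀ \ B).card + ∑ v ∈ V, (B.filter fun u => v + u ∉ S + S).card +
          V.card * W.card) := by
        rw [← Finset.mul_sum, Finset.sum_add_distrib, Finset.sum_add_distrib]
        simp
      _ ≤ _ := by gcongr
  have h4 := Finset.card_sdiff_add_card_eq_card hBB
  have hWg : W.card ≤ g := by omega
  have hVpos : 0 < V.card := by
    rw [hV]
    positivity
  have h5 : 4 * E * (B₀ \ B).card < B₀.card := by
    rw [← h4] at hshrink ⊢
    linarith
  have h6 : 4 * E * W.card ≤ B.card := le_trans (Nat.mul_le_mul_left _ hWg) hg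
  have h7 : V.card * (4 * E * (B₀ \ B).card) < V.card * B₀.card := Nat.mul_lt_mul_of_pos_left h5 hVpos
  have h8 : V.card * (4 * E * W.card) ≤ V.card * B.card := Nat.mul_le_mul_left _ h6
  have h9 : 4 * E * (B.card * D) = 2 * (V.card * B.card) := by rw [hV]; ring
  have h10 : V.card * B.card ≤ V.card * B₀.card :=
    Nat.mul_le_mul_left _ (Finset.card_le_card hBB)
  linarith

theorem exists_heavy_not_mem {E D : ℕ} (hE : 1 ≤ E) {B₀ S B : Finset G} (hSB : S ⊆ B)
    (hshrink : 4 * E * B₀.card < 4 * E * B.card + B₀.card) (hD : 2 * E * D ≤ B.card)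
    (hlow : ∀ u ∈ B, (S.filter fun s => u + s ∉ S + S).card ≤ D)
    (hbad : 2 * B.card ^ 2 < E * ((B ×ˢ B).filter fun x => x.1 + x.2 ∉ S + S).card) :
    ∃ v ∈ B \ S, B₀.card ≤ E * (B.filter fun u => v + u ∉ S + S).card := by
  by_contra! hcon
  have h1 : ((B ×ˢ B).filter fun x => x.1 + x.2 ∉ S + S).card =
      ∑ v ∈ B \ S, (B.filter fun u => v + u ∉ S + S).card +
        ∑ v ∈ S, (B.filter fun u => v + u ∉ S + S).card := by
    rw [Finset.sum_sdiff hSB]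
    simp only [Finset.card_filter, Finset.sum_product]
  have h2 : ∑ v ∈ S, (B.filter fun u => v + u ∉ S + S).card ≤ B.card * D := by
    rw [sum_card_filter_add_swap]
    calc _ ≤ ∑ u ∈ B, D := Finset.sum_le_sum hlow
      _ = B.card * D := by simp
  have h3 : E * ∑ v ∈ B \ S, (B.filter fun u => v + u ∉ S + S).card ≤ B.card * B₀.card := by
    rw [Finset.mul_sum]
    calc _ ≤ ∑ v ∈ B \ S, B₀.card := Finset.sum_le_sum fun v hv => (hcon v hv).le
      _ = (B \ S).card * B₀.card := by simp
      _ ≤ _ := Nat.mul_le_mul_right _ (Finset.card_le_card Finset.sdiff_subset)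
  rw [h1, mul_add] at hbad
  have h4 : E * ∑ v ∈ S, (B.filter fun u => v + u ∉ S + S).card ≤ E * (B.card * D) :=
    Nat.mul_le_mul_left _ h2
  have h5 : 3 * B₀.card ≤ 4 * B.card := by
    by_contra! h
    nlinarith
  have h6 : B.card * (2 * E * D) ≤ B.card * B.card := Nat.mul_le_mul_left _ hD
  have h7 : B.card * (3 * B₀.card) ≤ B.card * (4 * B.card) := Nat.mul_le_mul_left _ h5
  nlinarith

theorem hasSumsetContainers_round {m β E D g T : ℕ} (hE : 1 ≤ E) (hD : 1 ≤ D)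
    (hDβ : 2 * E * D ≤ β) (hg : 4 * E * g ≤ β) (S₀ B₀ : Finset G)
    (hshrink : ∀ p S B, S₀ ⊆ S → S ⊆ B → m < p * D + (S + S).card →
      4 * E * B.card + B₀.card ≤ 4 * E * B₀.card → HasSumsetContainers m β E (T + p) S B)
    (hgrow : ∀ p S B, S ⊆ B → B ⊆ B₀ → m < p * D + (S + S).card →
      (S₀ + S₀).card + g ≤ (S + S).card → HasSumsetContainers m β E (T + p) S B)
    (c j p : ℕ) (S B V : Finset G) (hc : (B \ S).card = c) (hSS : S₀ ⊆ S) (hSB : S ⊆ B)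
    (hBB : B ⊆ B₀) (hp : m < p * D + (S + S).card) (hVS : V ⊆ S) (hj : V.card + j = 2 * E * D)
    (hdeg : ∀ v ∈ V, B₀.card ≤ E * (B₀.filter fun u => v + u ∉ S₀ + S₀).card) :
    HasSumsetContainers m β E (T + j + p) S B := by
  induction c using Nat.strong_induction_on generalizing j p S B V with
  | _ c ih =>
  by_cases hm : m < (S + S).card
  · exact .of_lt_card hm
  push Not at hm
  by_cases hterm : B.card ≤ β ∨
      E * ((B ×ˢ B).filter fun x => x.1 + x.2 ∉ S + S).card ≤ 2 * B.card ^ 2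
  · exact .of_terminal hm hterm
  push Not at hterm
  obtain ⟨hβ, hbad⟩ := hterm
  by_cases hsh : 4 * E * B.card + B₀.card ≤ 4 * E * B₀.card
  · exact (hshrink p S B hSS hSB hp hsh).mono (by omega)
  push Not at hsh
  by_cases hgr : (S₀ + S₀).card + g ≤ (S + S).card
  · exact (hgrow p S B hSB hBB hp hgr).mono (by omega)
  have erase_step : ∀ v ∈ B \ S, HasSumsetContainers m β E (T + j + p) S (B.erase v) := by
    intro v hv
    have hv' := Finset.mem_sdiff.mp hv
    refine ih _ ?_ j p S (B.erase v) V rfl hSS (Finset.subset_erase.mpr ⟨hSB, hv'.2⟩)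
      ((Finset.erase_subset _ _).trans hBB) hp hVS hj hdeg
    rw [← hc, Finset.erase_sdiff_comm]
    exact Finset.card_erase_lt_of_mem hv
  have insert_lt : ∀ v ∈ B \ S, (B \ insert v S).card < c := by
    intro v hv
    rw [← hc, Finset.sdiff_insert]
    exact Finset.card_erase_lt_of_mem hv
  by_cases hu : ∃ u ∈ B \ S, D ≤ (S.filter fun s => u + s ∉ S + S).card
  · obtain ⟨u, hu, hDu⟩ := hu
    have hu' := Finset.mem_sdiff.mp hu
    obtain _ | p := p
    · omega
    refine .of_query hu'.1 (erase_step u hu) ?_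
    have := card_add_insert_ge S u
    exact ih _ (insert_lt u hu) j p _ B V rfl (hSS.trans (Finset.subset_insert _ _))
      (Finset.insert_subset hu'.1 hSB) hBB (by rw [add_mul] at hp; omega)
      (hVS.trans (Finset.subset_insert _ _)) hj hdeg
  push Not at hu
  have hlow : ∀ u ∈ B, (S.filter fun s => u + s ∉ S + S).card ≤ D := by
    intro u huB
    by_cases huS : u ∈ S
    · rw [Finset.filter_eq_empty_iff.mpr]
      · simp
      · intro s hs
        simpa using Finset.add_mem_add huS hs
    · exact (hu u (Finset.mem_sdiff.mpr ⟨huB, huS⟩)).le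
  obtain _ | j := j
  · exact absurd (card_growth_of_many_heavy hE hD hBB hVS (by omega) hdeg hsh (by omega) hlow hSS)
      hgr
  · obtain ⟨v, hv, hvdeg⟩ := exists_heavy_not_mem hE hSB hsh (by omega) hlow hbad
    have hv' := Finset.mem_sdiff.mp hv
    have hvV : v ∉ V := fun h => hv'.2 (hVS h)
    have e1 : T + (j + 1) + p = T + j + p + 1 := by omega
    have h1 := erase_step v hv
    rw [e1] at h1 ⊢
    refine .of_query hv'.1 h1 ?_
    have h2 := card_add_insert_ge S v
    refine ih _ (insert_lt v hv) j p _ B (insert v V) rfl (hSS.trans (Finset.subset_insert _ _))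
      (Finset.insert_subset hv'.1 hSB) hBB (by omega) (Finset.insert_subset_insert _ hVS) ?_ ?_
    · rw [Finset.card_insert_of_notMem hvV]
      omega
    · intro w hw
      rcases Finset.mem_insert.mp hw with rfl | hw
      · refine hvdeg.trans (Nat.mul_le_mul_left _ (Finset.card_le_card ?_))
        intro u hu
        obtain ⟨hu1, hu2⟩ := Finset.mem_filter.mp hu
        exact Finset.mem_filter.mpr ⟨hBB hu1, fun h => hu2 (Finset.add_subset_add hSS hSS h)⟩
      · exact hdeg w hw

/-- The container theorem for sumsets: `i` bounds the number of times `B` may shrink by a constant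
factor, `j` the number of times `S + S` may grow by `g`. -/
theorem hasSumsetContainers {m β E D g : ℕ} (hE : 1 ≤ E) (hD : 1 ≤ D)
    (hDβ : 2 * E * D ≤ β) (hg : 4 * E * g ≤ β) (r : ℕ) :
    ∀ (i j p : ℕ) (S B : Finset G), i + j = r → S ⊆ B →
      (4 * E - 1) ^ i * B.card ≤ (4 * E) ^ i * β → m < j * g + (S + S).card →
      m < p * D + (S + S).card → HasSumsetContainers m β E (2 * E * D * r + p) S B := by
  induction r with
  | zero =>
    intro i j p S B hij _ _ hj _
    obtain rfl : j = 0 := by omega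
    exact .of_lt_card (by omega)
  | succ r ih =>
    intro i j p S B hij hSB hi hj hp
    by_cases hm : m < (S + S).card
    · exact .of_lt_card hm
    obtain _ | i := i
    · exact .of_terminal (by omega) (Or.inl (by simpa using hi))
    obtain _ | j := j
    · omega
    have key := hasSumsetContainers_round (m := m) (T := 2 * E * D * r) hE hD hDβ hg S B
      (fun p' S' B' hSS' hSB' hp' hsh => ?_) (fun p' S' B' hSB' hBB' hp' hgr => ?_)
      _ (2 * E * D) p S B ∅ rfl le_rfl hSB le_rfl hp (by simp) (by simp) (by simp)
    · rw [show 2 * E * D * (r + 1) + p = 2 * E * D * r + 2 * E * D + p by ring]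
      exact key
    · refine ih i (j + 1) p' S' B' (by omega) hSB' ?_ ?_ hp'
      · have h1 : 4 * E * B'.card ≤ (4 * E - 1) * B.card := by
          rw [Nat.sub_mul]
          omega
        have h2 : 4 * E * ((4 * E - 1) ^ i * B'.card) ≤ 4 * E * ((4 * E) ^ i * β) := by
          calc _ = (4 * E - 1) ^ i * (4 * E * B'.card) := by ring
            _ ≤ (4 * E - 1) ^ i * ((4 * E - 1) * B.card) := Nat.mul_le_mul_left _ h1
            _ = (4 * E - 1) ^ (i + 1) * B.card := by ring
            _ ≤ (4 * E) ^ (i + 1) * β := hi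
            _ = _ := by ring
        exact Nat.le_of_mul_le_mul_left h2 (by omega)
      · have := Finset.card_le_card (Finset.add_subset_add hSS' hSS')
        omega
    · refine ih (i + 1) j p' S' B' (by omega) hSB' ?_ ?_ hp'
      · exact le_trans (Nat.mul_le_mul_left _ (Finset.card_le_card hBB')) hi
      · rw [add_mul] at hj
        omega

end Containers

theorem pow_mul_choose_le_pow_mul_choose {P Q a b s : ℕ}
    (h : ∀ k < s, P * (a - k) ≤ Q * (b - k)) : P ^ s * a.choose s ≤ Q ^ s * b.choose s := by
  have key : ∀ t ≤ s, P ^ t * a.descFactorial t ≤ Q ^ t * b.descFactorial t := by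
    intro t
    induction t with
    | zero => simp
    | succ t ih =>
      intro ht
      rw [Nat.descFactorial_succ, Nat.descFactorial_succ]
      calc _ = (P * (a - t)) * (P ^ t * a.descFactorial t) := by ring
        _ ≤ (Q * (b - t)) * (Q ^ t * b.descFactorial t) :=
          Nat.mul_le_mul (h t (by omega)) (ih (by omega))
        _ = _ := by ring
  have h1 := key s le_rfl
  rw [Nat.descFactorial_eq_factorial_mul_choose, Nat.descFactorial_eq_factorial_mul_choose] at h1
  refine Nat.le_of_mul_le_mul_left ?_ (Nat.factorial_pos s)
  linarith

/-- Few `s`-subsets of `B` have more than a `1 / w` proportion of their elements in a tiny subset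
`X` of `B`. -/
theorem pow_mul_card_powersetCard_filter_le {α : Type*} [DecidableEq α] (B X : Finset α)
    {s w R : ℕ} (hw : 0 < w) (hR : 1 ≤ R) (hX : X.card * R ^ w + s ≤ B.card) :
    R ^ s * ((B.powersetCard s).filter fun J => s < w * (J ∩ X).card).card ≤
      2 ^ s * B.card.choose s := by
  set h := s / w + 1 with hh
  have hle : ∀ J ∈ (B.powersetCard s).filter fun J => s < w * (J ∩ X).card,
      J ⊆ B ∧ J.card = s ∧ h ≤ (J ∩ X).card := by
    intro J hJ
    obtain ⟨h1, h2⟩ := Finset.mem_filter.mp hJ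
    obtain ⟨h3, h4⟩ := Finset.mem_powersetCard.mp h1
    exact ⟨h3, h4, Nat.div_lt_of_lt_mul h2⟩
  by_cases hs : s < h
  · have : ((B.powersetCard s).filter fun J => s < w * (J ∩ X).card) = ∅ := by
      apply Finset.eq_empty_of_forall_notMem
      intro J hJ
      obtain ⟨-, h2, h3⟩ := hle J hJ
      have := Finset.card_le_card (Finset.inter_subset_left (s₁ := J) (s₂ := X))
      omega
    rw [this]
    simp
  push Not at hs
  have h1 : ((B.powersetCard s).filter fun J => s < w * (J ∩ X).card).card ≤
      X.card.choose h * B.card.choose (s - h) := by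
    rw [← Finset.card_powersetCard, ← Finset.card_powersetCard, ← Finset.card_product]
    refine le_trans (Finset.card_le_card ?_) (Finset.card_image_le
      (f := fun p : Finset α × Finset α => p.1 ∪ p.2))
    intro J hJ
    obtain ⟨hJB, hJs, hJh⟩ := hle J hJ
    obtain ⟨H, hH, hHc⟩ := Finset.exists_subset_card_eq hJh
    have hHJ : H ⊆ J := hH.trans Finset.inter_subset_left
    refine Finset.mem_image.mpr ⟨(H, J \ H), Finset.mem_product.mpr ⟨?_, ?_⟩, ?_⟩
    · exact Finset.mem_powersetCard.mpr ⟨hH.trans Finset.inter_subset_right, hHc⟩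
    · refine Finset.mem_powersetCard.mpr ⟨Finset.sdiff_subset.trans hJB, ?_⟩
      rw [Finset.card_sdiff_of_subset hHJ, hHc, hJs]
    · exact Finset.union_sdiff_of_subset hHJ
  have h2 : (R ^ w) ^ h * X.card.choose h ≤ (B.card - (s - h)).choose h := by
    have h3 : (R ^ w) ^ h * X.card.choose h ≤ 1 ^ h * (X.card * R ^ w).choose h := by
      apply pow_mul_choose_le_pow_mul_choose
      intro k _
      rw [one_mul, Nat.mul_sub, mul_comm]
      have : 1 ≤ R ^ w := Nat.one_le_pow _ _ (by omega)
      have : k ≤ R ^ w * k := Nat.le_mul_of_pos_left _ (by omega)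
      omega
    rw [one_pow, one_mul] at h3
    refine h3.trans (Nat.choose_le_choose _ (le_trans ?_ (Nat.sub_le_sub_left (Nat.sub_le s h) _)))
    omega
  have h3 : R ^ s ≤ (R ^ w) ^ h := by
    rw [← pow_mul]
    exact Nat.pow_le_pow_right hR (Nat.lt_mul_div_succ s hw).le
  calc _ ≤ (R ^ w) ^ h * (X.card.choose h * B.card.choose (s - h)) := Nat.mul_le_mul h3 h1
    _ = ((R ^ w) ^ h * X.card.choose h) * B.card.choose (s - h) := by ring
    _ ≤ (B.card - (s - h)).choose h * B.card.choose (s - h) := Nat.mul_le_mul_right _ h2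
    _ = B.card.choose s * s.choose (s - h) := by
      rw [Nat.choose_mul (Nat.sub_le s h), Nat.sub_sub_self hs, mul_comm]
    _ ≤ B.card.choose s * 2 ^ s := Nat.mul_le_mul_left _ (Nat.choose_le_two_pow _ _)
    _ = _ := mul_comm _ _

/-- All but a `1 / w` proportion of the elements of `J` lie in an arithmetic progression of size
at most `(1 + 1 / w) * m / 2`. -/
def IsNearProgression (w m s : ℕ) (J : Finset ℤ) : Prop :=
  ∃ T : Finset ℤ, T ⊆ J ∧ w * T.card ≤ s ∧ ∃ a d : ℤ, d ≠ 0 ∧ ∃ L : ℕ,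
    2 * w * L ≤ (w + 1) * m ∧ J \ T ⊆ (Finset.range L).image (fun i : ℕ => a + (i : ℤ) * d)

/-- Sets with doubling very close to `2` are always near a progression. -/
theorem IsNearProgression.of_doubling_near_two {w m : ℕ} {J : Finset ℤ} (hw : 1 ≤ w)
    (hJ : (J + J).card ≤ m) (hs : 1000 * w ≤ J.card) (hm2 : 2 * J.card ≤ m)
    (hm : 200 * w * (m - 2 * J.card) ≤ J.card) : IsNearProgression w m J.card J := by
  obtain ⟨e, he⟩ : ∃ e, m = 2 * J.card + e := ⟨m - 2 * J.card, by omega⟩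
  rw [he, Nat.add_sub_cancel_left] at hm
  have hwe : 200 * e ≤ J.card := le_trans (by nlinarith) hm
  obtain ⟨a, d, hd, L, hL, hsub⟩ := (subset_progression_of_forall_few_missing_sums J (J + J) e (by
    intro v hv
    rw [Finset.filter_eq_empty_iff.mpr]
    · simp
    · intro s hs
      simpa using Finset.add_mem_add hv hs) (by omega)).2 (by omega)
  refine ⟨∅, by simp, by simp, a, d, hd, L, ?_, by simpa using hsub⟩
  have : w * L ≤ w * (J.card + 21 * (e + 1)) := Nat.mul_le_mul_left _ hL
  rw [he]
  nlinarith

/-- A container, of one of the two kinds produced by `hasSumsetContainers`, contains few sets that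
are not near a progression. -/
theorem card_not_isNearProgression_le {w m s q : ℕ} (hw : 1 ≤ w)
    (hq : q = 100000 * (w * 32 ^ w)) (hs : 10 * q ≤ s) (hm : s < 200 * w * (m - 2 * s))
    (S B : Finset ℤ) (hS : (S + S).card ≤ m) (hB : B.card ≤ m / 4 ∨
      2 * q ^ 2 * ((B ×ˢ B).filter fun x => x.1 + x.2 ∉ S + S).card ≤ 2 * B.card ^ 2)
    (F : Finset (Finset ℤ)) (hF : ∀ J ∈ F, J ⊆ B ∧ J.card = s ∧ ¬ IsNearProgression w m s J) :
    (8 * q) ^ s * F.card ≤ (8 * q - 1) ^ s * (m / 2).choose s := by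
  have h32 : 32 ≤ 32 ^ w := Nat.le_self_pow (by omega) _
  have hwq : 3200000 * w ≤ q := by
    have := Nat.mul_le_mul_left w h32
    omega
  set M := m / 2 with hM
  obtain ⟨x, hx⟩ : ∃ x, m = 2 * s + x := by
    refine ⟨m - 2 * s, ?_⟩
    by_contra h
    have : m - 2 * s = 0 := by omega
    rw [this] at hm
    omega
  rw [hx, Nat.add_sub_cancel_left] at hm
  have hMs : (800 * w + 1) * s ≤ 800 * w * M := by
    have : 2 * s + x ≤ 2 * M + 1 := by omega
    have := Nat.mul_le_mul_left (400 * w) this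
    linarith
  have hFB : F ⊆ B.powersetCard s := fun J hJ =>
    Finset.mem_powersetCard.mpr ⟨(hF J hJ).1, (hF J hJ).2.1⟩
  set b := B.card with hb
  by_cases hsmall : 8 * q * b ≤ (8 * q - 1) * M
  · calc (8 * q) ^ s * F.card ≤ (8 * q) ^ s * b.choose s := by
          refine Nat.mul_le_mul_left _ ?_
          rw [hb, ← Finset.card_powersetCard]
          exact Finset.card_le_card hFB
      _ ≤ _ := by
        apply pow_mul_choose_le_pow_mul_choose
        intro k _
        rw [Nat.mul_sub, Nat.mul_sub]
        have : (8 * q - 1) * k ≤ 8 * q * k := Nat.mul_le_mul_right _ (by omega)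
        omega
  have hq1 : 8 * q - 1 + 1 = 8 * q := by omega
  have hlarge : 8 * q * M < 8 * q * b + M := by
    push Not at hsmall
    rw [Nat.sub_mul, one_mul] at hsmall
    omega
  have hsM : s ≤ M := by
    have : 800 * w * s ≤ 800 * w * M := by linarith
    exact Nat.le_of_mul_le_mul_left this (by omega)
  have hbM : 7 * M ≤ 8 * b := by
    have h1 : M ≤ q * M := Nat.le_mul_of_pos_left _ (by omega)
    have h2 : q * (7 * M) ≤ q * (8 * b) := by linarith
    exact Nat.le_of_mul_le_mul_left h2 (by omega)
  replace hB : 2 * q ^ 2 * ((B ×ˢ B).filter fun x => x.1 + x.2 ∉ S + S).card ≤ 2 * b ^ 2 := by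
    rcases hB with h | h
    · omega
    · exact h
  set e := b / q + 1 with he
  have hqpos : 0 < q := by omega
  have hbe : b < q * e := Nat.lt_mul_div_succ b hqpos
  have heb : q * e ≤ b + q := by
    rw [he, mul_add, mul_one]
    have := Nat.mul_div_le b q
    omega
  have hbad : ((B ×ˢ B).filter fun x => x.1 + x.2 ∉ S + S).card ≤ e ^ 2 := by
    have h1 : b ^ 2 ≤ (q * e) ^ 2 := Nat.pow_le_pow_left hbe.le 2
    have h2 : q ^ 2 * ((B ×ˢ B).filter fun x => x.1 + x.2 ∉ S + S).card ≤ q ^ 2 * e ^ 2 := by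
      rw [mul_pow] at h1
      linarith
    exact Nat.le_of_mul_le_mul_left h2 (by positivity)
  have hwe : 100000 * (w * e) ≤ b + q := by
    have := Nat.mul_le_mul_right e hwq
    linarith
  have he1 : e ≤ w * e := Nat.le_mul_of_pos_left _ (by omega)
  obtain ⟨h1, h2⟩ := mostly_subset_progression_of_few_missing_sums B (S + S) e hbad (by omega)
  have hmM : m ≤ 2 * M + 1 := by omega
  obtain ⟨a, d, hd, L, hL, hPe⟩ := h2 (by
    have : 4 * q * (2 * M + 1) ≤ 4 * q * (2 * b + e) := by
      have : M + 4 * q ≤ 4 * b := by omega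
      linarith
    have := Nat.le_of_mul_le_mul_left this (by omega)
    omega)
  set X := B \ (Finset.range L).image (fun i : ℕ => a + (i : ℤ) * d) with hX
  have hLm : 2 * w * L ≤ (w + 1) * m := by
    have h3 : w * L ≤ w * (b + 21 * (e + 1)) := Nat.mul_le_mul_left _ hL
    have h4 : w * (2 * b) ≤ w * (m + 4 * e + 1) := Nat.mul_le_mul_left _ (by omega)
    have h5 : b ≤ m := by omega
    have h6 : q ≤ m := by omega
    linarith
  have hFX : F ⊆ (B.powersetCard s).filter fun J => s < w * (J ∩ X).card := by
    intro J hJ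
    refine Finset.mem_filter.mpr ⟨hFB hJ, ?_⟩
    by_contra hcon
    push Not at hcon
    refine (hF J hJ).2.2 ⟨J ∩ X, Finset.inter_subset_left, hcon, a, d, hd, L, hLm, ?_⟩
    intro v hv
    obtain ⟨hvJ, hv2⟩ := Finset.mem_sdiff.mp hv
    by_contra hvP
    exact hv2 (Finset.mem_inter.mpr ⟨hvJ, Finset.mem_sdiff.mpr ⟨(hF J hJ).1 hvJ, hvP⟩⟩)
  have hwMb : 1000000 * (w * M) ≤ 1000000 * (w * b) + M := by
    rcases le_total M b with h | h
    · have := Nat.mul_le_mul_left w h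
      omega
    · obtain ⟨y, hy⟩ := Nat.exists_eq_add_of_le h
      have := Nat.mul_le_mul_right y hwq
      rw [hy] at hlarge ⊢
      linarith
  have hwMs : w * s * 800 + s ≤ 800 * (w * M) := by linarith
  have hsw : s ≤ w * s := Nat.le_mul_of_pos_left _ (by omega)
  have hMw : M ≤ w * M := Nat.le_mul_of_pos_left _ (by omega)
  obtain ⟨y, hy⟩ := Nat.exists_eq_add_of_le hsM
  have hgap : M ≤ 801 * (w * y) := by
    have : y ≤ w * y := Nat.le_mul_of_pos_left _ (by omega)
    rw [hy] at hMs
    linarith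
  have hwMy : w * M = w * s + w * y := by rw [hy]; ring
  have hb2M : b ≤ 2 * M := by omega
  have hXb : X.card * 32 ^ w + s ≤ b := by
    have h3 : 100000 * (w * (X.card * 32 ^ w)) ≤ b + q := by
      calc _ = q * X.card := by rw [hq]; ring
        _ ≤ q * e := Nat.mul_le_mul_left _ hPe
        _ ≤ _ := heb
    have h4 : w * (X.card * 32 ^ w + s) ≤ w * b := by
      rw [mul_add]
      linarith
    exact Nat.le_of_mul_le_mul_left h4 (by omega)
  have hbs : b + s ≤ 2 * M := by
    have h3 : w * (2 * e + 1 + s) ≤ w * M := by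
      rw [hwMy]
      linarith
    have := Nat.le_of_mul_le_mul_left h3 (by omega)
    omega
  have h3 := pow_mul_card_powersetCard_filter_le B X (by omega) (by omega) hXb
  have h4 : 1 ^ s * b.choose s ≤ 2 ^ s * M.choose s := by
    apply pow_mul_choose_le_pow_mul_choose
    intro k _
    omega
  rw [one_pow, one_mul] at h4
  have h5 : 8 ^ s * F.card ≤ M.choose s := by
    have h6 : 4 ^ s * (8 ^ s * F.card) ≤ 4 ^ s * M.choose s := by
      calc 4 ^ s * (8 ^ s * F.card) = 32 ^ s * F.card := by
            rw [← mul_assoc, ← mul_pow]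
            norm_num
        _ ≤ _ := Nat.mul_le_mul_left _ (Finset.card_le_card hFX)
        _ ≤ 2 ^ s * b.choose s := h3
        _ ≤ 2 ^ s * (2 ^ s * M.choose s) := Nat.mul_le_mul_left _ h4
        _ = 4 ^ s * M.choose s := by
            rw [← mul_assoc, ← mul_pow]
            norm_num
    exact Nat.le_of_mul_le_mul_left h6 (by positivity)
  calc (8 * q) ^ s * F.card = q ^ s * (8 ^ s * F.card) := by rw [mul_pow]; ring
    _ ≤ q ^ s * M.choose s := Nat.mul_le_mul_left _ h5
    _ ≤ _ := Nat.mul_le_mul_right _ (Nat.pow_le_pow_left (by omega) _)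

theorem pow_sub_one_mul_le_pow {k n i : ℕ} (hk : 1 ≤ k) (hn : 1 ≤ n)
    (hi : k * Real.log n ≤ i) : (k - 1) ^ i * n ≤ k ^ i := by
  have hk1 : (1 : ℝ) ≤ k := by exact_mod_cast hk
  have hk0 : (0 : ℝ) < k := by linarith
  have hn0 : (0 : ℝ) < n := by exact_mod_cast hn
  have h1 : ((k - 1 : ℕ) : ℝ) = k * (1 - 1 / k) := by
    rw [Nat.cast_sub hk]
    field_simp
    simp
  have h4 : (0 : ℝ) ≤ 1 - 1 / k := by
    rw [sub_nonneg, div_le_one hk0]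
    exact hk1
  have h2 : (1 - 1 / k : ℝ) ^ i * n ≤ 1 := by
    calc (1 - 1 / k : ℝ) ^ i * n
        ≤ Real.exp (-(1 / k)) ^ i * Real.exp (Real.log n) := by
          rw [Real.exp_log hn0]
          gcongr
          exact Real.one_sub_le_exp_neg _
      _ = Real.exp (Real.log n - i / k) := by
          rw [← Real.exp_nat_mul, ← Real.exp_add]
          congr 1
          ring
      _ ≤ 1 := by
          rw [Real.exp_le_one_iff, sub_nonpos, le_div_iff₀ hk0]
          linarith
  have h3 : ((k - 1 : ℕ) : ℝ) ^ i * n ≤ k ^ i := by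
    rw [h1, mul_pow, mul_assoc]
    exact mul_le_of_le_one_right (by positivity) h2
  exact_mod_cast h3

set_option maxHeartbeats 1000000 in
theorem hasSumsetContainers_of_log_pow_le {E n s : ℕ} {η K : ℝ} (hE : 1 ≤ E) (hη : 0 < η)
    (hη1 : η ≤ 1) (hn : 2 ≤ n) (hK : 2 ≤ K)
    (hKs : K * Real.log n ^ 3 * (20000 * (E : ℝ) ^ 2) ≤ η ^ 2 * s) (B : Finset ℤ)
    (hB : B.card = n) :
    ∃ t : ℕ, HasSumsetContainers ⌊K * s⌋₊ (⌊K * s⌋₊ / 4) E t ∅ B ∧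
      t * Real.log (n + 1) ≤ η * s := by
  set ℓ := Real.log n with hℓdef
  have hn2 : (2 : ℝ) ≤ n := by exact_mod_cast hn
  have hℓ : 1 / 2 < ℓ := by
    have := Real.log_two_gt_d9
    have := Real.log_le_log (by norm_num) hn2
    linarith
  have hE1 : (1 : ℝ) ≤ E := by exact_mod_cast hE
  have hE2 : (E : ℝ) ≤ (E : ℝ) ^ 2 := by nlinarith
  have hs0 : (0 : ℝ) ≤ s := Nat.cast_nonneg s
  have hη2 : η ^ 2 ≤ η := by nlinarith
  have hη2' : η ^ 2 ≤ 1 := by linarith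
  have hℓ2 : (1 / 2) ^ 2 < ℓ ^ 2 := by nlinarith
  have hℓ3 : (1 / 2) ^ 3 < ℓ ^ 3 := by nlinarith
  have hs1 : 5000 * (E : ℝ) ^ 2 ≤ s := by
    have h1 : 1 / 4 ≤ K * ℓ ^ 3 := by nlinarith
    have h2 : 1 / 4 * (20000 * (E : ℝ) ^ 2) ≤ K * ℓ ^ 3 * (20000 * (E : ℝ) ^ 2) :=
      mul_le_mul_of_nonneg_right h1 (by positivity)
    have h3 : η ^ 2 * s ≤ 1 * s := mul_le_mul_of_nonneg_right hη2' hs0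
    linarith
  set m := ⌊K * s⌋₊ with hm
  have hmK : (m : ℝ) ≤ K * s := Nat.floor_le (by positivity)
  have h2s : 2 * s ≤ m := by
    apply Nat.le_floor
    push_cast
    exact mul_le_mul_of_nonneg_right hK hs0
  have hsE : 5000 * E ≤ s := by
    have : 5000 * (E : ℝ) ≤ s := by linarith
    exact_mod_cast this
  set x := η * s / (1072 * (E : ℝ) ^ 2 * ℓ ^ 2) with hx
  have hden : 0 < 1072 * (E : ℝ) ^ 2 * ℓ ^ 2 := by positivity
  have hxeq : x * (1072 * (E : ℝ) ^ 2 * ℓ ^ 2) = η * s := div_mul_cancel₀ _ hden.ne'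
  have hx2 : 2 ≤ x := by
    rw [hx, le_div_iff₀ hden]
    have h1 : η * (2 * (1072 * (E : ℝ) ^ 2 * ℓ ^ 2)) ≤ η * (η * s) := by
      have h4 : ℓ ^ 2 ≤ K * ℓ ^ 3 := by
        have : 1 ≤ K * ℓ := by nlinarith
        calc ℓ ^ 2 = 1 * ℓ ^ 2 := by ring
          _ ≤ K * ℓ * ℓ ^ 2 := mul_le_mul_of_nonneg_right this (by positivity)
          _ = _ := by ring
      have h5 : ℓ ^ 2 * (20000 * (E : ℝ) ^ 2) ≤ K * ℓ ^ 3 * (20000 * (E : ℝ) ^ 2) :=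
        mul_le_mul_of_nonneg_right h4 (by positivity)
      have h6 : 0 ≤ (E : ℝ) ^ 2 * ℓ ^ 2 := by positivity
      calc η * (2 * (1072 * (E : ℝ) ^ 2 * ℓ ^ 2)) ≤ 1 * (2 * (1072 * (E : ℝ) ^ 2 * ℓ ^ 2)) :=
            mul_le_mul_of_nonneg_right hη1 (by positivity)
        _ ≤ η ^ 2 * s := by linarith
        _ = _ := by ring
    exact le_of_mul_le_mul_left h1 hη
  set D := ⌊x⌋₊ with hD
  have hDx : (D : ℝ) ≤ x := Nat.floor_le (by linarith)
  have hDx2 : x / 2 ≤ D := by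
    have := Nat.lt_floor_add_one x
    rw [← hD] at this
    linarith
  have hD1 : 1 ≤ D := by
    apply Nat.le_floor
    push_cast
    linarith
  have hDβ : 2 * E * D ≤ m / 4 := by
    have h1 : 100 * (E * D : ℝ) ≤ s := by
      have h2 : (E : ℝ) * x * (1072 * E * ℓ ^ 2) ≤ s := by
        have : η * s ≤ 1 * s := mul_le_mul_of_nonneg_right hη1 hs0
        linarith
      have h3 : (100 : ℝ) ≤ 1072 * E * ℓ ^ 2 := by nlinarith
      have h4 : (E : ℝ) * x * 100 ≤ E * x * (1072 * E * ℓ ^ 2) :=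
        mul_le_mul_of_nonneg_left h3 (by positivity)
      have h5 : (E : ℝ) * D ≤ E * x := mul_le_mul_of_nonneg_left hDx (by positivity)
      linarith
    have h2 : 100 * (E * D) ≤ s := by exact_mod_cast h1
    rw [mul_assoc]
    omega
  set g := m / 4 / (4 * E) with hg
  have hg4 : 4 * E * g ≤ m / 4 := Nat.mul_div_le _ _
  have hj : m < 64 * E * g := by
    have h1 : m / 4 < 4 * E * (g + 1) := by
      have := Nat.lt_mul_div_succ (m / 4) (show 0 < 4 * E by omega)
      simpa [hg] using this
    rw [mul_add] at h1
    have h2 : 64 * E * g = 16 * (4 * E * g) := by ring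
    omega
  set i := ⌈4 * E * ℓ⌉₊ with hi
  have hi1 : (i : ℝ) < 4 * E * ℓ + 1 := Nat.ceil_lt_add_one (by positivity)
  have hi2 : 4 * E * ℓ ≤ i := Nat.le_ceil _
  have hpow : (4 * E - 1) ^ i * B.card ≤ (4 * E) ^ i * (m / 4) := by
    rw [hB]
    exact (pow_sub_one_mul_le_pow (by omega) (by omega) (by push_cast; exact hi2)).trans
      (Nat.le_mul_of_pos_right _ (by omega))
  have hp : m < (m / D + 1) * D := by
    have := Nat.lt_mul_div_succ m hD1
    rwa [mul_comm] at this
  refine ⟨2 * E * D * (i + 64 * E) + (m / D + 1),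
    hasSumsetContainers hE hD1 hDβ hg4 (i + 64 * E) i (64 * E) (m / D + 1) ∅ B rfl
      (Finset.empty_subset _) hpow (by omega) (by omega), ?_⟩
  have hlog : Real.log (n + 1) ≤ 2 * ℓ := by
    have : Real.log (n + 1) ≤ Real.log ((n : ℝ) ^ 2) :=
      Real.log_le_log (by positivity) (by nlinarith)
    rwa [Real.log_pow] at this
  have hr : (i : ℝ) + 64 * E ≤ 134 * E * ℓ := by nlinarith
  have hfirst : (2 * E * D * (i + 64 * E) : ℝ) * (2 * ℓ) ≤ η * s / 2 := by
    calc (2 * E * D * (i + 64 * E) : ℝ) * (2 * ℓ)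
        ≤ (2 * E * x * (134 * E * ℓ)) * (2 * ℓ) := by gcongr
      _ = x * (1072 * (E : ℝ) ^ 2 * ℓ ^ 2) / 2 := by ring
      _ = _ := by rw [hxeq]
  have hsecond : ((m / D : ℕ) + 1 : ℝ) * (2 * ℓ) ≤ η * s / 2 := by
    have hη3 : η * (((m / D : ℕ) : ℝ) * (2 * ℓ)) ≤ η * (η * s * (4288 / 20000)) := by
      have h1 : ((m / D : ℕ) : ℝ) * D ≤ K * s := by
        have : ((m / D * D : ℕ) : ℝ) ≤ m := by exact_mod_cast Nat.div_mul_le_self m D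
        push_cast at this
        linarith
      have h2 : ((m / D : ℕ) : ℝ) * x ≤ 2 * (K * s) := by
        have := mul_le_mul_of_nonneg_left hDx2 (Nat.cast_nonneg (α := ℝ) (m / D))
        linarith
      have h3 : s * (((m / D : ℕ) : ℝ) * η) ≤ s * (2 * K * (1072 * (E : ℝ) ^ 2 * ℓ ^ 2)) := by
        have := mul_le_mul_of_nonneg_right h2 hden.le
        rw [mul_assoc, hxeq] at this
        linarith
      have h4 : ((m / D : ℕ) : ℝ) * η ≤ 2 * K * (1072 * (E : ℝ) ^ 2 * ℓ ^ 2) :=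
        le_of_mul_le_mul_left h3 (by linarith)
      have h5 := mul_le_mul_of_nonneg_right h4 (show 0 ≤ 2 * ℓ by linarith)
      linarith
    have h6 := le_of_mul_le_mul_left hη3 hη
    have h7 : 2 * ℓ * 2500 ≤ η * s := by
      have h8 : ℓ * 2 ≤ 4 * (K * ℓ ^ 3) := by
        have : 1 / 2 ≤ K * ℓ ^ 2 := by nlinarith
        have := mul_le_mul_of_nonneg_left this (show 0 ≤ ℓ by linarith)
        linarith
      have h9 : K * ℓ ^ 3 * 20000 ≤ K * ℓ ^ 3 * (20000 * (E : ℝ) ^ 2) := by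
        apply mul_le_mul_of_nonneg_left _ (by positivity)
        nlinarith
      have h10 : η ^ 2 * s ≤ η * s := mul_le_mul_of_nonneg_right hη2 hs0
      linarith
    linarith
  have ht0 : (0 : ℝ) ≤ (2 * E * D * (i + 64 * E) + (m / D + 1) : ℕ) := Nat.cast_nonneg _
  calc _ ≤ ((2 * E * D * (i + 64 * E) + (m / D + 1) : ℕ) : ℝ) * (2 * ℓ) :=
        mul_le_mul_of_nonneg_left hlog ht0
    _ = (2 * E * D * (i + 64 * E) : ℝ) * (2 * ℓ) + ((m / D : ℕ) + 1 : ℝ) * (2 * ℓ) := by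
        push_cast
        ring
    _ ≤ _ := by linarith

theorem HasSumsetContainers.card_not_isNearProgression_le {w m s q t : ℕ} {A : Finset ℤ}
    (hA : HasSumsetContainers m (m / 4) (2 * q ^ 2) t ∅ A) (hw : 1 ≤ w)
    (hq : q = 100000 * (w * 32 ^ w)) (hs : 10 * q ≤ s) (hm : s < 200 * w * (m - 2 * s))
    (F : Finset (Finset ℤ))
    (hF : ∀ J ∈ F, J ⊆ A ∧ J.card = s ∧ (J + J).card ≤ m ∧ ¬ IsNearProgression w m s J) :
    (8 * q) ^ s * F.card ≤ (A.card + 1) ^ t * ((8 * q - 1) ^ s * (m / 2).choose s) := by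
  classical
  obtain ⟨C, hCcard, hC, hcover⟩ := hA
  have hsub : F ⊆ C.biUnion fun p => F.filter fun J => J ⊆ p.2 := by
    intro J hJ
    obtain ⟨p, hp, -, hJp⟩ := hcover J (Finset.empty_subset _) (hF J hJ).1 (hF J hJ).2.2.1
    exact Finset.mem_biUnion.mpr ⟨p, hp, Finset.mem_filter.mpr ⟨hJ, hJp⟩⟩
  have h1 : ∀ p ∈ C, (8 * q) ^ s * (F.filter fun J => J ⊆ p.2).card ≤
      (8 * q - 1) ^ s * (m / 2).choose s := by
    intro p hp
    refine _root_.card_not_isNearProgression_le hw hq hs hm p.1 p.2 (hC p hp).1 (hC p hp).2 _ ?_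
    intro J hJ
    obtain ⟨hJF, hJp⟩ := Finset.mem_filter.mp hJ
    exact ⟨hJp, (hF J hJF).2.1, (hF J hJF).2.2.2⟩
  calc (8 * q) ^ s * F.card
      ≤ (8 * q) ^ s * ∑ p ∈ C, (F.filter fun J => J ⊆ p.2).card :=
        Nat.mul_le_mul_left _ ((Finset.card_le_card hsub).trans Finset.card_biUnion_le)
    _ = ∑ p ∈ C, (8 * q) ^ s * (F.filter fun J => J ⊆ p.2).card := Finset.mul_sum _ _ _
    _ ≤ ∑ p ∈ C, (8 * q - 1) ^ s * (m / 2).choose s := Finset.sum_le_sum h1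
    _ = C.card * ((8 * q - 1) ^ s * (m / 2).choose s) := by
        rw [Finset.sum_const, smul_eq_mul]
    _ ≤ _ := Nat.mul_le_mul_right _ hCcard

theorem choose_le_card_filter_card_add_self_le {n m s : ℕ} (hmn : m / 2 ≤ n) :
    (m / 2).choose s ≤ ((Finset.Icc 1 (n : ℤ)).powerset.filter fun J =>
      J.card = s ∧ (J + J).card ≤ m).card := by
  have h : ((Finset.Icc 1 ((m / 2 : ℕ) : ℤ)).powersetCard s).card = (m / 2).choose s := by
    rw [Finset.card_powersetCard, Int.card_Icc]
    congr 1
    omega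
  rw [← h]
  apply Finset.card_le_card
  intro J hJ
  obtain ⟨hJM, hJs⟩ := Finset.mem_powersetCard.mp hJ
  refine Finset.mem_filter.mpr ⟨Finset.mem_powerset.mpr (hJM.trans ?_), hJs, ?_⟩
  · exact Finset.Icc_subset_Icc_right (by exact_mod_cast hmn)
  · have hsub : J + J ⊆ Finset.Icc 2 (m : ℤ) := by
      intro v hv
      obtain ⟨a, ha, b, hb, rfl⟩ := Finset.mem_add.mp hv
      have h1 := Finset.mem_Icc.mp (hJM ha)
      have h2 := Finset.mem_Icc.mp (hJM hb)
      exact Finset.mem_Icc.mpr ⟨by omega, by omega⟩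
    have := Finset.card_le_card hsub
    rw [Int.card_Icc] at this
    omega

open Classical in
theorem card_filter_not_isNearProgression_le {w q n s : ℕ} {K : ℝ} (hw : 1 ≤ w)
    (hq : q = 100000 * (w * 32 ^ w)) (hn : 2 ≤ n) (hK : 2 ≤ K)
    (hKs : K * Real.log n ^ 3 * (20000 * ((2 * q ^ 2 : ℕ) : ℝ) ^ 2) ≤
      (1 / (16 * (q : ℝ))) ^ 2 * s) :
    w * (((Finset.Icc 1 (n : ℤ)).powerset.filter fun J =>
      (J.card = s ∧ (J + J).card ≤ ⌊K * s⌋₊) ∧ ¬ IsNearProgression w ⌊K * s⌋₊ s J).card : ℝ) ≤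
      ((Finset.Icc 1 (n : ℤ)).powerset.filter fun J =>
        J.card = s ∧ (J + J).card ≤ ⌊K * s⌋₊).card := by
  have hwq : 100000 * w ≤ q := by
    rw [hq]
    exact Nat.mul_le_mul_left _ (Nat.le_mul_of_pos_right _ (by positivity))
  have hq1 : (1 : ℝ) ≤ q := by
    have : 1 ≤ q := by omega
    exact_mod_cast this
  have hs0 : (0 : ℝ) ≤ s := Nat.cast_nonneg s
  have hs : 20 * (q : ℝ) ^ 2 ≤ s := by
    have hℓ : 1 / 2 < Real.log n := by
      have h1 := Real.log_two_gt_d9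
      have h2 := Real.log_le_log (by norm_num) (show (2 : ℝ) ≤ n by exact_mod_cast hn)
      linarith
    have hℓ3 : (1 / 2) ^ 3 ≤ Real.log n ^ 3 := by gcongr
    have h1 : 1 / 4 ≤ K * Real.log n ^ 3 := by nlinarith
    have h2 : (1 / (16 * (q : ℝ))) ^ 2 * s ≤ 1 * s := by
      apply mul_le_mul_of_nonneg_right _ hs0
      apply pow_le_one₀ (by positivity)
      rw [div_le_one (by positivity)]
      linarith
    have h3 : 1 / 4 * (20000 * ((2 * q ^ 2 : ℕ) : ℝ) ^ 2) ≤
        K * Real.log n ^ 3 * (20000 * ((2 * q ^ 2 : ℕ) : ℝ) ^ 2) :=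
      mul_le_mul_of_nonneg_right h1 (by positivity)
    push_cast at h3 hKs
    have h4 : (q : ℝ) ^ 2 ≤ (q : ℝ) ^ 4 := pow_le_pow_right₀ hq1 (by norm_num)
    nlinarith
  have hsq : 10 * q ≤ s := by
    have : 10 * (q : ℝ) ≤ s := by nlinarith
    exact_mod_cast this
  set m := ⌊K * s⌋₊ with hm
  have h2s : 2 * s ≤ m := by
    apply Nat.le_floor
    push_cast
    exact mul_le_mul_of_nonneg_right hK hs0
  set F := (Finset.Icc 1 (n : ℤ)).powerset.filter fun J =>
    (J.card = s ∧ (J + J).card ≤ m) ∧ ¬ IsNearProgression w m s J with hF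
  rcases Nat.lt_or_ge s (200 * w * (m - 2 * s)) with hms | hms
  swap
  · have hF0 : F = ∅ := by
      rw [hF, Finset.filter_eq_empty_iff]
      rintro J - ⟨⟨hJs, hJm⟩, hJ⟩
      subst hJs
      exact hJ (IsNearProgression.of_doubling_near_two hw hJm (by omega) h2s hms)
    rw [hF0]
    simp
  rcases Nat.lt_or_ge ((w + 1) * m) (2 * w * n) with hmn | hmn
  swap
  · have hF0 : F = ∅ := by
      rw [hF, Finset.filter_eq_empty_iff]
      rintro J hJn ⟨-, hJ⟩
      refine hJ ⟨∅, Finset.empty_subset _, by simp, 1, 1, one_ne_zero, n, hmn, ?_⟩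
      intro v hv
      have hv1 := Finset.mem_Icc.mp (Finset.mem_powerset.mp hJn (Finset.mem_sdiff.mp hv).1)
      refine Finset.mem_image.mpr ⟨(v - 1).toNat, Finset.mem_range.mpr ?_, ?_⟩ <;> omega
    rw [hF0]
    simp
  have hmn2 : m / 2 ≤ n := by
    have h1 : w * m < w * (2 * n) := by
      have : w * m ≤ (w + 1) * m := Nat.mul_le_mul_right _ (by omega)
      have h3 : w * (2 * n) = 2 * w * n := by ring
      omega
    have := Nat.lt_of_mul_lt_mul_left h1
    omega
  have hAcard : (Finset.Icc 1 (n : ℤ)).card = n := by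
    rw [Int.card_Icc]
    omega
  obtain ⟨t, ht, htn⟩ := hasSumsetContainers_of_log_pow_le (E := 2 * q ^ 2)
    (Nat.mul_pos two_pos (pow_pos (by omega) 2)) (by positivity)
    (by rw [div_le_one (by positivity)]; linarith) hn hK hKs (Finset.Icc 1 (n : ℤ)) hAcard
  have hmain := ht.card_not_isNearProgression_le hw hq hsq hms F (by
    intro J hJ
    obtain ⟨hJn, ⟨hJs, hJm⟩, hJ⟩ := Finset.mem_filter.mp hJ
    exact ⟨Finset.mem_powerset.mp hJn, hJs, hJm, hJ⟩)
  rw [hAcard] at hmain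
  have hchoose := choose_le_card_filter_card_add_self_le (s := s) hmn2
  set N := ((Finset.Icc 1 (n : ℤ)).powerset.filter fun J =>
    J.card = s ∧ (J + J).card ≤ m).card
  have hmainR : (8 * q : ℝ) ^ s * F.card ≤
      (n + 1 : ℝ) ^ t * (((8 * q - 1 : ℕ) : ℝ) ^ s * N) := by
    have := hmain.trans (Nat.mul_le_mul_left _ (Nat.mul_le_mul_left _ hchoose))
    rw [← Nat.cast_le (α := ℝ)] at this
    simpa only [Nat.cast_mul, Nat.cast_pow, Nat.cast_add, Nat.cast_one, Nat.cast_ofNat] using this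
  have hsplit : (((8 * q - 1 : ℕ) : ℝ)) = 8 * q * (1 - 1 / (8 * q)) := by
    rw [Nat.cast_sub (by omega)]
    push_cast
    field_simp
  have hFN : (F.card : ℝ) ≤ (n + 1 : ℝ) ^ t * (1 - 1 / (8 * q)) ^ s * N := by
    rw [hsplit, mul_pow _ (1 - 1 / (8 * (q : ℝ)))] at hmainR
    refine le_of_mul_le_mul_left ?_ (show (0 : ℝ) < (8 * q) ^ s by positivity)
    linarith
  have hexp : (n + 1 : ℝ) ^ t * (1 - 1 / (8 * q)) ^ s ≤ Real.exp (-(s / (16 * q))) := by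
    have h1 : (1 - 1 / (8 * q) : ℝ) ≤ Real.exp (-(1 / (8 * q))) := Real.one_sub_le_exp_neg _
    have h2 : (0 : ℝ) ≤ 1 - 1 / (8 * q) := by
      rw [sub_nonneg, div_le_one (by positivity)]
      linarith
    calc (n + 1 : ℝ) ^ t * (1 - 1 / (8 * q)) ^ s
        ≤ (n + 1 : ℝ) ^ t * Real.exp (-(1 / (8 * q))) ^ s := by gcongr
      _ = Real.exp (t * Real.log (n + 1)) * Real.exp (-(1 / (8 * q))) ^ s := by
          rw [Real.exp_nat_mul, Real.exp_log (by positivity)]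
      _ = Real.exp (t * Real.log (n + 1) - s / (8 * q)) := by
          rw [← Real.exp_nat_mul, ← Real.exp_add]
          congr 1
          ring
      _ ≤ _ := by
          rw [Real.exp_le_exp]
          have : (s : ℝ) / (8 * q) = 1 / (16 * q) * s + s / (16 * q) := by
            field_simp
            ring
          linarith
  have hw_exp : w * Real.exp (-(s / (16 * (q : ℝ)))) ≤ 1 := by
    have h1 : (q : ℝ) ≤ s / (16 * q) := by
      rw [le_div_iff₀ (by positivity)]
      nlinarith
    have h2 : (w : ℝ) ≤ q := by
      have : w ≤ q := by omega
      exact_mod_cast this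
    have h3 := Real.add_one_le_exp (s / (16 * (q : ℝ)))
    rw [Real.exp_neg, ← div_eq_mul_inv, div_le_one (Real.exp_pos _)]
    linarith
  calc (w : ℝ) * F.card ≤ w * ((n + 1 : ℝ) ^ t * (1 - 1 / (8 * q)) ^ s * N) := by gcongr
    _ ≤ w * (Real.exp (-(s / (16 * q))) * N) := by gcongr
    _ = w * Real.exp (-(s / (16 * q))) * N := by ring
    _ ≤ 1 * N := by gcongr
    _ = N := one_mul _

/-- For every `δ > 0` there exists `c > 0` such that for all integers
`n ≥ 2`, `s ≥ 1` and every real `K` with `2 ≤ K ≤ c·s/(log n)^3`, all but a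
`δ`-fraction of the sets `J ⊆ [n]` with `|J| = s` and `|J+J| ≤ K·s` admit a subset
`T ⊆ J` with `|T| ≤ δs` such that `J \ T` is contained in an arithmetic progression
of size at most `(1+δ)Ks/2`. -/
theorem typical_structure_small_doubling :
    ∀ δ : ℝ, 0 < δ → ∃ c : ℝ, 0 < c ∧
      ∀ n s : ℕ, 2 ≤ n → 1 ≤ s →
      ∀ K : ℝ, 2 ≤ K → K ≤ c * s / (Real.log n) ^ 3 →
      (Nat.card {J : Finset ℤ | J ⊆ Finset.Icc 1 (n : ℤ) ∧ J.card = s ∧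
            ((J + J).card : ℝ) ≤ K * s} : ℝ) -
        (Nat.card {J : Finset ℤ | (J ⊆ Finset.Icc 1 (n : ℤ) ∧ J.card = s ∧
            ((J + J).card : ℝ) ≤ K * s) ∧
            ∃ T : Finset ℤ, T ⊆ J ∧ ((T.card : ℝ) ≤ δ * s) ∧
              ∃ a d : ℤ, d ≠ 0 ∧ ∃ L : ℕ, ((L : ℝ) ≤ (1 + δ) * K * s / 2) ∧
                J \ T ⊆ (Finset.range L).image (fun i : ℕ => a + (i : ℤ) * d)} : ℝ) ≤
      δ * (Nat.card {J : Finset ℤ | J ⊆ Finset.Icc 1 (n : ℤ) ∧ J.card = s ∧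
            ((J + J).card : ℝ) ≤ K * s} : ℝ) := by
  classical
  intro δ hδ
  obtain ⟨w, hwδ⟩ := exists_nat_ge (1 / δ)
  have hwδ1 : 1 ≤ w * δ := (div_le_iff₀ hδ).mp hwδ
  have hw : 1 ≤ w := by
    rcases Nat.eq_zero_or_pos w with h | h
    · rw [h] at hwδ1
      norm_num at hwδ1
    · exact h
  have hwpos : (0 : ℝ) < w := by exact_mod_cast hw
  obtain ⟨q, hq⟩ : ∃ q, q = 100000 * (w * 32 ^ w) := ⟨_, rfl⟩
  have hqpos : 0 < q := by rw [hq]; positivity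
  have hqpos' : (0 : ℝ) < q := by exact_mod_cast hqpos
  refine ⟨(1 / (16 * (q : ℝ))) ^ 2 / (20000 * ((2 * q ^ 2 : ℕ) : ℝ) ^ 2), by positivity, ?_⟩
  intro n s hn _ K hK hKc
  have hℓ : 0 < Real.log n := Real.log_pos (by exact_mod_cast hn)
  have hKs : K * Real.log n ^ 3 * (20000 * ((2 * q ^ 2 : ℕ) : ℝ) ^ 2) ≤
      (1 / (16 * (q : ℝ))) ^ 2 * s := by
    rw [le_div_iff₀ (by positivity), div_mul_eq_mul_div, le_div_iff₀ (by positivity)] at hKc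
    exact hKc
  have hbad := card_filter_not_isNearProgression_le hw hq hn hK hKs
  have hfloor : ∀ J : Finset ℤ, ((J + J).card : ℝ) ≤ K * s ↔ (J + J).card ≤ ⌊K * s⌋₊ :=
    fun J => (Nat.le_floor_iff (by positivity)).symm
  set 𝒥 := (Finset.Icc 1 (n : ℤ)).powerset.filter fun J =>
    J.card = s ∧ (J + J).card ≤ ⌊K * s⌋₊ with h𝒥
  set 𝒩 := (Finset.Icc 1 (n : ℤ)).powerset.filter fun J =>
    (J.card = s ∧ (J + J).card ≤ ⌊K * s⌋₊) ∧ ¬ IsNearProgression w ⌊K * s⌋₊ s J with h𝒩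
  have hall : {J : Finset ℤ | J ⊆ Finset.Icc 1 (n : ℤ) ∧ J.card = s ∧
      ((J + J).card : ℝ) ≤ K * s} = (𝒥 : Set (Finset ℤ)) := by
    ext J
    simp [h𝒥, hfloor]
  rw [hall, Nat.card_coe_set_eq, Nat.card_coe_set_eq, Set.ncard_coe_finset]
  set G := {J : Finset ℤ | (J ⊆ Finset.Icc 1 (n : ℤ) ∧ J.card = s ∧
      ((J + J).card : ℝ) ≤ K * s) ∧ ∃ T : Finset ℤ, T ⊆ J ∧ ((T.card : ℝ) ≤ δ * s) ∧
        ∃ a d : ℤ, d ≠ 0 ∧ ∃ L : ℕ, ((L : ℝ) ≤ (1 + δ) * K * s / 2) ∧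
          J \ T ⊆ (Finset.range L).image (fun i : ℕ => a + (i : ℤ) * d)} with hG
  have hGfin : G.Finite := 𝒥.finite_toSet.subset fun J hJ => hall ▸ hJ.1
  have hcover : (𝒥 : Set (Finset ℤ)) ⊆ G ∪ (𝒩 : Set (Finset ℤ)) := by
    intro J hJ
    have hJ' := hJ
    rw [← hall] at hJ'
    by_cases hnear : IsNearProgression w ⌊K * s⌋₊ s J
    · left
      obtain ⟨T, hT, hTs, a, d, hd, L, hL, hsub⟩ := hnear
      refine ⟨hJ', T, hT, ?_, a, d, hd, L, ?_, hsub⟩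
      · have h1 : (w : ℝ) * T.card ≤ s := by exact_mod_cast hTs
        have h2 : (s : ℝ) ≤ w * (δ * s) := by
          have := mul_le_mul_of_nonneg_right hwδ1 (Nat.cast_nonneg (α := ℝ) s)
          linarith
        exact le_of_mul_le_mul_left (h1.trans h2) hwpos
      · have h1 : (2 * w * L : ℝ) ≤ (w + 1) * ⌊K * s⌋₊ := by exact_mod_cast hL
        have h2 : (⌊K * s⌋₊ : ℝ) ≤ K * s := Nat.floor_le (by positivity)
        have h3 : ((w : ℝ) + 1) * ⌊K * s⌋₊ ≤ (w + w * δ) * (K * s) := by gcongr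
        refine le_of_mul_le_mul_left ?_ hwpos
        linarith
    · right
      obtain ⟨hJn, hJm⟩ := Finset.mem_filter.mp (Finset.mem_coe.mp hJ)
      exact Finset.mem_coe.mpr (Finset.mem_filter.mpr ⟨hJn, hJm, hnear⟩)
  have hcount : 𝒥.card ≤ G.ncard + 𝒩.card := by
    rw [← Set.ncard_coe_finset 𝒥, ← Set.ncard_coe_finset 𝒩]
    exact (Set.ncard_le_ncard hcover (hGfin.union 𝒩.finite_toSet)).trans (Set.ncard_union_le _ _)
  have hcountR : (𝒥.card : ℝ) ≤ G.ncard + 𝒩.card := by exact_mod_cast hcount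
  have h𝒩 : (𝒩.card : ℝ) ≤ δ * 𝒥.card := by
    have h1 : (𝒩.card : ℝ) ≤ w * δ * 𝒩.card :=
      le_mul_of_one_le_left (Nat.cast_nonneg _) hwδ1
    have h2 := mul_le_mul_of_nonneg_left hbad hδ.le
    linarith
  linarith
end
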